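/- For every function f : ℕ → ℝ satisfying f(n) → ∞ as n → ∞ and 1 ≤ f(n) ≤ log log log n for all sufficiently large n, there exist a constant c > 0, N ∈ ℕ, and for each n ≥ N a symmetric generating set S_n of Sym(n) consisting of transpositions together with weights W_n = (w_n(s) : s ∈ S_n) satisfying 1 ≤ w_n(s) ≤ 1 + (f(n!)/log log n)^{1/4} for all s ∈ S_n, such that mix(Cay(Sym(n),S_n,W_n)) ≥ c · mix(Cay(Sym(n),S_n)) · f(n!). -/

import Mathlib

open Finset Filter

/-- A symmetric generating set of a group: does not contain the identity, is closed under
inverses, and generates the group. -/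
def IsSymmGen {G : Type*} [Group G] (S : Finset G) : Prop :=
  (1 : G) ∉ S ∧ (∀ s ∈ S, s⁻¹ ∈ S) ∧ Subgroup.closure (S : Set G) = ⊤

/-- Transition matrix of the lazy weighted random walk on the Cayley graph `Cay(G,S,W)`:
`P(g,g) = 1/2` and `P(g,gs) = w(s)/(2 ∑_{r∈S} w(r))` for `s ∈ S`. -/
noncomputable def lazyCayleyWP {G : Type*} [Group G] [Fintype G] [DecidableEq G]
    (S : Finset G) (w : G → ℝ) : Matrix G G ℝ :=
  fun g h => if h = g then 1 / 2
    else if g⁻¹ * h ∈ S then w (g⁻¹ * h) / (2 * ∑ r ∈ S, w r) else 0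

/-- Total variation mixing time of a discrete-time chain with transition matrix `P` whose
stationary distribution is uniform. -/
noncomputable def tvMixUnif {G : Type*} [Fintype G] [DecidableEq G] (P : Matrix G G ℝ) : ℕ :=
  sInf {t : ℕ | ∀ x : G, (∑ y : G, |(P ^ t) x y - 1 / (Fintype.card G : ℝ)|) / 2 ≤ 1 / 4}

/-! ### Random walks on groups -/
section groupWalk
variable {G : Type*} [Group G] [Fintype G] [DecidableEq G]

theorem lcw_apply (S : Finset G) (w : G → ℝ) (h1 : (1 : G) ∉ S) (F : G → ℝ) (x : G) :
    ∑ y, lazyCayleyWP S w x y * F y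
      = 1 / 2 * F x + 1 / (2 * ∑ r ∈ S, w r) * ∑ s ∈ S, w s * F (x * s) := by
  rw [← Equiv.sum_comp (Equiv.mulLeft x)]
  have key : ∀ s : G, lazyCayleyWP S w x (x * s) * F (x * s)
      = (if s = 1 then 1 / 2 * F x else 0)
        + (if s ∈ S then 1 / (2 * ∑ r ∈ S, w r) * (w s * F (x * s)) else 0) := by
    intro s
    unfold lazyCayleyWP
    by_cases hs : s = 1
    · subst hs; simp [h1]
    · have : ¬ (x * s = x) := by simpa using hs
      by_cases hS : s ∈ S
      · simp [hs, hS]; ring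
      · simp [hs, hS]
  simp only [Equiv.coe_mulLeft]
  rw [Finset.sum_congr rfl (fun s _ => key s), Finset.sum_add_distrib]
  simp [Finset.mul_sum]

theorem lcw_inv (S : Finset G) (w : G → ℝ) (g x y : G) :
    lazyCayleyWP S w (g * x) (g * y) = lazyCayleyWP S w x y := by
  unfold lazyCayleyWP
  simp [mul_assoc]

theorem lcw_pow_inv (S : Finset G) (w : G → ℝ) (t : ℕ) (g x y : G) :
    (lazyCayleyWP S w ^ t) (g * x) (g * y) = (lazyCayleyWP S w ^ t) x y := by
  induction t generalizing x y with
  | zero => simp [Matrix.one_apply]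
  | succ t ih =>
    rw [pow_succ', Matrix.mul_apply, Matrix.mul_apply, ← Equiv.sum_comp (Equiv.mulLeft g)]
    refine Finset.sum_congr rfl fun z _ => ?_
    simp only [Equiv.coe_mulLeft]
    rw [ih, lcw_inv]

theorem lcw_nonneg (S : Finset G) (w : G → ℝ) (hw : ∀ s ∈ S, 0 ≤ w s) (x y : G) :
    0 ≤ lazyCayleyWP S w x y := by
  unfold lazyCayleyWP
  split_ifs with h1 h2
  · norm_num
  · exact div_nonneg (hw _ h2) (mul_nonneg (by norm_num) (Finset.sum_nonneg hw))
  · exact le_rfl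

theorem lcw_pow_nonneg (S : Finset G) (w : G → ℝ) (hw : ∀ s ∈ S, 0 ≤ w s) (t : ℕ) (x y : G) :
    0 ≤ (lazyCayleyWP S w ^ t) x y := by
  induction t generalizing x y with
  | zero => simp only [pow_zero, Matrix.one_apply]; split_ifs <;> norm_num
  | succ t ih =>
    rw [pow_succ', Matrix.mul_apply]
    exact Finset.sum_nonneg fun z _ => mul_nonneg (lcw_nonneg S w hw _ _) (ih _ _)

theorem lcw_row (S : Finset G) (w : G → ℝ) (h1 : (1 : G) ∉ S) (hZ : ∑ r ∈ S, w r ≠ 0) (x : G) :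
    ∑ y, lazyCayleyWP S w x y = 1 := by
  have := lcw_apply S w h1 (fun _ => 1) x
  simp only [mul_one] at this
  rw [this]; field_simp; norm_num

theorem lcw_pow_row (S : Finset G) (w : G → ℝ) (h1 : (1 : G) ∉ S) (hZ : ∑ r ∈ S, w r ≠ 0)
    (t : ℕ) (x : G) : ∑ y, (lazyCayleyWP S w ^ t) x y = 1 := by
  induction t generalizing x with
  | zero => simp [Matrix.one_apply]
  | succ t ih =>
    simp only [pow_succ', Matrix.mul_apply]
    rw [Finset.sum_comm]
    simp only [← Finset.mul_sum, ih, mul_one]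
    exact lcw_row S w h1 hZ x

theorem lcw_pow_col (S : Finset G) (w : G → ℝ) (h1 : (1 : G) ∉ S) (hZ : ∑ r ∈ S, w r ≠ 0)
    (t : ℕ) (y : G) : ∑ x, (lazyCayleyWP S w ^ t) x y = 1 := by
  rw [← lcw_pow_row S w h1 hZ t 1]
  rw [← Equiv.sum_comp ((Equiv.inv G).trans (Equiv.mulLeft y))]
  refine Finset.sum_congr rfl fun z _ => ?_
  have := lcw_pow_inv S w t (y * z⁻¹) 1 z
  simpa using this

/-- Total variation distance between the time `t` laws started at `x` and `y`. -/
noncomputable def wdist (S : Finset G) (w : G → ℝ) (t : ℕ) (x y : G) : ℝ :=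
  (∑ z, |(lazyCayleyWP S w ^ t) x z - (lazyCayleyWP S w ^ t) y z|) / 2

theorem wdist_nonneg (S : Finset G) (w : G → ℝ) (t : ℕ) (x y : G) : 0 ≤ wdist S w t x y :=
  div_nonneg (Finset.sum_nonneg fun _ _ => abs_nonneg _) (by norm_num)

theorem wdist_self (S : Finset G) (w : G → ℝ) (t : ℕ) (x : G) : wdist S w t x x = 0 := by
  simp [wdist]

theorem wdist_comm (S : Finset G) (w : G → ℝ) (t : ℕ) (x y : G) :
    wdist S w t x y = wdist S w t y x := by
  unfold wdist; simp only [abs_sub_comm]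

theorem wdist_triangle (S : Finset G) (w : G → ℝ) (t : ℕ) (x y z : G) :
    wdist S w t x z ≤ wdist S w t x y + wdist S w t y z := by
  unfold wdist
  rw [← add_div, ← Finset.sum_add_distrib]
  gcongr
  exact abs_sub_le _ _ _

theorem wdist_inv (S : Finset G) (w : G → ℝ) (t : ℕ) (g x y : G) :
    wdist S w t (g * x) (g * y) = wdist S w t x y := by
  unfold wdist
  rw [← Equiv.sum_comp (Equiv.mulLeft g)]
  simp only [Equiv.coe_mulLeft, lcw_pow_inv]

theorem wdist_le_one (S : Finset G) (w : G → ℝ) (hw : ∀ s ∈ S, 0 ≤ w s) (h1 : (1 : G) ∉ S)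
    (hZ : ∑ r ∈ S, w r ≠ 0) (t : ℕ) (x y : G) : wdist S w t x y ≤ 1 := by
  unfold wdist
  have : ∑ z, |(lazyCayleyWP S w ^ t) x z - (lazyCayleyWP S w ^ t) y z|
      ≤ ∑ z, ((lazyCayleyWP S w ^ t) x z + (lazyCayleyWP S w ^ t) y z) := by
    refine Finset.sum_le_sum fun z _ => ?_
    have h1 := lcw_pow_nonneg S w hw t x z
    have h2 := lcw_pow_nonneg S w hw t y z
    rw [abs_le]; constructor <;> linarith
  rw [Finset.sum_add_distrib, lcw_pow_row S w h1 hZ, lcw_pow_row S w h1 hZ] at this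
  linarith

theorem wdist_succ_le (S : Finset G) (w : G → ℝ) (hw : ∀ s ∈ S, 0 ≤ w s) (h1 : (1 : G) ∉ S)
    (hZ : ∑ r ∈ S, w r ≠ 0) (t : ℕ) (x y : G) : wdist S w (t + 1) x y ≤ wdist S w t x y := by
  unfold wdist
  gcongr ?_ / 2
  calc ∑ z, |(lazyCayleyWP S w ^ (t + 1)) x z - (lazyCayleyWP S w ^ (t + 1)) y z|
      ≤ ∑ z, ∑ u, |(lazyCayleyWP S w ^ t) x u - (lazyCayleyWP S w ^ t) y u|
          * lazyCayleyWP S w u z := by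
        refine Finset.sum_le_sum fun z _ => ?_
        rw [pow_succ, Matrix.mul_apply, Matrix.mul_apply, ← Finset.sum_sub_distrib]
        refine (Finset.abs_sum_le_sum_abs _ _).trans (Finset.sum_le_sum fun u _ => ?_)
        rw [← sub_mul, abs_mul, abs_of_nonneg (lcw_nonneg S w hw u z)]
    _ = _ := by
        rw [Finset.sum_comm]
        refine Finset.sum_congr rfl fun u _ => ?_
        rw [← Finset.mul_sum, lcw_row S w h1 hZ, mul_one]

theorem wdist_anti (S : Finset G) (w : G → ℝ) (hw : ∀ s ∈ S, 0 ≤ w s) (h1 : (1 : G) ∉ S)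
    (hZ : ∑ r ∈ S, w r ≠ 0) {t t' : ℕ} (h : t ≤ t') (x y : G) :
    wdist S w t' x y ≤ wdist S w t x y :=
  antitone_nat_of_succ_le (f := fun t => wdist S w t x y)
    (fun t => wdist_succ_le S w hw h1 hZ t x y) h

theorem tv_le_of_wdist (S : Finset G) (w : G → ℝ) (h1 : (1 : G) ∉ S)
    (hZ : ∑ r ∈ S, w r ≠ 0) (t : ℕ) (a : ℝ) (ha : ∀ g, wdist S w t 1 g ≤ a) (x : G) :
    (∑ y, |(lazyCayleyWP S w ^ t) x y - 1 / (Fintype.card G : ℝ)|) / 2 ≤ a := by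
  set P := lazyCayleyWP S w
  have hc : (0 : ℝ) < Fintype.card G := by exact_mod_cast Fintype.card_pos
  have e : ∀ y, (P ^ t) x y - 1 / (Fintype.card G : ℝ)
      = 1 / (Fintype.card G : ℝ) * ∑ g, ((P ^ t) x y - (P ^ t) g y) := by
    intro y
    rw [Finset.sum_sub_distrib, lcw_pow_col S w h1 hZ]
    simp
    field_simp
  have ha' : ∀ g, (∑ y, |(P ^ t) x y - (P ^ t) g y|) ≤ 2 * a := by
    intro g
    have := ha (x⁻¹ * g)
    rw [← wdist_inv S w t x] at this
    simp only [mul_one, mul_inv_cancel_left] at this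
    unfold wdist at this
    linarith
  calc (∑ y, |(P ^ t) x y - 1 / (Fintype.card G : ℝ)|) / 2
      ≤ (∑ y, 1 / (Fintype.card G : ℝ) * ∑ g, |(P ^ t) x y - (P ^ t) g y|) / 2 := by
        gcongr with y
        rw [e y, abs_mul, abs_of_nonneg (by positivity)]
        gcongr
        exact Finset.abs_sum_le_sum_abs _ _
    _ = (1 / (Fintype.card G : ℝ) * ∑ g, ∑ y, |(P ^ t) x y - (P ^ t) g y|) / 2 := by
        rw [← Finset.mul_sum, Finset.sum_comm]
    _ ≤ (1 / (Fintype.card G : ℝ) * ∑ g : G, 2 * a) / 2 := by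
        gcongr with g
        exact ha' g
    _ = a := by simp

theorem tvMix_le (S : Finset G) (w : G → ℝ) (h1 : (1 : G) ∉ S)
    (hZ : ∑ r ∈ S, w r ≠ 0) (t : ℕ) (ha : ∀ g, wdist S w t 1 g ≤ 1 / 4) :
    tvMixUnif (lazyCayleyWP S w) ≤ t :=
  Nat.sInf_le (fun x => tv_le_of_wdist S w h1 hZ t _ ha x)

/-- Existence of a mixing time. -/
theorem exists_mix (S : Finset G) (w : G → ℝ) (hS : IsSymmGen S) (hw : ∀ s ∈ S, 0 < w s)
    (hZ : ∑ r ∈ S, w r ≠ 0) :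
    ∃ t, ∀ x : G, (∑ y, |(lazyCayleyWP S w ^ t) x y - 1 / (Fintype.card G : ℝ)|) / 2 ≤ 1 / 4 := by
  obtain ⟨h1, hinv, hgen⟩ := hS
  set P := lazyCayleyWP S w with hP
  have hw0 : ∀ s ∈ S, 0 ≤ w s := fun s hs => (hw s hs).le
  have hZp : 0 < ∑ r ∈ S, w r := lt_of_le_of_ne (Finset.sum_nonneg hw0) (Ne.symm hZ)
  -- one-step expansion on the right
  have hpos : ∀ g : G, ∃ t, 0 < (P ^ t) 1 g := by
    intro g
    have hg : g ∈ Subgroup.closure (S : Set G) := by rw [hgen]; trivial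
    have step : ∀ (x s : G), s ∈ S → (∃ t, 0 < (P ^ t) 1 x) → ∃ t, 0 < (P ^ t) 1 (x * s) := by
      rintro x s hs ⟨t, ht⟩
      refine ⟨t + 1, ?_⟩
      rw [pow_succ, Matrix.mul_apply]
      refine lt_of_lt_of_le ?_ (Finset.single_le_sum
        (f := fun z => (P ^ t) 1 z * P z (x * s))
        (fun z _ => mul_nonneg (lcw_pow_nonneg S w hw0 _ _ _) (lcw_nonneg S w hw0 _ _))
        (Finset.mem_univ x))
      refine mul_pos ht ?_
      have hs1 : s ≠ 1 := fun h => h1 (h ▸ hs)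
      simp only [hP, lazyCayleyWP]
      rw [if_neg (by simpa using hs1)]
      simp only [inv_mul_cancel_left, hs, if_true]
      exact div_pos (hw s hs) (by linarith)
    refine Subgroup.closure_induction_right (p := fun g _ => ∃ t, 0 < (P ^ t) 1 g) ?_ ?_ ?_ hg
    · exact ⟨0, by simp⟩
    · intro x _ y hy hx
      exact step x y hy hx
    · intro x _ y hy hx
      exact step x _ (hinv y hy) hx
  have hmono : ∀ t g, 0 < (P ^ t) 1 g → 0 < (P ^ (t + 1)) 1 g := by
    intro t g h
    rw [pow_succ, Matrix.mul_apply]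
    refine lt_of_lt_of_le ?_ (Finset.single_le_sum
        (f := fun z => (P ^ t) 1 z * P z g)
        (fun z _ => mul_nonneg (lcw_pow_nonneg S w hw0 _ _ _) (lcw_nonneg S w hw0 _ _))
        (Finset.mem_univ g))
    refine mul_pos h ?_
    simp [hP, lazyCayleyWP]
  have hmono' : ∀ t t' g, t ≤ t' → 0 < (P ^ t) 1 g → 0 < (P ^ t') 1 g := by
    intro t t' g h h0
    induction h with
    | refl => exact h0
    | step _ ih => exact hmono _ _ ih
  choose τ hτ using hpos
  set N := ∑ g, τ g
  have hN : ∀ x y, 0 < (P ^ N) x y := by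
    intro x y
    have := lcw_pow_inv S w N x 1 (x⁻¹ * y)
    simp only [mul_one, mul_inv_cancel_left] at this
    rw [hP, this]
    exact hmono' _ _ _ (Finset.single_le_sum (fun _ _ => Nat.zero_le _) (Finset.mem_univ _))
      (hτ _)
  obtain ⟨z, -, hz⟩ := Finset.exists_min_image (Finset.univ : Finset G)
    (fun y => (P ^ N) 1 y) ⟨1, Finset.mem_univ _⟩
  set δ := (P ^ N) 1 z
  have hδ : 0 < δ := hN _ _
  have hδ' : ∀ x y, δ ≤ (P ^ N) x y := by
    intro x y
    have := lcw_pow_inv S w N x 1 (x⁻¹ * y)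
    simp only [mul_one, mul_inv_cancel_left] at this
    rw [hP, this]
    exact hz _ (Finset.mem_univ _)
  set c : ℝ := (Fintype.card G : ℝ) with hcdef
  have hc : (0 : ℝ) < c := by simp only [c]; exact_mod_cast Fintype.card_pos
  have hr : 0 ≤ 1 - δ * c := by
    have : ∑ y : G, δ ≤ ∑ y, (P ^ N) 1 y := Finset.sum_le_sum fun y _ => hδ' 1 y
    rw [lcw_pow_row S w h1 hZ] at this
    simp at this
    simp only [c]; linarith
  set r := 1 - δ * c
  have hr1 : r < 1 := by simp only [r]; nlinarith
  have hlow : ∀ k x y, (1 - r ^ k) / c ≤ (P ^ (N * k)) x y := by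
    intro k
    induction k with
    | zero => intro x y; simp only [pow_zero, sub_self, zero_div]; exact lcw_pow_nonneg S w hw0 _ _ _
    | succ k ih =>
      intro x y
      rw [show N * (k + 1) = N + N * k by ring, pow_add P N (N * k), Matrix.mul_apply]
      have : ∑ z, (((P ^ N) x z - δ) * ((1 - r ^ k) / c) + δ * (P ^ (N * k)) z y)
          ≤ ∑ z, (P ^ N) x z * (P ^ (N * k)) z y := by
        refine Finset.sum_le_sum fun z _ => ?_
        have := ih z y
        nlinarith [hδ' x z]
      refine le_trans (le_of_eq ?_) this
      rw [Finset.sum_add_distrib, ← Finset.mul_sum, lcw_pow_col S w h1 hZ, ← Finset.sum_mul,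
        Finset.sum_sub_distrib, lcw_pow_row S w h1 hZ]
      simp only [Finset.sum_const, Finset.card_univ, nsmul_eq_mul]
      change _ = (1 - c * δ) * _ + _
      have : 1 - c * δ = r := by simp only [r]; ring
      rw [this]
      have hδr : δ = (1 - r) / c := by simp only [r]; field_simp; ring
      rw [hδr]
      field_simp; ring
  obtain ⟨k, hk⟩ := exists_pow_lt_of_lt_one (show (0 : ℝ) < 1 / 4 by norm_num) hr1
  refine ⟨N * k, fun x => ?_⟩
  have hrk : 0 ≤ r ^ k := pow_nonneg hr k
  have : ∀ y, |(P ^ (N * k)) x y - 1 / c| ≤ ((P ^ (N * k)) x y - 1 / c) + 2 * (r ^ k / c) := by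
    intro y
    have := hlow k x y
    have e : (1 - r ^ k) / c = 1 / c - r ^ k / c := by ring
    have : 0 ≤ r ^ k / c := by positivity
    rw [abs_le]; constructor <;> linarith
  have h2 := Finset.sum_le_sum (fun y (_ : y ∈ (Finset.univ : Finset G)) => this y)
  rw [Finset.sum_add_distrib, Finset.sum_sub_distrib, lcw_pow_row S w h1 hZ] at h2
  simp only [Finset.sum_const, Finset.card_univ, nsmul_eq_mul] at h2
  change _ ≤ 1 - c * (1 / c) + c * (2 * (r ^ k / c)) at h2
  have e1 : c * (1 / c) = 1 := by field_simp
  have e2 : c * (2 * (r ^ k / c)) = 2 * r ^ k := by field_simp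
  rw [e1, e2] at h2
  linarith

theorem le_tvMix (S : Finset G) (w : G → ℝ) (hS : IsSymmGen S) (hw : ∀ s ∈ S, 0 < w s)
    (hZ : ∑ r ∈ S, w r ≠ 0) (T : ℕ)
    (h : ∀ t, (∀ x : G, (∑ y, |(lazyCayleyWP S w ^ t) x y - 1 / (Fintype.card G : ℝ)|) / 2
      ≤ 1 / 4) → T ≤ t) : T ≤ tvMixUnif (lazyCayleyWP S w) :=
  le_csInf (exists_mix S w hS hw hZ) h

theorem lcw_super (S : Finset G) (w : G → ℝ) (hw : ∀ s ∈ S, 0 ≤ w s) (F : G → ℝ) (c : ℝ)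
    (hc : 0 ≤ c)
    (h : ∀ x, ∑ y, lazyCayleyWP S w x y * F y ≤ c * F x) (t : ℕ) (x : G) :
    ∑ y, (lazyCayleyWP S w ^ t) x y * F y ≤ c ^ t * F x := by
  induction t generalizing x with
  | zero => simp [Matrix.one_apply]
  | succ t ih =>
    simp only [pow_succ', Matrix.mul_apply, Finset.sum_mul]
    rw [Finset.sum_comm]
    calc _ = ∑ z, lazyCayleyWP S w x z * ∑ y, (lazyCayleyWP S w ^ t) z y * F y := by
          simp only [Finset.mul_sum, mul_assoc]
      _ ≤ ∑ z, lazyCayleyWP S w x z * (c ^ t * F z) := by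
          gcongr with z
          · exact lcw_nonneg S w hw x z
          · exact ih z
      _ = c ^ t * ∑ z, lazyCayleyWP S w x z * F z := by
          rw [Finset.mul_sum]; exact Finset.sum_congr rfl fun z _ => by ring
      _ ≤ c ^ t * (c * F x) := by gcongr; exact h x
      _ = _ := by ring

end groupWalk

/-! ### Interchange process on a graph -/
section interchange
open Classical
variable {V : Type*} [Fintype V]

/-- The transpositions along the edges of a graph. -/
noncomputable def swS (G : SimpleGraph V) : Finset (Equiv.Perm V) :=
  univ.filter (fun g => ∃ p q, G.Adj p q ∧ g = Equiv.swap p q)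

theorem mem_swS (G : SimpleGraph V) (g : Equiv.Perm V) :
    g ∈ swS G ↔ ∃ p q, G.Adj p q ∧ g = Equiv.swap p q := by simp [swS]

theorem one_notMem_swS (G : SimpleGraph V) : (1 : Equiv.Perm V) ∉ swS G := by
  rw [mem_swS]
  rintro ⟨p, q, h, e⟩
  have := congrArg (fun g => g p) e
  simp at this
  exact h.ne this

theorem sq_swS (G : SimpleGraph V) {s : Equiv.Perm V} (h : s ∈ swS G) : s⁻¹ = s := by
  rw [mem_swS] at h
  obtain ⟨p, q, h, rfl⟩ := h
  simp

theorem swS_mul_self (G : SimpleGraph V) {s : Equiv.Perm V} (h : s ∈ swS G) : s * s = 1 := by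
  rw [mem_swS] at h
  obtain ⟨p, q, h, rfl⟩ := h
  simp

theorem swS_eq_swap (G : SimpleGraph V) {s : Equiv.Perm V} (h : s ∈ swS G) (p : V)
    (hp : s p ≠ p) : G.Adj p (s p) ∧ s = Equiv.swap p (s p) := by
  rw [mem_swS] at h
  obtain ⟨a, b, h, rfl⟩ := h
  by_cases h1 : p = a
  · subst h1; simp [h]
  · by_cases h2 : p = b
    · subst h2; simp [h.symm, Equiv.swap_comm]
    · exact absurd (Equiv.swap_apply_of_ne_of_ne h1 h2) hp

theorem sum_swS (G : SimpleGraph V) (w : Equiv.Perm V → ℝ) (F : V → ℝ) (p : V) :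
    ∑ s ∈ swS G, w s * (F (s p) - F p)
      = ∑ q ∈ univ.filter (G.Adj p), w (Equiv.swap p q) * (F q - F p) := by
  have : ∑ s ∈ swS G, w s * (F (s p) - F p)
      = ∑ s ∈ (swS G).filter (fun s => s p ≠ p), w s * (F (s p) - F p) := by
    symm
    apply Finset.sum_filter_of_ne
    intro s _ h h'
    apply h; rw [h']; simp
  rw [this]
  refine Finset.sum_bij' (fun s _ => s p) (fun q _ => Equiv.swap p q) ?_ ?_ ?_ ?_ ?_
  · intro s hs
    simp only [mem_filter] at hs
    simpa using (swS_eq_swap G hs.1 p hs.2).1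
  · intro q hq
    simp only [mem_filter, mem_univ, true_and] at hq
    simp only [mem_filter, mem_swS, Equiv.swap_apply_left]
    exact ⟨⟨p, q, hq, rfl⟩, hq.ne'⟩
  · intro s hs
    simp only [mem_filter] at hs
    exact (swS_eq_swap G hs.1 p hs.2).2.symm
  · intro q hq; simp
  · intro s hs
    simp only [mem_filter] at hs
    rw [← (swS_eq_swap G hs.1 p hs.2).2]

theorem degree_le_swS (G : SimpleGraph V) (p : V) :
    #(univ.filter (G.Adj p)) ≤ #(swS G) := by
  refine Finset.card_le_card_of_injOn (fun q => Equiv.swap p q) ?_ ?_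
  · intro q hq
    simp only [coe_filter, mem_univ, true_and, Set.mem_ofPred_eq] at hq
    exact (mem_swS G _).2 ⟨p, q, hq, rfl⟩
  · intro q _ q' _ h
    have := congrArg (fun g => g p) h
    simpa using this

/-- Graph Laplacian. -/
noncomputable def lapG (G : SimpleGraph V) (F : V → ℝ) (p : V) : ℝ :=
  ∑ q ∈ univ.filter (G.Adj p), (F q - F p)

/-- Distance between walks started from `1` and from a transposition. -/
noncomputable def Dsw (G : SimpleGraph V) (t : ℕ) (p q : V) : ℝ :=
  wdist (swS G) (fun _ => 1) t 1 (Equiv.swap p q)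

theorem Dsw_succ (G : SimpleGraph V) (hE : 0 < #(swS G)) (t : ℕ) (p q : V) (hpq : p ≠ q) :
    Dsw G (t + 1) p q ≤ Dsw G t p q + 1 / (2 * (#(swS G) : ℝ)) *
      (lapG G (fun p' => Dsw G t p' q) p + lapG G (fun q' => Dsw G t p q') q) := by
  set S := swS G with hS
  set τ := Equiv.swap p q with hτ
  have hE' : (1 : ℝ) ≤ #S := by exact_mod_cast hE
  set E : ℝ := (#S : ℝ) with hEd
  have hself : ∀ a, Dsw G t a a = 0 := by
    intro a; simp only [Dsw, Equiv.swap_self]; exact wdist_self _ _ _ _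
  have hconj : ∀ s ∈ S, wdist S (fun _ => 1) t s (τ * s) = Dsw G t (s p) (s q) := by
    intro s hs
    have h2 := wdist_inv S (fun _ => (1 : ℝ)) t s 1 (s * τ * s⁻¹)
    have e : s * (s * τ * s⁻¹) = τ * s := by
      rw [sq_swS G hs]
      have := swS_mul_self G hs
      calc s * (s * τ * s) = (s * s) * τ * s := by group
        _ = _ := by rw [this, one_mul]
    rw [mul_one, e] at h2
    rw [h2]
    unfold Dsw
    rw [hτ, Equiv.swap_apply_apply]
  -- expansion
  set Q := lazyCayleyWP S (fun _ => (1 : ℝ)) with hQ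
  have hexp : ∀ x z, (Q ^ (t + 1)) x z
      = 1 / 2 * (Q ^ t) x z + 1 / (2 * E) * ∑ s ∈ S, (Q ^ t) (x * s) z := by
    intro x z
    rw [pow_succ', Matrix.mul_apply, hQ, lcw_apply S _ (one_notMem_swS G) (fun u => (Q ^ t) u z)]
    simp [hEd, hQ]
  have hτ2 : τ * τ = 1 := by simp [hτ]
  set δ : ℝ := if τ ∈ S then 1 else 0 with hδ
  have hδ01 : 0 ≤ δ ∧ δ ≤ 1 := by
    simp only [hδ]; split_ifs <;> norm_num
  have hsplit : ∀ f : Equiv.Perm V → ℝ, ∑ s ∈ S, f s = δ * f τ + ∑ s ∈ S.erase τ, f s := by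
    intro f
    by_cases h : τ ∈ S
    · simp only [hδ, h, if_true, one_mul]; exact (Finset.add_sum_erase S f h).symm
    · simp [hδ, h]
  have hmain : Dsw G (t + 1) p q ≤ (1 / 2 - δ / (2 * E)) * Dsw G t p q
      + 1 / (2 * E) * ∑ s ∈ S.erase τ, Dsw G t (s p) (s q) := by
    have h3 : ∀ z, |(Q ^ (t + 1)) 1 z - (Q ^ (t + 1)) τ z|
        ≤ (1 / 2 - δ / (2 * E)) * |(Q ^ t) 1 z - (Q ^ t) τ z|
          + 1 / (2 * E) * ∑ s ∈ S.erase τ, |(Q ^ t) s z - (Q ^ t) (τ * s) z| := by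
      intro z
      rw [hexp, hexp, hsplit, hsplit]
      simp only [one_mul, hτ2]
      have e : 1 / 2 * (Q ^ t) 1 z + 1 / (2 * E) * (δ * (Q ^ t) τ z + ∑ s ∈ S.erase τ, (Q ^ t) s z)
          - (1 / 2 * (Q ^ t) τ z
            + 1 / (2 * E) * (δ * (Q ^ t) 1 z + ∑ s ∈ S.erase τ, (Q ^ t) (τ * s) z))
          = (1 / 2 - δ / (2 * E)) * ((Q ^ t) 1 z - (Q ^ t) τ z)
          + 1 / (2 * E) * ∑ s ∈ S.erase τ, ((Q ^ t) s z - (Q ^ t) (τ * s) z) := by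
        rw [Finset.sum_sub_distrib]; ring
      rw [e]
      refine (abs_add_le _ _).trans ?_
      rw [abs_mul, abs_mul]
      have h4 : 0 ≤ 1 / 2 - δ / (2 * E) := by
        have : δ / (2 * E) ≤ 1 / 2 := by
          rw [div_le_div_iff₀ (by linarith) (by norm_num)]; linarith [hδ01.2]
        linarith
      rw [abs_of_nonneg h4, abs_of_nonneg (show 0 ≤ 1 / (2 * E) by positivity)]
      gcongr
      exact Finset.abs_sum_le_sum_abs _ _
    have h5 := Finset.sum_le_sum (fun z (_ : z ∈ (univ : Finset (Equiv.Perm V))) => h3 z)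
    rw [Finset.sum_add_distrib, ← Finset.mul_sum, ← Finset.mul_sum, Finset.sum_comm] at h5
    have h6 : ∀ s ∈ S.erase τ, ∑ z, |(Q ^ t) s z - (Q ^ t) (τ * s) z| = 2 * Dsw G t (s p) (s q) := by
      intro s hs
      rw [← hconj s (Finset.mem_of_mem_erase hs)]
      unfold wdist
      ring
    rw [Finset.sum_congr rfl h6, ← Finset.mul_sum] at h5
    unfold Dsw wdist
    unfold Dsw wdist at h5
    simp only [← hS, ← hQ, ← hτ] at h5 ⊢
    linarith
  refine hmain.trans ?_
  have hlap : ∀ F : V → ℝ, ∀ a, lapG G F a = ∑ s ∈ S, (F (s a) - F a) := by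
    intro F a
    have := sum_swS G (fun _ => 1) F a
    simp only [one_mul] at this
    rw [hS, this, lapG]
  rw [hlap, hlap, ← Finset.sum_add_distrib, hsplit]
  have h7 : ∀ s ∈ S.erase τ, Dsw G t (s p) q - Dsw G t p q + (Dsw G t p (s q) - Dsw G t p q)
      = Dsw G t (s p) (s q) - Dsw G t p q := by
    intro s hs
    rw [Finset.mem_erase] at hs
    by_cases h : s p = p
    · rw [h]; ring
    · by_cases h' : s q = q
      · rw [h']; ring
      · exfalso
        obtain ⟨_, h1⟩ := swS_eq_swap G hs.2 p h
        rw [h1] at h'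
        have : q = s p := by
          by_contra hne
          exact h' (Equiv.swap_apply_of_ne_of_ne hpq.symm hne)
        rw [← this] at h1
        exact hs.1 h1
  rw [Finset.sum_congr rfl h7, Finset.sum_sub_distrib]
  simp only [hτ, Equiv.swap_apply_left, Equiv.swap_apply_right, hself, sum_const, nsmul_eq_mul]
  have hc : (#(S.erase τ) : ℝ) = E - δ := by
    by_cases h : τ ∈ S
    · rw [Finset.cast_card_erase_of_mem h]; simp [hδ, h, hEd]
    · simp [hδ, h, hEd]
  rw [hc]
  have hE0 : E ≠ 0 := by linarith
  apply le_of_eq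
  field_simp
  ring

/-- Properties of the distances `Dsw` used in the comparison arguments. -/
structure DSys (G : SimpleGraph V) (N : ℝ) (D : ℕ → V → V → ℝ) : Prop where
  nonneg : ∀ t p q, 0 ≤ D t p q
  le_one : ∀ t p q, D t p q ≤ 1
  self : ∀ t p, D t p p = 0
  symm : ∀ t p q, D t p q = D t q p
  anti : ∀ s t p q, D (s + t) p q ≤ D s p q
  Npos : 2 ≤ N
  deg : ∀ p, (#(univ.filter (G.Adj p)) : ℝ) ≤ N / 2
  step : ∀ t p q, p ≠ q → D (t + 1) p q ≤ D t p q + 1 / N *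
      (lapG G (fun p' => D t p' q) p + lapG G (fun q' => D t p q') q)

theorem dsys_Dsw (G : SimpleGraph V) (hE : 0 < #(swS G)) :
    DSys G (2 * (#(swS G) : ℝ)) (Dsw G) := by
  have hE' : (1 : ℝ) ≤ #(swS G) := by exact_mod_cast hE
  have hZ : ∑ r ∈ swS G, (1 : ℝ) ≠ 0 := by simp; intro h; simp [h] at hE
  refine ⟨fun _ _ _ => wdist_nonneg _ _ _ _ _, fun t p q => ?_, fun t p => ?_, fun t p q => ?_,
    fun s t p q => ?_, by linarith, fun p => ?_, fun t p q h => Dsw_succ G hE t p q h⟩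
  · exact wdist_le_one _ _ (by simp) (one_notMem_swS G) hZ _ _ _
  · simp only [Dsw, Equiv.swap_self]; exact wdist_self _ _ _ _
  · simp only [Dsw, Equiv.swap_comm]
  · exact wdist_anti _ _ (by simp) (one_notMem_swS G) hZ (by omega) _ _
  · have := degree_le_swS G p
    have : (#(univ.filter (G.Adj p)) : ℝ) ≤ #(swS G) := by exact_mod_cast this
    linarith

theorem lapG_eq (G : SimpleGraph V) (F : V → ℝ) (p : V) :
    lapG G F p = ∑ q ∈ univ.filter (G.Adj p), F q - #(univ.filter (G.Adj p)) * F p := by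
  simp [lapG, Finset.sum_sub_distrib]

theorem compare (G : SimpleGraph V) (N : ℝ) (D : ℕ → V → V → ℝ) (hD : DSys G N D)
    (Ω : V → V → Prop) (hΩ : ∀ p q, Ω p q → p ≠ q) (F : ℕ → V → V → ℝ) (s : ℕ)
    (h0 : ∀ p q, Ω p q → D s p q ≤ F 0 p q)
    (hb1 : ∀ t p q p', Ω p q → G.Adj p p' → ¬ Ω p' q → D (s + t) p' q ≤ F t p' q)
    (hb2 : ∀ t p q q', Ω p q → G.Adj q q' → ¬ Ω p q' → D (s + t) p q' ≤ F t p q')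
    (hs : ∀ t p q, Ω p q → F t p q + 1 / N *
      (lapG G (fun p' => F t p' q) p + lapG G (fun q' => F t p q') q) ≤ F (t + 1) p q) :
    ∀ t p q, Ω p q → D (s + t) p q ≤ F t p q := by
  intro t
  induction t with
  | zero => exact h0
  | succ t ih =>
    intro p q hpq
    refine le_trans (hD.step (s + t) p q (hΩ p q hpq)) (le_trans ?_ (hs t p q hpq))
    rw [lapG_eq, lapG_eq, lapG_eq, lapG_eq]
    have h1 : ∑ p' ∈ univ.filter (G.Adj p), D (s + t) p' q
        ≤ ∑ p' ∈ univ.filter (G.Adj p), F t p' q := by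
      refine Finset.sum_le_sum fun p' hp' => ?_
      simp only [mem_filter, mem_univ, true_and] at hp'
      by_cases h : Ω p' q
      · exact ih _ _ h
      · exact hb1 t p q p' hpq hp' h
    have h2 : ∑ q' ∈ univ.filter (G.Adj q), D (s + t) p q'
        ≤ ∑ q' ∈ univ.filter (G.Adj q), F t p q' := by
      refine Finset.sum_le_sum fun p' hp' => ?_
      simp only [mem_filter, mem_univ, true_and] at hp'
      by_cases h : Ω p p'
      · exact ih _ _ h
      · exact hb2 t p q p' hpq hp' h
    have h3 := ih p q hpq
    have hN := hD.Npos
    have hd : 0 ≤ 1 - 1 / N * (#(univ.filter (G.Adj p)) + #(univ.filter (G.Adj q))) := by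
      have := hD.deg p
      have := hD.deg q
      have : 1 / N * ((#(univ.filter (G.Adj p)) : ℝ) + #(univ.filter (G.Adj q))) ≤ 1 / N * N := by
        gcongr; linarith
      rw [one_div_mul_cancel (by linarith)] at this
      linarith
    have h4 := mul_le_mul_of_nonneg_left h3 hd
    have h5 : 1 / N * (∑ p' ∈ univ.filter (G.Adj p), D (s + t) p' q
        + ∑ q' ∈ univ.filter (G.Adj q), D (s + t) p q')
        ≤ 1 / N * (∑ p' ∈ univ.filter (G.Adj p), F t p' q
        + ∑ q' ∈ univ.filter (G.Adj q), F t p q') := by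
      have : 0 ≤ 1 / N := by positivity
      gcongr
    linarith

/-- Vertices outside of `A`, joined to `k`, etc. -/
noncomputable def etaK (G : SimpleGraph V) (A : V → Prop) (Db : V → ℝ) (p : V) : ℝ :=
  (∑ x ∈ univ.filter (fun x => G.Adj p x ∧ A x), Db x) / #(univ.filter (fun x => ¬ A x))

theorem nbr_split (G : SimpleGraph V) (A : V → Prop) (hK : ∀ p q, ¬ A p → ¬ A q → p ≠ q → G.Adj p q)
    (p : V) (hp : ¬ A p) (f : V → ℝ) :
    ∑ q ∈ univ.filter (G.Adj p), f q = ∑ q ∈ (univ.filter (fun x => ¬ A x)).erase p, f q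
      + ∑ x ∈ univ.filter (fun x => G.Adj p x ∧ A x), f x := by
  rw [← Finset.sum_union]
  · refine Finset.sum_congr ?_ fun _ _ => rfl
    ext q
    simp only [mem_filter, mem_univ, true_and, mem_union, mem_erase]
    constructor
    · intro h
      by_cases hq : A q
      · exact Or.inr ⟨h, hq⟩
      · exact Or.inl ⟨h.ne', hq⟩
    · rintro (⟨h1, h2⟩ | ⟨h1, h2⟩)
      · exact hK _ _ hp h2 h1.symm
      · exact h1
  · rw [Finset.disjoint_left]
    intro q h1 h2
    simp only [mem_filter, mem_univ, true_and, mem_erase] at h1 h2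
    exact h1.2 h2.2

theorem KK_lemma (G : SimpleGraph V) (N : ℝ) (D : ℕ → V → V → ℝ) (hD : DSys G N D)
    (A : V → Prop) (hK : ∀ p q, ¬ A p → ¬ A q → p ≠ q → G.Adj p q) (Db : V → ℝ)
    (hDb0 : ∀ x, 0 ≤ Db x) (s : ℕ)
    (hDb : ∀ t x k, A x → ¬ A k → D (s + t) x k ≤ Db x) (t : ℕ) (p q : V) (hp : ¬ A p)
    (hq : ¬ A q) (hpq : p ≠ q) :
    D (s + t) p q ≤ (1 - 2 / N) ^ t + etaK G A Db p + etaK G A Db q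
      + ∑ k ∈ univ.filter (fun x => ¬ A x), etaK G A Db k := by
  set η := etaK G A Db with hη
  set KK := univ.filter (fun x => ¬ A x) with hKK
  set σ := ∑ k ∈ KK, η k with hσ
  have hN := hD.Npos
  have hr : 0 ≤ 1 - 2 / N := by
    have : 2 / N ≤ 1 := by rw [div_le_one (by linarith)]; exact hN
    linarith
  set r := 1 - 2 / N with hrd
  have hηnn : ∀ k, 0 ≤ η k := fun k => div_nonneg (Finset.sum_nonneg fun _ _ => hDb0 _) (by positivity)
  have hσ0 : 0 ≤ σ := Finset.sum_nonneg fun _ _ => hηnn _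
  have hcK : ∀ k, ¬ A k → (0 : ℝ) < #KK := by
    intro k hk
    exact_mod_cast Finset.card_pos.2 ⟨k, by simp [hKK, hk]⟩
  have hηc : ∀ k, ¬ A k → ∑ x ∈ univ.filter (fun x => G.Adj k x ∧ A x), Db x = #KK * η k := by
    intro k hk
    have := hcK k hk
    simp only [hη, etaK, ← hKK]
    field_simp
  let F : ℕ → V → V → ℝ := fun t a b =>
    if A a then Db a else if A b then Db b else if a = b then 0 else r ^ t + η a + η b + σ
  have hFK : ∀ t a b, ¬ A a → ¬ A b → a ≠ b → F t a b = r ^ t + η a + η b + σ := by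
    intro t a b ha hb hab; simp [F, ha, hb, hab]
  have hFs : ∀ t a b, ¬ A b → F t a b = F t b a := by
    intro t a b hb
    simp only [F, hb, if_false]
    by_cases ha : A a
    · simp [ha]
    · by_cases hab : a = b
      · simp [ha, hab, hb]
      · have : b ≠ a := fun h => hab h.symm
        simp only [ha, hab, this, if_false]; ring
  -- half of the estimate
  have half : ∀ t a b, ¬ A a → ¬ A b → a ≠ b →
      lapG G (fun b' => F t a b') b ≤ - r ^ t - 2 * η a := by
    intro t a b ha hb hab
    have hrt : 0 ≤ r ^ t := pow_nonneg hr t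
    unfold lapG
    rw [nbr_split G A hK b hb]
    have h1 : ∑ x ∈ univ.filter (fun x => G.Adj b x ∧ A x), (F t a x - F t a b)
        ≤ #KK * η b := by
      rw [← hηc b hb]
      refine Finset.sum_le_sum fun x hx => ?_
      simp only [mem_filter, mem_univ, true_and] at hx
      have : F t a x = Db x := by simp [F, ha, hx.2]
      rw [this, hFK t a b ha hb hab]
      linarith [hηnn a, hηnn b]
    have haK : a ∈ KK.erase b := by simp [hKK, ha, hab]
    have hbK : b ∈ KK := by simp [hKK, hb]
    have h2 : ∑ x ∈ KK.erase b, (F t a x - F t a b)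
        = - F t a b + ∑ x ∈ (KK.erase b).erase a, (η x - η b) := by
      rw [← Finset.add_sum_erase _ _ haK]
      congr 1
      · simp [F, ha]
      · refine Finset.sum_congr rfl fun x hx => ?_
        simp only [mem_erase, hKK, mem_filter, mem_univ, true_and] at hx
        rw [hFK t a x ha hx.2.2 (fun h => hx.1 h.symm), hFK t a b ha hb hab]
        ring
    have h3 : ∑ x ∈ (KK.erase b).erase a, (η x - η b) = σ - η a - η b - (#KK - 2) * η b := by
      rw [Finset.sum_sub_distrib]
      have e1 := Finset.add_sum_erase KK η hbK
      have e2 := Finset.add_sum_erase (KK.erase b) η haK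
      have e3 : (#((KK.erase b).erase a) : ℝ) = #KK - 2 := by
        rw [Finset.cast_card_erase_of_mem haK, Finset.cast_card_erase_of_mem hbK]; ring
      simp only [sum_const, nsmul_eq_mul, e3]
      linarith
    change ∑ x ∈ KK.erase b, (F t a x - F t a b) + _ ≤ _
    rw [h2, h3, hFK t a b ha hb hab]
    linarith
  have key := compare G N D hD (fun a b => ¬ A a ∧ ¬ A b ∧ a ≠ b) (fun _ _ h => h.2.2) F s
    ?_ ?_ ?_ ?_ t p q ⟨hp, hq, hpq⟩
  · rwa [hFK t p q hp hq hpq] at key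
  · rintro a b ⟨ha, hb, hab⟩
    rw [hFK 0 a b ha hb hab]
    have := hD.le_one s a b
    simp only [pow_zero]
    linarith [hηnn a, hηnn b]
  · rintro t a b a' ⟨ha, hb, hab⟩ h h'
    simp only [not_and, not_not] at h'
    by_cases hA : A a'
    · simp only [F, hA, if_true]; exact hDb t a' b hA hb
    · rw [h' hA hb, hD.self]; simp [F, hb]
  · rintro t a b a' ⟨ha, hb, hab⟩ h h'
    simp only [not_and, not_not] at h'
    by_cases hA : A a'
    · simp only [F, ha, hA, if_true, if_false]; rw [hD.symm]; exact hDb t a' a hA ha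
    · rw [← h' ha hA, hD.self]; simp [F, ha]
  · rintro t a b ⟨ha, hb, hab⟩
    have h1 := half t a b ha hb hab
    have h2 := half t b a hb ha (fun h => hab h.symm)
    have e : (fun p' => F t p' b) = fun p' => F t b p' := by
      funext p'; exact hFs t p' b hb
    rw [e]
    have h3 : 1 / N * (lapG G (fun p' => F t b p') a + lapG G (fun q' => F t a q') b)
        ≤ 1 / N * (-2 * r ^ t) := by
      have : 0 ≤ 1 / N := by positivity
      gcongr
      linarith [hηnn a, hηnn b]
    rw [hFK _ a b ha hb hab, hFK _ a b ha hb hab, pow_succ]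
    have : r ^ t * r = r ^ t + 1 / N * (-2 * r ^ t) := by rw [hrd]; ring
    linarith

theorem KA_lemma (G : SimpleGraph V) (N : ℝ) (D : ℕ → V → V → ℝ) (hD : DSys G N D)
    (A : V → Prop) (hK : ∀ p q, ¬ A p → ¬ A q → p ≠ q → G.Adj p q)
    (Dom : V → Prop) (hDom : ∀ x, Dom x → A x) (s : ℕ) (err : ℝ) (herr : 0 ≤ err)
    (hKK : ∀ p q, ¬ A p → ¬ A q → D s p q ≤ err)
    (U : ℕ → V → ℝ) (hU0 : ∀ t x, 0 ≤ U t x) (hU1 : ∀ x, Dom x → 1 ≤ U 0 x)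
    (hUb : ∀ t x x' k, Dom x → G.Adj x x' → A x' → ¬ Dom x' → ¬ A k → D (s + t) x' k ≤ U t x')
    (hUs : ∀ t x, Dom x → U t x + 1 / N *
      (∑ x' ∈ univ.filter (G.Adj x), ((if A x' then U t x' else 0) - U t x)) ≤ U (t + 1) x)
    (t : ℕ) (x k : V) (hx : Dom x) (hk : ¬ A k) :
    D (s + t) x k ≤ err + U t x + etaK G A (fun _ => 1) k
      + t * ((∑ k ∈ univ.filter (fun x => ¬ A x), etaK G A (fun _ => 1) k) / N) := by
  set e := etaK G A (fun _ => 1) with he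
  set KK := univ.filter (fun x => ¬ A x) with hKKd
  set e0 := ∑ k ∈ KK, e k with he0
  have hN := hD.Npos
  have hee : ∀ k, 0 ≤ e k := fun k => div_nonneg (Finset.sum_nonneg fun _ _ => zero_le_one) (by positivity)
  have he00 : 0 ≤ e0 := Finset.sum_nonneg fun _ _ => hee _
  have hec : ∀ k, ¬ A k → ∑ x ∈ univ.filter (fun x => G.Adj k x ∧ A x), (1 : ℝ) = #KK * e k := by
    intro k hk
    have : (0 : ℝ) < #KK := by exact_mod_cast Finset.card_pos.2 ⟨k, by simp [hKKd, hk]⟩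
    simp only [he, etaK, ← hKKd]
    field_simp
  let F : ℕ → V → V → ℝ := fun t a b =>
    if A b then 1 else if A a then err + U t a + e b + t * (e0 / N) else err
  have hFA : ∀ t a b, A a → ¬ A b → F t a b = err + U t a + e b + t * (e0 / N) := by
    intro t a b ha hb; simp [F, ha, hb]
  have key := compare G N D hD (fun a b => Dom a ∧ ¬ A b)
    (fun a b h h' => h.2 (h' ▸ hDom _ h.1)) F s ?_ ?_ ?_ ?_ t x k ⟨hx, hk⟩
  · rwa [hFA t x k (hDom x hx) hk] at key
  · rintro a b ⟨ha, hb⟩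
    rw [hFA 0 a b (hDom a ha) hb]
    have := hD.le_one s a b
    have := hU1 a ha
    simp only [CharP.cast_eq_zero, zero_mul]
    linarith [hee b]
  · rintro t a b a' ⟨ha, hb⟩ h h'
    simp only [not_and, not_not] at h'
    have hnn : 0 ≤ (t : ℝ) * (e0 / N) := by positivity
    by_cases hA : A a'
    · rw [hFA t a' b hA hb]
      have := hUb t a a' b ha h hA (fun h => hb (h' h)) hb
      linarith [hee b]
    · simp only [F, hA, hb, if_false]
      exact (hD.anti s t a' b).trans (hKK _ _ hA hb)
  · rintro t a b b' ⟨ha, hb⟩ h h'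
    simp only [not_and, not_not] at h'
    simp only [F, h' ha, if_true]
    exact hD.le_one _ _ _
  · rintro t a b ⟨ha, hb⟩
    have hnn : 0 ≤ (t : ℝ) * (e0 / N) := by positivity
    have h1 : lapG G (fun p' => F t p' b) a
        ≤ ∑ x' ∈ univ.filter (G.Adj a), ((if A x' then U t x' else 0) - U t a) := by
      unfold lapG
      refine Finset.sum_le_sum fun x' _ => ?_
      beta_reduce
      rw [hFA t a b (hDom a ha) hb]
      by_cases hA : A x'
      · rw [hFA t x' b hA hb]; simp [hA]
      · simp only [F, hA, hb, if_false]; linarith [hee b]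
    have h2 : lapG G (fun q' => F t a q') b ≤ e0 := by
      unfold lapG
      rw [nbr_split G A hK b hb]
      have h3 : ∑ x ∈ univ.filter (fun x => G.Adj b x ∧ A x), (F t a x - F t a b)
          ≤ #KK * e b := by
        rw [← hec b hb]
        refine Finset.sum_le_sum fun x hx => ?_
        simp only [mem_filter, mem_univ, true_and] at hx
        have : F t a x = 1 := by simp [F, hx.2]
        rw [this, hFA t a b (hDom a ha) hb]
        linarith [hU0 t a, hee b]
      have hbK : b ∈ KK := by simp [hKKd, hb]
      have h4 : ∑ x ∈ KK.erase b, (F t a x - F t a b) = ∑ x ∈ KK.erase b, (e x - e b) := by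
        refine Finset.sum_congr rfl fun x hx => ?_
        simp only [mem_erase, hKKd, mem_filter, mem_univ, true_and] at hx
        rw [hFA t a x (hDom a ha) hx.2, hFA t a b (hDom a ha) hb]
        ring
      have h5 : ∑ x ∈ KK.erase b, (e x - e b) = e0 - #KK * e b := by
        rw [Finset.sum_sub_distrib]
        have e1 := Finset.add_sum_erase KK e hbK
        simp only [sum_const, nsmul_eq_mul, Finset.cast_card_erase_of_mem hbK]
        linarith
      change ∑ x ∈ KK.erase b, (F t a x - F t a b) + _ ≤ _
      rw [h4, h5]; linarith
    have h6 := hUs t a ha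
    rw [hFA t a b (hDom a ha) hb, hFA (t + 1) a b (hDom a ha) hb]
    have hN0 : 0 ≤ 1 / N := by positivity
    have h7 := mul_le_mul_of_nonneg_left h1 hN0
    have h8 := mul_le_mul_of_nonneg_left h2 hN0
    push_cast
    have : 1 / N * e0 = e0 / N := by ring
    linarith

theorem wdist_le_support (G : SimpleGraph V) (t : ℕ) (β : V → ℝ) (hβ : ∀ p, 0 ≤ β p)
    (h : ∀ p q, p ≠ q → Dsw G t p q ≤ β p + β q) :
    ∀ n : ℕ, ∀ g : Equiv.Perm V, #g.support ≤ n →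
      wdist (swS G) (fun _ => 1) t 1 g ≤ 2 * ∑ p ∈ g.support, β p := by
  intro n
  induction n with
  | zero =>
    intro g hg
    have : g = 1 := by simpa using hg
    subst this
    simp [wdist_self]
  | succ n ih =>
    intro g hg
    by_cases hg1 : g = 1
    · subst hg1; simp [wdist_self]
    have hne : g.support.Nonempty := by
      rw [Finset.nonempty_iff_ne_empty]; simpa using hg1
    obtain ⟨p, hp, hmax⟩ := Finset.exists_max_image g.support β hne
    have hgp : g p ≠ p := by simpa using hp
    set τ := Equiv.swap p (g p) with hτ
    set g' := τ * g with hg'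
    have e : g = τ * g' := by rw [hg', ← mul_assoc]; simp [hτ]
    have hsub : g'.support ⊆ g.support.erase p := by
      intro x hx
      rw [Equiv.Perm.mem_support] at hx
      rw [Finset.mem_erase, Equiv.Perm.mem_support]
      constructor
      · rintro rfl; apply hx; simp [hg', hτ]
      · intro hgx
        apply hx
        simp only [hg', Equiv.Perm.mul_apply, hgx]
        apply Equiv.swap_apply_of_ne_of_ne
        · rintro rfl; exact hgp hgx
        · intro hxp
          apply hgp
          have : g x = g p := by rw [hgx]; exact hxp
          have := g.injective this
          rw [← this, hgx]
    have hcard : #g'.support ≤ n := by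
      have := Finset.card_le_card hsub
      rw [Finset.card_erase_of_mem hp] at this
      omega
    have h1 := wdist_triangle (swS G) (fun _ => 1) t 1 τ g
    have h2 : wdist (swS G) (fun _ => 1) t τ g = wdist (swS G) (fun _ => 1) t 1 g' := by
      have := wdist_inv (swS G) (fun _ => 1) t τ 1 g'
      rwa [mul_one, ← e] at this
    have h3 := ih g' hcard
    have h4 : ∑ p ∈ g'.support, β p ≤ ∑ p ∈ g.support.erase p, β p :=
      Finset.sum_le_sum_of_subset_of_nonneg hsub fun _ _ _ => hβ _
    have h5 := Finset.add_sum_erase _ β hp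
    have h6 := h p (g p) (fun h => hgp h.symm)
    have h7 : β (g p) ≤ β p := hmax _ (by simpa using hgp)
    unfold Dsw at h6
    linarith

theorem Dsw_triangle (G : SimpleGraph V) (t : ℕ) (p q k : V) (hpq : p ≠ q)
    (hqk : q ≠ k) : Dsw G t p q ≤ 2 * Dsw G t p k + Dsw G t q k := by
  have e : Equiv.swap p q = Equiv.swap p k * (Equiv.swap q k * Equiv.swap p k) := by
    have := Equiv.swap_mul_swap_mul_swap (x := q) (y := k) (z := p) hqk hpq.symm
    rw [← mul_assoc, Equiv.swap_comm p k, this]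
  have h1 := wdist_triangle (swS G) (fun _ => 1) t 1 (Equiv.swap p k) (Equiv.swap p q)
  have h2 : wdist (swS G) (fun _ => 1) t (Equiv.swap p k) (Equiv.swap p q)
      = wdist (swS G) (fun _ => 1) t 1 (Equiv.swap q k * Equiv.swap p k) := by
    have := wdist_inv (swS G) (fun _ => 1) t (Equiv.swap p k) 1 (Equiv.swap q k * Equiv.swap p k)
    rwa [mul_one, ← e] at this
  have h3 := wdist_triangle (swS G) (fun _ => 1) t 1 (Equiv.swap q k)
    (Equiv.swap q k * Equiv.swap p k)
  have h4 : wdist (swS G) (fun _ => 1) t (Equiv.swap q k) (Equiv.swap q k * Equiv.swap p k)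
      = wdist (swS G) (fun _ => 1) t 1 (Equiv.swap p k) := by
    have := wdist_inv (swS G) (fun _ => 1) t (Equiv.swap q k) 1 (Equiv.swap p k)
    rwa [mul_one] at this
  unfold Dsw
  linarith

end interchange

/-! ### Elementary inequalities -/
section ineq

theorem exp_quad {y δ : ℝ} (h : |y| ≤ δ) (hδ : δ ≤ 1) : Real.exp y ≤ 1 + y + δ ^ 2 := by
  have h1 := Real.abs_exp_sub_one_sub_id_le (h.trans hδ)
  have h2 : y ^ 2 ≤ δ ^ 2 := by
    rw [← sq_abs]; exact pow_le_pow_left₀ (abs_nonneg _) h 2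
  have := (abs_le.1 h1).2
  linarith

theorem psi_ineq {α y : ℝ} (h0 : 0 ≤ α) (h1 : α ≤ 1 / 100) (hy : |y| ≤ 1 / 3) :
    2 * Real.exp (α * (3 / 4 * (1 + y)) - 2 * α ^ 2) + 2 * Real.exp (α * (3 / 4 * (-1 + y)) - 2 * α ^ 2)
      + Real.exp (α * (-3 * y) + 2 * α ^ 2) ≤ 5 := by
  obtain ⟨hy1, hy2⟩ := abs_le.1 hy
  have hd : α + 2 * α ^ 2 ≤ 1 := by nlinarith
  have e1 : |α * (3 / 4 * (1 + y)) - 2 * α ^ 2| ≤ α + 2 * α ^ 2 := by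
    rw [abs_le]; constructor <;> nlinarith
  have e2 : |α * (3 / 4 * (-1 + y)) - 2 * α ^ 2| ≤ α + 2 * α ^ 2 := by
    rw [abs_le]; constructor <;> nlinarith
  have e3 : |α * (-3 * y) + 2 * α ^ 2| ≤ α + 2 * α ^ 2 := by
    rw [abs_le]; constructor <;> nlinarith
  have f1 := exp_quad e1 hd
  have f2 := exp_quad e2 hd
  have f3 := exp_quad e3 hd
  have : (α + 2 * α ^ 2) ^ 2 ≤ 6 / 5 * α ^ 2 := by
    have : (α + 2 * α ^ 2) ^ 2 = α ^ 2 * (1 + 2 * α) ^ 2 := by ring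
    rw [this]
    nlinarith [sq_nonneg α, mul_nonneg (sq_nonneg α) h0]
  nlinarith

theorem psi_ineq_root {α : ℝ} (h0 : 0 ≤ α) (h1 : α ≤ 1 / 100) :
    2 * Real.exp (α * (3 / 4 * (1 + 0)) - 2 * α ^ 2)
      + 2 * Real.exp (α * (3 / 4 * (-1 + 0)) - 2 * α ^ 2) ≤ 4 := by
  have hd : α + 2 * α ^ 2 ≤ 1 := by nlinarith
  have e1 : |α * (3 / 4 * (1 + 0)) - 2 * α ^ 2| ≤ α + 2 * α ^ 2 := by
    rw [abs_le]; constructor <;> nlinarith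
  have e2 : |α * (3 / 4 * (-1 + 0)) - 2 * α ^ 2| ≤ α + 2 * α ^ 2 := by
    rw [abs_le]; constructor <;> nlinarith
  have f1 := exp_quad e1 hd
  have f2 := exp_quad e2 hd
  have : (α + 2 * α ^ 2) ^ 2 ≤ 6 / 5 * α ^ 2 := by
    have : (α + 2 * α ^ 2) ^ 2 = α ^ 2 * (1 + 2 * α) ^ 2 := by ring
    rw [this]
    nlinarith [sq_nonneg α, mul_nonneg (sq_nonneg α) h0]
  nlinarith

theorem phi_ineq {ε α y u : ℝ} (h0 : 0 ≤ ε) (h1 : ε ≤ 1) (hα : α = ε / 64) (hy : |y| ≤ 1 / 3)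
    (hu : (u = 0 ∧ y = 0) ∨ u = 1 ∨ u = 1 + ε) :
    2 * ((1 + ε) * (Real.exp (-α * (3 / 4 * (1 + y)) + 4 * α ^ 2) - 1))
      + 2 * (Real.exp (-α * (3 / 4 * (-1 + y)) + 4 * α ^ 2) - 1)
      + u * (Real.exp (-α * (-3 * y) - 4 * α ^ 2) - 1) ≤ 0 := by
  obtain ⟨hy1, hy2⟩ := abs_le.1 hy
  have hα0 : 0 ≤ α := by rw [hα]; positivity
  have hα1 : α ≤ 1 / 64 := by rw [hα]; linarith
  have hε : ε = 64 * α := by rw [hα]; ring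
  have hd : α + 4 * α ^ 2 ≤ 1 := by nlinarith
  have e1 : |-α * (3 / 4 * (1 + y)) + 4 * α ^ 2| ≤ α + 4 * α ^ 2 := by
    rw [abs_le]; constructor <;> nlinarith
  have e2 : |-α * (3 / 4 * (-1 + y)) + 4 * α ^ 2| ≤ α + 4 * α ^ 2 := by
    rw [abs_le]; constructor <;> nlinarith
  have e3 : |-α * (-3 * y) - 4 * α ^ 2| ≤ α + 4 * α ^ 2 := by
    rw [abs_le]; constructor <;> nlinarith
  have f1 := exp_quad e1 hd
  have f2 := exp_quad e2 hd
  have f3 := exp_quad e3 hd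
  have hq : (α + 4 * α ^ 2) ^ 2 ≤ 9 / 8 * (α ^ 2) + α ^ 2 / 32 := by
    have : (α + 4 * α ^ 2) ^ 2 = α ^ 2 * (1 + 4 * α) ^ 2 := by ring
    rw [this]
    have : (1 + 4 * α) ^ 2 ≤ 9 / 8 + 1 / 32 := by nlinarith
    nlinarith [sq_nonneg α]
  have hu0 : 0 ≤ u ∧ u ≤ 2 := by
    rcases hu with ⟨h, _⟩ | h | h <;> rw [h] <;> constructor <;> linarith
  set Q := (α + 4 * α ^ 2) ^ 2
  have g1 : (1 + ε) * (Real.exp (-α * (3 / 4 * (1 + y)) + 4 * α ^ 2) - 1)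
      ≤ (1 + ε) * (-α * (3 / 4 * (1 + y)) + 4 * α ^ 2 + Q) :=
    mul_le_mul_of_nonneg_left (by linarith) (by linarith)
  have g3 : u * (Real.exp (-α * (-3 * y) - 4 * α ^ 2) - 1)
      ≤ u * (-α * (-3 * y) - 4 * α ^ 2 + Q) :=
    mul_le_mul_of_nonneg_left (by linarith) hu0.1
  have hQ0 : 0 ≤ Q := sq_nonneg _
  have hfirst : ε ≤ 3 / 2 * ε * (1 + y) + 3 * y * (1 - u) := by
    rcases hu with ⟨h, h'⟩ | h | h
    · rw [h, h']; linarith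
    · rw [h]; nlinarith
    · rw [h]; nlinarith
  have h2 : 2 * ((1 + ε) * (-α * (3 / 4 * (1 + y)) + 4 * α ^ 2 + Q))
      + 2 * (-α * (3 / 4 * (-1 + y)) + 4 * α ^ 2 + Q) + u * (-α * (-3 * y) - 4 * α ^ 2 + Q)
      = -α * (3 / 2 * ε * (1 + y) + 3 * y * (1 - u)) + 4 * α ^ 2 * (4 + 2 * ε - u)
        + Q * (4 + 2 * ε + u) := by ring
  have h3 : α * ε ≤ α * (3 / 2 * ε * (1 + y) + 3 * y * (1 - u)) :=
    mul_le_mul_of_nonneg_left hfirst hα0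
  have h4 : 4 * α ^ 2 * (4 + 2 * ε - u) ≤ 4 * α ^ 2 * 6 :=
    mul_le_mul_of_nonneg_left (by linarith) (by positivity)
  have h5 : Q * (4 + 2 * ε + u) ≤ Q * 8 := mul_le_mul_of_nonneg_left (by linarith) hQ0
  have h6 : α * ε = 64 * α ^ 2 := by rw [hε]; ring
  nlinarith [sq_nonneg α]

end ineq

/-! ### Words -/
section words

/-- The sign of a letter. -/
noncomputable def lx (a : Fin 4) : ℝ := if a.1 < 2 then 1 else -1

noncomputable def wY : List (Fin 4) → ℝ
  | [] => 0
  | a :: w => (wY w + lx a) / 4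

noncomputable def wS : List (Fin 4) → ℝ
  | [] => 0
  | a :: w => wS w + lx a

noncomputable def wX (w : List (Fin 4)) : ℝ := wS w - wY w

theorem lx_abs (a : Fin 4) : |lx a| = 1 := by
  unfold lx; split_ifs <;> simp

theorem wY_abs (w : List (Fin 4)) : |wY w| ≤ 1 / 3 := by
  induction w with
  | nil => simp [wY]
  | cons a w ih =>
    have h1 := lx_abs a
    have h2 := abs_add_le (wY w) (lx a)
    simp only [wY, abs_div]
    rw [abs_of_pos (show (0 : ℝ) < 4 by norm_num)]
    linarith

theorem wX_nil : wX [] = 0 := by simp [wX, wS, wY]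

theorem wX_cons (a : Fin 4) (w : List (Fin 4)) :
    wX (a :: w) = wX w + 3 / 4 * (lx a + wY w) := by
  simp only [wX, wS, wY]; ring

theorem wX_up (a : Fin 4) (w : List (Fin 4)) :
    wX w = wX (a :: w) + (-3 * wY (a :: w)) := by
  simp only [wX, wS, wY]; ring

theorem wX_abs (w : List (Fin 4)) : |wX w| ≤ w.length := by
  induction w with
  | nil => simp [wX_nil]
  | cons a w ih =>
    rw [wX_cons]
    have h1 := lx_abs a
    have h2 := wY_abs w
    have h3 := abs_add_le (lx a) (wY w)
    have h4 := abs_add_le (wX w) (3 / 4 * (lx a + wY w))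
    rw [abs_mul, abs_of_pos (show (0 : ℝ) < 3 / 4 by norm_num)] at h4
    simp only [List.length_cons]; push_cast
    linarith

theorem sum_lx (f : ℝ → ℝ) : ∑ a : Fin 4, f (lx a) = 2 * f 1 + 2 * f (-1) := by
  simp [Fin.sum_univ_four, lx]; ring

/-- Words of length `d`. -/
noncomputable def wl : ℕ → Finset (List (Fin 4))
  | 0 => {[]}
  | d + 1 => ((univ : Finset (Fin 4)) ×ˢ wl d).image (fun x => x.1 :: x.2)

theorem mem_wl (d : ℕ) (w : List (Fin 4)) : w ∈ wl d ↔ w.length = d := by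
  induction d generalizing w with
  | zero => simp [wl]
  | succ d ih =>
    simp only [wl, mem_image, mem_product, mem_univ, true_and, Prod.exists]
    constructor
    · rintro ⟨a, u, h, rfl⟩
      simp [(ih u).1 h]
    · intro h
      match w, h with
      | a :: u, h => exact ⟨a, u, (ih u).2 (by simpa using h), rfl⟩

theorem sum_wl_succ (d : ℕ) (f : List (Fin 4) → ℝ) :
    ∑ w ∈ wl (d + 1), f w = ∑ w ∈ wl d, ∑ a, f (a :: w) := by
  rw [wl, Finset.sum_image, Finset.sum_product_right]
  rintro ⟨a, u⟩ _ ⟨b, v⟩ _ h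
  simpa using h

theorem card_wl (d : ℕ) : ∑ _w ∈ wl d, (1 : ℝ) = 4 ^ d := by
  induction d with
  | zero => simp [wl]
  | succ d ih =>
    rw [sum_wl_succ]
    simp only [sum_const, card_univ, Fintype.card_fin, nsmul_eq_mul, mul_one] at ih ⊢
    rw [ih]; push_cast; ring

/-- Chernoff bound for the words with drift. -/
theorem chernoff (κ : ℝ) (h0 : 0 ≤ κ) (d : ℕ) :
    ∑ w ∈ wl d, Real.exp (κ * wS w) ≤ 4 ^ d * Real.exp (κ ^ 2 / 2 * d) := by
  induction d with
  | zero => simp [wl, wS]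
  | succ d ih =>
    rw [sum_wl_succ]
    have : ∀ w, ∑ a, Real.exp (κ * wS (a :: w)) = 4 * Real.cosh κ * Real.exp (κ * wS w) := by
      intro w
      have := sum_lx (fun y => Real.exp (κ * (wS w + y)))
      simp only [wS]
      rw [this, Real.cosh_eq, mul_add, mul_add, Real.exp_add, Real.exp_add]
      simp; ring
    simp only [this]
    rw [← Finset.mul_sum]
    have hc := Real.cosh_le_exp_half_sq κ
    calc 4 * Real.cosh κ * ∑ w ∈ wl d, Real.exp (κ * wS w)
        ≤ 4 * Real.exp (κ ^ 2 / 2) * (4 ^ d * Real.exp (κ ^ 2 / 2 * d)) := by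
          gcongr
      _ = _ := by
          push_cast
          rw [mul_add, Real.exp_add, mul_one]; ring

/-- The number of words of length `d` with `wX w ≥ κ d`. -/
theorem chernoff_card (κ : ℝ) (h0 : 0 ≤ κ) (d : ℕ) :
    ∑ _w ∈ (wl d).filter (fun w => κ * d ≤ wX w), (1 : ℝ)
      ≤ 4 ^ d * Real.exp (κ / 3 - κ ^ 2 / 2 * d) := by
  have h1 : ∑ _w ∈ (wl d).filter (fun w => κ * d ≤ wX w), (1 : ℝ)
      ≤ ∑ w ∈ wl d, Real.exp (κ * wS w) * Real.exp (κ / 3 - κ ^ 2 * d) := by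
    refine le_trans (Finset.sum_le_sum (f := fun _ => (1 : ℝ))
      (g := fun w => Real.exp (κ * wS w) * Real.exp (κ / 3 - κ ^ 2 * d)) ?_)
      (Finset.sum_le_sum_of_subset_of_nonneg (Finset.filter_subset _ _)
        fun _ _ _ => by positivity)
    intro w hw
    simp only [mem_filter] at hw
    rw [← Real.exp_add]
    apply Real.one_le_exp
    have hy := (abs_le.1 (wY_abs w)).1
    have : κ * d - 1 / 3 ≤ wS w := by
      have := hw.2; unfold wX at this; linarith
    nlinarith
  refine h1.trans ?_
  rw [← Finset.sum_mul]
  calc (∑ w ∈ wl d, Real.exp (κ * wS w)) * Real.exp (κ / 3 - κ ^ 2 * d)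
      ≤ 4 ^ d * Real.exp (κ ^ 2 / 2 * d) * Real.exp (κ / 3 - κ ^ 2 * d) := by
        gcongr; exact chernoff κ h0 d
    _ = _ := by
        rw [mul_assoc, ← Real.exp_add]; congr 2; ring

end words

/-! ### Abstract upper bound -/
section absUpper
open Classical
variable {V : Type*} [Fintype V]

theorem sum_etaK_le (G : SimpleGraph V) (A : V → Prop) (Db : V → ℝ) (hDb0 : ∀ x, 0 ≤ Db x)
    (hnb : ∀ x, A x → #(univ.filter (fun k => G.Adj x k ∧ ¬ A k)) ≤ 4) :
    ∑ k ∈ univ.filter (fun x => ¬ A x), etaK G A Db k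
      ≤ 4 * (∑ x ∈ univ.filter A, Db x) / #(univ.filter (fun x => ¬ A x)) := by
  unfold etaK
  rw [← Finset.sum_div]
  gcongr
  have e : ∀ k, ∑ x ∈ univ.filter (fun x => G.Adj k x ∧ A x), Db x
      = ∑ x ∈ univ.filter A, if G.Adj k x then Db x else 0 := by
    intro k
    rw [← Finset.sum_filter, Finset.filter_filter]
    refine Finset.sum_congr ?_ fun _ _ => rfl
    ext x; simp [and_comm]
  simp only [e]
  rw [Finset.sum_comm, Finset.mul_sum]
  refine Finset.sum_le_sum fun x hx => ?_
  simp only [mem_filter, mem_univ, true_and] at hx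
  rw [← Finset.sum_filter, Finset.filter_filter, Finset.sum_const, nsmul_eq_mul]
  refine mul_le_mul_of_nonneg_right ?_ (hDb0 x)
  have e2 : univ.filter (fun k => ¬ A k ∧ G.Adj k x) = univ.filter (fun k => G.Adj x k ∧ ¬ A k) := by
    ext k; simp [and_comm, G.adj_comm]
  rw [e2]
  exact_mod_cast hnb x hx

theorem etaK_le (G : SimpleGraph V) (A : V → Prop) (k : V) :
    etaK G A (fun _ => 1) k ≤ #(univ.filter A) / #(univ.filter (fun x => ¬ A x)) := by
  unfold etaK
  gcongr
  simp only [sum_const, nsmul_eq_mul, mul_one]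
  exact_mod_cast Finset.card_le_card (fun x hx => by simp at hx ⊢; exact hx.2)

theorem etaK_nonneg (G : SimpleGraph V) (A : V → Prop) (Db : V → ℝ) (hDb0 : ∀ x, 0 ≤ Db x) (k : V) :
    0 ≤ etaK G A Db k := div_nonneg (Finset.sum_nonneg fun _ _ => hDb0 _) (by positivity)

theorem mix_upper (G : SimpleGraph V) (hE : 0 < #(swS G)) (A : V → Prop)
    (hK : ∀ p q, ¬ A p → ¬ A q → p ≠ q → G.Adj p q)
    (hnb : ∀ x, A x → #(univ.filter (fun k => G.Adj x k ∧ ¬ A k)) ≤ 4)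
    (hKne : ∃ k, ¬ A k)
    (Db : V → ℝ) (hDb0 : ∀ x, 0 ≤ Db x) (s t : ℕ)
    (hDb : ∀ t x k, A x → ¬ A k → Dsw G (s + t) x k ≤ Db x)
    (hsum : ∑ x ∈ univ.filter A, Db x ≤ 1 / 100)
    (ht : (1 - 2 / (2 * (#(swS G) : ℝ))) ^ t * Fintype.card V ≤ 1 / 100) :
    tvMixUnif (lazyCayleyWP (swS G) (fun _ => 1)) ≤ s + t := by
  have hD := dsys_Dsw G hE
  have hZ : ∑ r ∈ swS G, (1 : ℝ) ≠ 0 := by simp; intro h; simp [h] at hE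
  set N := 2 * (#(swS G) : ℝ) with hN
  set KK := univ.filter (fun x => ¬ A x) with hKK
  set sd := ∑ x ∈ univ.filter A, Db x with hsdd
  have hsd0 : 0 ≤ sd := Finset.sum_nonneg fun _ _ => hDb0 _
  have hcK : (1 : ℝ) ≤ #KK := by
    obtain ⟨k, hk⟩ := hKne
    exact_mod_cast Finset.card_pos.2 ⟨k, by simp [hKK, hk]⟩
  have hcV : (#KK : ℝ) ≤ Fintype.card V := by exact_mod_cast Finset.card_le_univ KK
  set σ := ∑ k ∈ KK, etaK G A Db k with hσ
  have hσ' : σ ≤ 4 * sd / #KK := sum_etaK_le G A Db hDb0 hnb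
  have hη0 := fun k => etaK_nonneg G A Db hDb0 k
  have hσ0 : 0 ≤ σ := Finset.sum_nonneg fun k _ => hη0 k
  have hr : 0 ≤ 1 - 2 / N := by
    have : 2 / N ≤ 1 := by rw [div_le_one (by linarith [hD.Npos])]; exact hD.Npos
    linarith
  set R := (1 - 2 / N) ^ t with hR
  have hR0 : 0 ≤ R := pow_nonneg hr t
  let β : V → ℝ := fun x => if A x then 2 * Db x else R / 2 + σ / 2 + etaK G A Db x
  have hβ0 : ∀ p, 0 ≤ β p := by
    intro p
    simp only [β]; split_ifs
    · linarith [hDb0 p]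
    · linarith [hη0 p]
  have hβ : ∀ p q, p ≠ q → Dsw G (s + t) p q ≤ β p + β q := by
    intro p q hpq
    by_cases hp : A p
    · by_cases hq : A q
      · obtain ⟨k, hk⟩ := hKne
        have h1 := Dsw_triangle G (s + t) p q k hpq (fun h => hk (h ▸ hq))
        have h2 := hDb t p k hp hk
        have h3 := hDb t q k hq hk
        simp only [β, hp, hq, if_true]
        linarith [hDb0 q]
      · have h2 := hDb t p q hp hq
        have := hβ0 q
        have : β p = 2 * Db p := by simp [β, hp]
        linarith [hDb0 p]
    · by_cases hq : A q
      · have h2 := hDb t q p hq hp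
        rw [hD.symm] at h2
        have := hβ0 p
        have : β q = 2 * Db q := by simp [β, hq]
        linarith [hDb0 q]
      · have := KK_lemma G N (Dsw G) hD A hK Db hDb0 s hDb t p q hp hq hpq
        simp only [β, hp, hq, if_false]
        linarith
  refine tvMix_le _ _ (one_notMem_swS G) hZ _ fun g => ?_
  have h1 := wdist_le_support G (s + t) β hβ0 hβ _ g le_rfl
  have h2 : ∑ p ∈ g.support, β p ≤ ∑ p, β p :=
    Finset.sum_le_sum_of_subset_of_nonneg (Finset.subset_univ _) fun _ _ _ => hβ0 _
  have h3 : ∑ p, β p = 2 * sd + (#KK * (R / 2 + σ / 2) + σ) := by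
    simp only [β]
    rw [Finset.sum_ite, ← Finset.mul_sum, Finset.sum_add_distrib, Finset.sum_const, nsmul_eq_mul]
  have h4 : #KK * σ ≤ 4 * sd := by
    have := mul_le_mul_of_nonneg_left hσ' (show (0 : ℝ) ≤ #KK by linarith)
    have e : (#KK : ℝ) * (4 * sd / #KK) = 4 * sd := by field_simp
    linarith
  have h5 : σ ≤ 4 * sd := by nlinarith
  have h6 : #KK * R ≤ 1 / 100 := by nlinarith
  linarith

end absUpper

/-! ### The gadget -/
section gadget
open Classical

noncomputable instance wordFintype (n : ℕ) : Fintype {l : List (Fin 4) // l.length ≤ n} :=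
  @Fintype.ofFinite _ (List.finite_length_le (Fin 4) n)

structure GP where
  H : ℕ
  q : ℕ
  l : ℕ
  b0 : ℕ
  m : ℕ
  ε : ℝ

namespace GP

/-- The checkpoints. -/
def cp (p : GP) (i : ℕ) : ℕ := p.H * p.q ^ i
def L (p : GP) : ℕ := p.cp (p.l - 1)
def Bi (p : GP) (i : ℕ) : ℕ := p.b0 * p.q ^ (p.l - 1 - i)
noncomputable def lay (p : GP) (d : ℕ) : ℕ := #((range p.l).filter (fun i => p.cp i ≤ d))
noncomputable def B (p : GP) (d : ℕ) : ℕ := p.Bi (p.lay d)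
def Bmax (p : GP) : ℕ := p.b0 * p.q ^ (p.l - 1)
def T (p : GP) : ℕ := p.b0 * p.q ^ (p.l - 1) * p.H
noncomputable def κ (p : GP) : ℝ := p.ε / 32

structure Ok (p : GP) : Prop where
  H4 : 8 ≤ p.H
  q2 : 2 ≤ p.q
  l1 : 1 ≤ p.l
  bq : p.q ≤ p.b0
  m1 : 2 ≤ p.m
  e0 : 0 < p.ε
  e1 : p.ε ≤ 1
  qk : 88 ≤ p.q * p.κ ^ 2

def good (p : GP) (w : List (Fin 4)) : Prop :=
  w.length < p.L ∧ ∀ i, w.length = p.cp i → p.κ * w.length ≤ wX w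

def alive (p : GP) : List (Fin 4) → Prop
  | [] => True
  | a :: w => p.alive w ∧ p.good (a :: w)

abbrev Wd (p : GP) : Type := {l : List (Fin 4) // l.length ≤ p.L}

def VT (p : GP) : Type := (p.Wd × Fin (p.Bmax + 1)) ⊕ Fin p.m

noncomputable instance (p : GP) : Fintype p.VT :=
  inferInstanceAs (Fintype ((p.Wd × Fin (p.Bmax + 1)) ⊕ Fin p.m))

/-- Clique vertices outside of the gadget. -/
def cl (p : GP) (i : Fin p.m) : p.VT := Sum.inr i

variable {p : GP}

theorem cp_strict (hp : p.Ok) : StrictMono p.cp := by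
  apply strictMono_nat_of_lt_succ
  intro i
  have h1 := hp.H4
  have h2 := hp.q2
  unfold cp
  rw [pow_succ, ← mul_assoc]
  have : 0 < p.H * p.q ^ i := by positivity
  nlinarith

theorem cp_pos (hp : p.Ok) (i : ℕ) : 0 < p.cp i := by
  have h1 := hp.H4
  have h2 := hp.q2
  unfold cp; positivity

theorem cp_succ (i : ℕ) : p.cp (i + 1) = p.q * p.cp i := by
  unfold cp; rw [pow_succ]; ring

theorem lay_le_iff (hp : p.Ok) (d i : ℕ) (hi : i < p.l) : p.lay d ≤ i ↔ d < p.cp i := by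
  constructor
  · intro h
    by_contra hc
    push Not at hc
    have : range (i + 1) ⊆ (range p.l).filter (fun i => p.cp i ≤ d) := by
      intro j hj
      simp only [mem_range, mem_filter] at hj ⊢
      exact ⟨by omega, ((cp_strict hp).monotone (by omega)).trans hc⟩
    have := Finset.card_le_card this
    rw [card_range] at this
    unfold lay at h
    omega
  · intro h
    have : (range p.l).filter (fun i => p.cp i ≤ d) ⊆ range i := by
      intro j hj
      simp only [mem_range, mem_filter] at hj ⊢
      by_contra hc
      push Not at hc
      have := (cp_strict hp).monotone hc
      omega
    have := Finset.card_le_card this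
    rw [card_range] at this
    exact this

theorem lay_lt (hp : p.Ok) {d : ℕ} (hd : d < p.L) : p.lay d < p.l := by
  have h1 := hp.l1
  have := (lay_le_iff hp d (p.l - 1) (by omega)).2 hd
  omega

theorem lt_cp_lay (hp : p.Ok) {d : ℕ} (hd : d < p.L) : d < p.cp (p.lay d) :=
  (lay_le_iff hp d _ (lay_lt hp hd)).1 le_rfl

theorem cp_le_of_lay (hp : p.Ok) {d i : ℕ} (hd : d < p.L) (h : i < p.lay d) : p.cp i ≤ d := by
  by_contra hc
  push Not at hc
  have := (lay_le_iff hp d i (h.trans (lay_lt hp hd))).2 hc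
  omega

theorem lay_mono (d d' : ℕ) (h : d ≤ d') : p.lay d ≤ p.lay d' := by
  unfold lay
  refine Finset.card_le_card fun i hi => ?_
  simp only [mem_filter] at hi ⊢
  exact ⟨hi.1, hi.2.trans h⟩

theorem Bi_mul_cp (i : ℕ) (hi : i < p.l) : p.Bi i * p.cp i = p.T := by
  unfold Bi cp T
  have : p.q ^ (p.l - 1) = p.q ^ (p.l - 1 - i) * p.q ^ i := by
    rw [← pow_add]; congr 1; omega
  rw [this]; ring

theorem Bi_anti (hp : p.Ok) {i j : ℕ} (h : i ≤ j) : p.Bi j ≤ p.Bi i := by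
  unfold Bi
  have := hp.q2
  gcongr
  · omega
  

theorem Bi_le_Bmax (hp : p.Ok) (i : ℕ) : p.Bi i ≤ p.Bmax := by
  have := Bi_anti hp (Nat.zero_le i)
  unfold Bmax
  simpa [Bi] using this

theorem b0_le_Bi (hp : p.Ok) (i : ℕ) : p.b0 ≤ p.Bi i := by
  unfold Bi
  have := hp.q2
  exact Nat.le_mul_of_pos_right _ (by positivity)

theorem B_le_Bmax (hp : p.Ok) (d : ℕ) : p.B d ≤ p.Bmax := Bi_le_Bmax hp _

theorem alive_len (hp : p.Ok) {w : List (Fin 4)} (h : p.alive w) : w.length < p.L := by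
  match w, h with
  | [], _ => exact cp_pos hp _
  | a :: w, h => exact h.2.1

theorem κ_pos (hp : p.Ok) : 0 < p.κ := by have := hp.e0; unfold κ; positivity
theorem κ_le (hp : p.Ok) : p.κ ≤ 1 / 32 := by have := hp.e1; unfold κ; linarith

/-- vertices -/
def nd (w : p.Wd) (j : Fin (p.Bmax + 1)) : p.VT := Sum.inl (w, j)

def ch (w : p.Wd) (h : w.1.length < p.L) (a : Fin 4) : p.Wd := ⟨a :: w.1, by simpa using h⟩

def inA (p : GP) : p.VT → Prop
  | Sum.inl (w, j) => p.alive w.1 ∧ j.1 ≤ p.B w.1.length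
  | Sum.inr _ => False

def gad (p : GP) : p.VT → p.VT → Prop
  | Sum.inl (w, i), Sum.inl (w', i') => p.alive w.1 ∧ i.1 = 0 ∧
      ((i'.1 = 0 ∧ ∃ a, w'.1 = a :: w.1) ∨ (w' = w ∧ 1 ≤ i'.1 ∧ i'.1 ≤ p.B w.1.length))
  | _, _ => False

/-- The graph. -/
def Gr (p : GP) : SimpleGraph p.VT where
  Adj x y := x ≠ y ∧ ((¬ p.inA x ∧ ¬ p.inA y) ∨ p.gad x y ∨ p.gad y x)
  symm := ⟨fun x y h => ⟨h.1.symm, by tauto⟩⟩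
  loopless := ⟨fun x h => h.1 rfl⟩

theorem Gr_adj (x y : p.VT) : p.Gr.Adj x y ↔
  x ≠ y ∧ ((¬ p.inA x ∧ ¬ p.inA y) ∨ p.gad x y ∨ p.gad y x) := Iff.rfl

theorem Gr_clique (x y : p.VT) (hx : ¬ p.inA x) (hy : ¬ p.inA y) (h : x ≠ y) : p.Gr.Adj x y :=
  ⟨h, Or.inl ⟨hx, hy⟩⟩

theorem inA_nd (w : p.Wd) (j : Fin (p.Bmax + 1)) :
    p.inA (nd w j) ↔ p.alive w.1 ∧ j.1 ≤ p.B w.1.length := Iff.rfl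

theorem nd_inj (w w' : p.Wd) (j j' : Fin (p.Bmax + 1)) (h : nd w j = nd w' j') :
    w = w' ∧ j = j' := by
  exact Prod.mk.inj (Sum.inl.inj h)

theorem adj_root (w : p.Wd) (hw : p.alive w.1) (y : p.VT) :
    p.Gr.Adj (nd w 0) y ↔ (∃ w' : p.Wd, (∃ a, w'.1 = a :: w.1) ∧ y = nd w' 0)
      ∨ (∃ w' : p.Wd, (∃ a, w.1 = a :: w'.1) ∧ y = nd w' 0)
      ∨ (∃ j : Fin (p.Bmax + 1), 1 ≤ j.1 ∧ j.1 ≤ p.B w.1.length ∧ y = nd w j) := by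
  rw [Gr_adj]
  have hA : p.inA (nd w 0) := ⟨hw, by simp⟩
  constructor
  · rintro ⟨hne, h⟩
    rcases h with h | h | h
    · exact absurd hA h.1
    · match y, h with
      | Sum.inl (w', j'), h =>
        obtain ⟨-, -, h⟩ := h
        rcases h with ⟨h1, h2⟩ | ⟨h1, h2, h3⟩
        · left
          refine ⟨w', h2, ?_⟩
          have : j' = 0 := Fin.ext h1
          rw [this]; rfl
        · right; right
          exact ⟨j', h2, h3, by rw [h1]; rfl⟩
    · match y, h with
      | Sum.inl (w', j'), h =>
        obtain ⟨-, h0, h⟩ := h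
        rcases h with ⟨h1, h2⟩ | ⟨h1, h2, h3⟩
        · right; left
          refine ⟨w', h2, ?_⟩
          have : j' = 0 := Fin.ext h0
          rw [this]; rfl
        · simp at h2
  · rintro (⟨w', ⟨a, ha⟩, rfl⟩ | ⟨w', ⟨a, ha⟩, rfl⟩ | ⟨j, h1, h2, rfl⟩)
    · refine ⟨?_, Or.inr (Or.inl ⟨hw, rfl, Or.inl ⟨rfl, a, ha⟩⟩)⟩
      intro h
      replace h := nd_inj _ _ _ _ h
      rw [← h.1] at ha
      have := congrArg List.length ha
      simp at this
    · refine ⟨?_, Or.inr (Or.inr ⟨?_, rfl, Or.inl ⟨rfl, a, ha⟩⟩)⟩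
      · intro h
        replace h := nd_inj _ _ _ _ h
        rw [← h.1] at ha
        have := congrArg List.length ha
        simp at this
      · rw [ha] at hw; exact hw.1
    · refine ⟨?_, Or.inr (Or.inl ⟨hw, rfl, Or.inr ⟨rfl, h1, h2⟩⟩)⟩
      intro h
      replace h := nd_inj _ _ _ _ h
      rw [← h.2] at h1
      simp at h1

theorem adj_pend (w : p.Wd) (hw : p.alive w.1) (j : Fin (p.Bmax + 1)) (h1 : 1 ≤ j.1)
    (h2 : j.1 ≤ p.B w.1.length) (y : p.VT) : p.Gr.Adj (nd w j) y ↔ y = nd w 0 := by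
  have hA : p.inA (nd w j) := ⟨hw, h2⟩
  constructor
  · rintro ⟨hne, h⟩
    rcases h with h | h | h
    · exact absurd hA h.1
    · match y, h with
      | Sum.inl (w', j'), h =>
        obtain ⟨-, h0, h⟩ := h
        omega
    · match y, h with
      | Sum.inl (w', j'), h =>
        obtain ⟨-, h0, h⟩ := h
        rcases h with ⟨h3, h4⟩ | ⟨h3, h4, h5⟩
        · omega
        · have : j' = 0 := Fin.ext h0
          rw [this, h3]; rfl
  · rintro rfl
    exact ((adj_root w hw _).2 (Or.inr (Or.inr ⟨j, h1, h2, rfl⟩))).symm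

/-- The backbone parent sum. -/
noncomputable def upS (w : p.Wd) (f : p.VT → ℝ) : ℝ :=
  ∑ u ∈ univ.filter (fun u : p.Wd => ∃ a, w.1 = a :: u.1), f (nd u 0)

noncomputable def pend (w : p.Wd) : Finset (Fin (p.Bmax + 1)) :=
  univ.filter (fun j => 1 ≤ j.1 ∧ j.1 ≤ p.B w.1.length)

theorem sum_nbr_root (w : p.Wd) (hw : p.alive w.1) (hl : w.1.length < p.L) (f : p.VT → ℝ) :
    ∑ y ∈ univ.filter (p.Gr.Adj (nd w 0)), f y
      = ∑ a, f (nd (ch w hl a) 0) + upS w f + ∑ j ∈ pend w, f (nd w j) := by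
  have e : univ.filter (p.Gr.Adj (nd w 0)) =
      ((univ.image fun a => nd (ch w hl a) 0) ∪
      ((univ.filter (fun u : p.Wd => ∃ a, w.1 = a :: u.1)).image fun u => nd u 0))
      ∪ (pend w).image (fun j => nd w j) := by
    ext y
    simp only [mem_filter, mem_univ, true_and, adj_root w hw, mem_union, mem_image, pend]
    constructor
    · rintro (⟨w', ⟨a, ha⟩, rfl⟩ | ⟨w', ha, rfl⟩ | ⟨j, h1, h2, rfl⟩)
      · left; left
        refine ⟨a, ?_⟩
        congr 1
        exact Subtype.ext ha.symm
      · left; right; exact ⟨w', ha, rfl⟩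
      · right; exact ⟨j, ⟨h1, h2⟩, rfl⟩
    · rintro ((⟨a, rfl⟩ | ⟨w', ha, rfl⟩) | ⟨j, ⟨h1, h2⟩, rfl⟩)
      · left; exact ⟨_, ⟨a, rfl⟩, rfl⟩
      · right; left; exact ⟨w', ha, rfl⟩
      · right; right; exact ⟨j, h1, h2, rfl⟩
  rw [e, Finset.sum_union, Finset.sum_union, Finset.sum_image, Finset.sum_image, Finset.sum_image]
  · rfl
  · intro j _ j' _ h; exact (nd_inj _ _ _ _ h).2
  · intro j _ j' _ h; exact (nd_inj _ _ _ _ h).1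
  · intro a _ a' _ h
    have := congrArg Subtype.val (nd_inj _ _ _ _ h).1
    simp [ch] at this
    exact this
  · rw [Finset.disjoint_left]
    intro y h1 h2
    simp only [mem_image, mem_univ, true_and, mem_filter] at h1 h2
    obtain ⟨a, rfl⟩ := h1
    obtain ⟨u, ⟨b, hb⟩, h⟩ := h2
    have := congrArg Subtype.val (nd_inj _ _ _ _ h).1
    rw [this] at hb
    have := congrArg List.length hb
    simp [ch] at this
    omega
  · rw [Finset.disjoint_left]
    intro y h1 h2
    simp only [mem_image, mem_univ, true_and, mem_filter, mem_union, pend] at h1 h2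
    obtain ⟨j, ⟨hj, _⟩, rfl⟩ := h2
    rcases h1 with ⟨a, h⟩ | ⟨u, _, h⟩
    · have := (nd_inj _ _ _ _ h).2; rw [← this] at hj; simp at hj
    · have := (nd_inj _ _ _ _ h).2; rw [← this] at hj; simp at hj

theorem sum_nbr_pend (w : p.Wd) (hw : p.alive w.1) (j : Fin (p.Bmax + 1)) (h1 : 1 ≤ j.1)
    (h2 : j.1 ≤ p.B w.1.length) (f : p.VT → ℝ) :
    ∑ y ∈ univ.filter (p.Gr.Adj (nd w j)), f y = f (nd w 0) := by
  have : univ.filter (p.Gr.Adj (nd w j)) = {nd w 0} := by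
    ext y; simp [adj_pend w hw j h1 h2]
  rw [this, Finset.sum_singleton]

theorem upS_nil (w : p.Wd) (h : w.1 = []) (f : p.VT → ℝ) : upS w f = 0 := by
  unfold upS
  apply Finset.sum_eq_zero
  intro u hu
  simp [h] at hu

theorem upS_cons (w u : p.Wd) (a : Fin 4) (h : w.1 = a :: u.1) (f : p.VT → ℝ) :
    upS w f = f (nd u 0) := by
  unfold upS
  rw [Finset.sum_eq_single u]
  · intro v hv hne
    simp only [mem_filter, mem_univ, true_and] at hv
    obtain ⟨b, hb⟩ := hv
    rw [h] at hb
    simp at hb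
    exact absurd (Subtype.ext hb.2.symm) hne
  · intro h'
    exfalso; apply h'
    simp only [mem_filter, mem_univ, true_and]
    exact ⟨a, h⟩

theorem card_pend (hp : p.Ok) (w : p.Wd) : #(pend w) = p.B w.1.length := by
  have hB := B_le_Bmax hp w.1.length
  have : pend w = (Finset.univ : Finset (Fin (p.B w.1.length))).image
      (fun i => ⟨i.1 + 1, by omega⟩) := by
    ext j
    simp only [pend, mem_filter, mem_univ, true_and, mem_image]
    constructor
    · rintro ⟨h1, h2⟩
      exact ⟨⟨j.1 - 1, by omega⟩, Fin.ext (by simp; omega)⟩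
    · rintro ⟨i, rfl⟩
      simp
  rw [this, Finset.card_image_of_injective]
  · simp
  · intro i i' h
    simp at h
    exact Fin.ext h

theorem nbrK_le (hp : p.Ok) (x : p.VT) (hx : p.inA x) :
    #(univ.filter (fun k => p.Gr.Adj x k ∧ ¬ p.inA k)) ≤ 4 := by
  match x, hx with
  | Sum.inl (w, j), hx =>
    obtain ⟨hw, hj⟩ := hx
    by_cases h0 : j.1 = 0
    · have : j = 0 := Fin.ext h0
      subst this
      have hl := alive_len hp hw
      have : univ.filter (fun k => p.Gr.Adj (nd w 0) k ∧ ¬ p.inA k)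
          ⊆ univ.image fun a => nd (ch w hl a) 0 := by
        intro y hy
        simp only [mem_filter, mem_univ, true_and, adj_root w hw] at hy
        obtain ⟨hy, hyA⟩ := hy
        rcases hy with ⟨w', ⟨a, ha⟩, rfl⟩ | ⟨w', ⟨a, ha⟩, rfl⟩ | ⟨j, h1, h2, rfl⟩
        · simp only [mem_image, mem_univ, true_and]
          refine ⟨a, ?_⟩
          congr 1
          exact Subtype.ext ha.symm
        · exfalso; apply hyA
          rw [ha] at hw
          exact ⟨hw.1, by simp⟩
        · exact absurd ⟨hw, h2⟩ hyA
      have h := Finset.card_le_card this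
      have h' := Finset.card_image_le (s := (univ : Finset (Fin 4)))
        (f := fun a => nd (p := p) (ch w hl a) 0)
      simp only [card_univ, Fintype.card_fin] at h'
      exact h.trans h'
    · have : univ.filter (fun k => p.Gr.Adj (nd w j) k ∧ ¬ p.inA k) = ∅ := by
        ext y
        simp only [mem_filter, mem_univ, true_and, adj_pend w hw j (by omega) hj]
        constructor
        · rintro ⟨rfl, h⟩
          exact absurd ⟨hw, by simp⟩ h
        · simp
      change #(univ.filter (fun k => p.Gr.Adj (nd w j) k ∧ ¬ p.inA k)) ≤ 4
      rw [this]; simp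

theorem swS_pos (hp : p.Ok) : 0 < #(swS p.Gr) := by
  have := hp.m1
  refine Finset.card_pos.2 ⟨Equiv.swap (p.cl ⟨0, by omega⟩) (p.cl ⟨1, by omega⟩), ?_⟩
  rw [mem_swS]
  refine ⟨_, _, Gr_clique (p.cl ⟨0, by omega⟩) (p.cl ⟨1, by omega⟩) (fun h => h) (fun h => h) ?_, rfl⟩
  intro h
  have := Sum.inr.inj h
  simp at this

end GP
end gadget

/-! ### Lower bound for the weighted walk -/
section lower
open Classical
namespace GP
variable {p : GP}

/-- The weights. -/
noncomputable def wtS (p : GP) (s : Equiv.Perm p.VT) : ℝ :=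
  if ∃ (w : p.Wd) (h : w.1.length < p.L) (a : Fin 4), a.1 < 2 ∧ s (nd w 0) = nd (ch w h a) 0
  then 1 + p.ε else 1

theorem wtS_cases (s : Equiv.Perm p.VT) : p.wtS s = 1 ∨ p.wtS s = 1 + p.ε := by
  unfold wtS; split_ifs <;> simp

theorem wtS_ge (hp : p.Ok) (s : Equiv.Perm p.VT) : 1 ≤ p.wtS s ∧ p.wtS s ≤ 1 + p.ε := by
  have := hp.e0
  rcases wtS_cases s with h | h <;> rw [h] <;> constructor <;> linarith

theorem nd_ne_ch (w : p.Wd) (h : w.1.length < p.L) (a : Fin 4) : nd w 0 ≠ nd (ch w h a) 0 := by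
  intro e
  have := congrArg (fun x => x.1.length) (nd_inj _ _ _ _ e).1
  simp [ch] at this

theorem wtS_child (w : p.Wd) (hl : w.1.length < p.L) (a : Fin 4) :
    p.wtS (Equiv.swap (nd w 0) (nd (ch w hl a) 0)) = if a.1 < 2 then 1 + p.ε else 1 := by
  unfold wtS
  by_cases ha : a.1 < 2
  · rw [if_pos, if_pos ha]
    exact ⟨w, hl, a, ha, by simp⟩
  · rw [if_neg, if_neg ha]
    rintro ⟨w', h', a', ha', e⟩
    by_cases h1 : nd w' 0 = nd w 0
    · have hw : w' = w := (nd_inj _ _ _ _ h1).1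
      subst hw
      rw [Equiv.swap_apply_left] at e
      have := congrArg Subtype.val (nd_inj _ _ _ _ e).1
      simp [ch] at this
      rw [this] at ha; exact ha ha'
    · by_cases h2 : nd w' 0 = nd (ch w hl a) 0
      · rw [h2, Equiv.swap_apply_right] at e
        have h3 := congrArg (fun x => x.1.length) (nd_inj _ _ _ _ e).1
        have h4 := congrArg (fun x => x.1.length) (nd_inj _ _ _ _ h2).1
        simp [ch] at h3 h4
        omega
      · rw [Equiv.swap_apply_of_ne_of_ne h1 h2] at e
        exact nd_ne_ch _ _ _ e

theorem wtS_pend (w : p.Wd) (j : Fin (p.Bmax + 1)) (hj : 1 ≤ j.1) :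
    p.wtS (Equiv.swap (nd w j) (nd w 0)) = 1 := by
  unfold wtS
  rw [if_neg]
  rintro ⟨w', h', a', ha', e⟩
  have hj0 : j ≠ 0 := by rintro rfl; simp at hj
  by_cases h1 : nd w' 0 = nd w j
  · exact hj0 (nd_inj _ _ _ _ h1).2.symm
  · by_cases h2 : nd w' 0 = nd w 0
    · rw [h2, Equiv.swap_apply_right] at e
      exact hj0 (nd_inj _ _ _ _ e).2
    · rw [Equiv.swap_apply_of_ne_of_ne h1 h2] at e
      exact nd_ne_ch _ _ _ e

noncomputable def sf (p : GP) (d : ℕ) : ℝ := ∑ j ∈ range d, 1 / (p.cp (p.lay j) : ℝ)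
noncomputable def gt (p : GP) (d : ℕ) : ℝ := Real.exp (p.sf d - p.sf p.L)
noncomputable def aa (p : GP) : ℝ := p.ε / 64
noncomputable def φ (p : GP) (w : List (Fin 4)) : ℝ :=
  Real.exp (-(4 * p.aa ^ 2) * p.H / 2) * Real.exp (- p.aa * wX w + 4 * p.aa ^ 2 * w.length)
noncomputable def θ (p : GP) : ℝ := 16 / p.T

theorem T_ge (hp : p.Ok) : 16 ≤ p.T := by
  unfold T
  have h1 := hp.H4
  have h2 := hp.bq
  have h3 := hp.q2
  have h4 : 1 ≤ p.q ^ (p.l - 1) := Nat.one_le_pow _ _ (by omega)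
  have h5 : 2 ≤ p.b0 * p.q ^ (p.l - 1) := by nlinarith
  nlinarith

theorem T_pos (hp : p.Ok) : (0 : ℝ) < p.T := by
  have := T_ge hp
  exact_mod_cast (by omega : 0 < p.T)

theorem θ_pos (hp : p.Ok) : 0 < p.θ := by have := T_pos hp; unfold θ; positivity
theorem θ_le (hp : p.Ok) : p.θ ≤ 1 := by
  have := T_pos hp
  have h : (16 : ℝ) ≤ p.T := by exact_mod_cast T_ge hp
  unfold θ; rw [div_le_one this]; exact h

theorem φ_pos (w : List (Fin 4)) : 0 < p.φ w := by unfold φ; positivity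
theorem gt_pos (d : ℕ) : 0 < p.gt d := Real.exp_pos _

theorem gt_succ (d : ℕ) : p.gt (d + 1) = p.gt d * Real.exp (1 / (p.cp (p.lay d) : ℝ)) := by
  unfold gt
  rw [← Real.exp_add]
  congr 1
  have : p.sf (d + 1) = p.sf d + 1 / (p.cp (p.lay d) : ℝ) := by
    unfold sf; rw [Finset.sum_range_succ]
  rw [this]; ring

theorem gt_mono (d : ℕ) : p.gt d ≤ p.gt (d + 1) := by
  rw [gt_succ]
  have := gt_pos (p := p) d
  have h : 1 ≤ Real.exp (1 / (p.cp (p.lay d) : ℝ)) := Real.one_le_exp (by positivity)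
  nlinarith

/-- The test function. -/
noncomputable def GF (p : GP) : p.VT → ℝ
  | Sum.inl (w, j) => if p.alive w.1 ∧ j.1 ≤ p.B w.1.length then
      min 1 ((if j.1 = 0 then p.gt w.1.length else p.gt w.1.length / (1 + p.θ)) + p.φ w.1) else 1
  | Sum.inr _ => 1

theorem GF_nd (w : p.Wd) (j : Fin (p.Bmax + 1)) : p.GF (nd w j) =
    if p.alive w.1 ∧ j.1 ≤ p.B w.1.length then
      min 1 ((if j.1 = 0 then p.gt w.1.length else p.gt w.1.length / (1 + p.θ)) + p.φ w.1)
    else 1 := rfl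

theorem GF_K (x : p.VT) (h : ¬ p.inA x) : p.GF x = 1 := by
  match x, h with
  | Sum.inl (w, j), h => exact if_neg h
  | Sum.inr _, _ => rfl

theorem GF_le_one (x : p.VT) : p.GF x ≤ 1 := by
  match x with
  | Sum.inl (w, j) =>
    change p.GF (nd w j) ≤ 1
    rw [GF_nd]; split_ifs
    · exact min_le_left _ _
    · exact min_le_left _ _
    · exact le_rfl
  | Sum.inr _ => exact le_rfl

theorem GF_nonneg (hp : p.Ok) (x : p.VT) : 0 ≤ p.GF x := by
  have h1 := θ_pos hp
  match x with
  | Sum.inl (w, j) =>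
    change 0 ≤ p.GF (nd w j)
    rw [GF_nd]
    have h2 := gt_pos (p := p) w.1.length
    have h3 := φ_pos (p := p) w.1
    split_ifs
    · exact le_min zero_le_one (by positivity)
    · exact le_min zero_le_one (by positivity)
    · exact zero_le_one
  | Sum.inr _ => exact zero_le_one

theorem φ_cp (hp : p.Ok) (w : List (Fin 4)) (i : ℕ) (h : w.length = p.cp i)
    (h' : wX w < p.κ * w.length) : 1 ≤ p.φ w := by
  unfold φ
  rw [← Real.exp_add]
  apply Real.one_le_exp
  have ha : 0 < p.aa := by have := hp.e0; unfold aa; positivity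
  have hκ : p.κ = 2 * p.aa := by unfold κ aa; ring
  have hH : (p.H : ℝ) ≤ w.length := by
    have : p.cp 0 ≤ p.cp i := (cp_strict hp).monotone (Nat.zero_le i)
    rw [h]
    have e : p.cp 0 = p.H := by simp [cp]
    rw [e] at this
    exact_mod_cast this
  rw [hκ] at h'
  have h1 : p.aa * wX w ≤ p.aa * (2 * p.aa * w.length) := mul_le_mul_of_nonneg_left h'.le ha.le
  have h2 := mul_le_mul_of_nonneg_left hH (sq_nonneg p.aa)
  nlinarith

theorem GF_child (hp : p.Ok) (w : p.Wd) (hw : p.alive w.1) (hl : w.1.length < p.L) (a : Fin 4) :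
    p.GF (nd (ch w hl a) 0) ≤ p.gt (w.1.length + 1) + p.φ (a :: w.1) := by
  rw [GF_nd]
  by_cases h : p.alive (a :: w.1)
  · rw [if_pos ⟨h, by simp⟩]
    refine (min_le_right _ _).trans ?_
    simp [ch]
  · rw [if_neg (fun h' => h h'.1)]
    have hg : ¬ p.good (a :: w.1) := fun hg => h ⟨hw, hg⟩
    unfold good at hg
    by_cases h1 : (a :: w.1).length < p.L
    · have : ¬ ∀ i, (a :: w.1).length = p.cp i → p.κ * (a :: w.1).length ≤ wX (a :: w.1) :=
        fun h2 => hg ⟨h1, h2⟩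
      push Not at this
      obtain ⟨i, h2, h3⟩ := this
      have := φ_cp hp _ i h2 h3
      linarith [gt_pos (p := p) (w.1.length + 1)]
    · have e : w.1.length + 1 = p.L := by
        simp only [List.length_cons] at h1; omega
      rw [e]
      have : p.gt p.L = 1 := by simp [gt]
      rw [this]; linarith [φ_pos (p := p) (a :: w.1)]

theorem φ_cons (a : Fin 4) (w : List (Fin 4)) : p.φ (a :: w)
    = p.φ w * Real.exp (- p.aa * (3 / 4 * (lx a + wY w)) + 4 * p.aa ^ 2) := by
  unfold φ
  simp only [← Real.exp_add]
  congr 1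
  rw [wX_cons]; simp only [List.length_cons]; push_cast; ring

theorem φ_up (a : Fin 4) (w : List (Fin 4)) : p.φ w
    = p.φ (a :: w) * Real.exp (- p.aa * (-3 * wY (a :: w)) - 4 * p.aa ^ 2) := by
  unfold φ
  simp only [← Real.exp_add]
  congr 1
  rw [wX_up a w]; simp only [List.length_cons]; push_cast; ring

theorem gt_ineq (hp : p.Ok) {d : ℕ} (hd : d < p.L) :
    6 * (p.gt (d + 1) - p.gt d) + p.B d * (p.gt d / (1 + p.θ) - p.gt d) ≤ 0 := by
  have hlay := lay_lt hp hd
  have hBT := Bi_mul_cp (p := p) (p.lay d) hlay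
  set h : ℝ := (p.cp (p.lay d) : ℝ) with hh
  have hBT' : (p.B d : ℝ) * h = p.T := by
    rw [hh]; unfold B; exact_mod_cast hBT
  have h8 : (8 : ℝ) ≤ h := by
    have h1 : p.cp 0 ≤ p.cp (p.lay d) := (cp_strict hp).monotone (Nat.zero_le _)
    have e : p.cp 0 = p.H := by simp [cp]
    have := hp.H4
    rw [e] at h1
    rw [hh]; exact_mod_cast this.trans h1
  have hg := gt_pos (p := p) d
  have hθ := θ_pos hp
  have hθ1 := θ_le hp
  rw [gt_succ]
  have hx : 1 / h ≤ 1 / 8 := one_div_le_one_div_of_le (by norm_num) h8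
  have hx0 : 0 < 1 / h := by positivity
  have he : Real.exp (1 / h) ≤ 1 + 1 / h + (1 / h) ^ 2 :=
    exp_quad (by rw [abs_of_pos hx0]) (by linarith)
  have he2 : Real.exp (1 / h) - 1 ≤ 9 / 8 * (1 / h) := by nlinarith
  have hB : (p.B d : ℝ) = p.T * (1 / h) := by
    rw [← hBT']; field_simp
  have hT := T_pos hp
  have hθT : (p.T : ℝ) * p.θ = 16 := by unfold θ; field_simp
  have e1 : p.gt d / (1 + p.θ) - p.gt d = - (p.gt d * (p.θ / (1 + p.θ))) := by
    field_simp; ring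
  have e2 : p.θ / 2 ≤ p.θ / (1 + p.θ) :=
    div_le_div_of_nonneg_left hθ.le (by linarith) (by linarith)
  have e3 : (p.B d : ℝ) * (p.gt d / (1 + p.θ) - p.gt d) ≤ - (8 * (1 / h) * p.gt d) := by
    rw [e1, hB]
    have h9 : p.gt d * (p.θ / 2) ≤ p.gt d * (p.θ / (1 + p.θ)) :=
      mul_le_mul_of_nonneg_left e2 hg.le
    have h10 : (p.T : ℝ) * (1 / h) * (p.gt d * (p.θ / 2))
        ≤ (p.T : ℝ) * (1 / h) * (p.gt d * (p.θ / (1 + p.θ))) :=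
      mul_le_mul_of_nonneg_left h9 (by positivity)
    have h11 : (p.T : ℝ) * (1 / h) * (p.gt d * (p.θ / 2)) = 8 * (1 / h) * p.gt d := by
      calc (p.T : ℝ) * (1 / h) * (p.gt d * (p.θ / 2))
          = (p.T * p.θ) * ((1 / h) * p.gt d / 2) := by ring
        _ = _ := by rw [hθT]; ring
    linarith
  have e4 : p.gt d * (Real.exp (1 / h) - 1) ≤ p.gt d * (9 / 8 * (1 / h)) :=
    mul_le_mul_of_nonneg_left he2 hg.le
  have : 0 ≤ (1 / h) * p.gt d := by positivity
  nlinarith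

theorem GF_root (hp : p.Ok) (w : p.Wd) (hw : p.alive w.1) :
    ∑ y ∈ univ.filter (p.Gr.Adj (nd w 0)),
      p.wtS (Equiv.swap (nd w 0) y) * (p.GF y - p.GF (nd w 0)) ≤ p.θ * p.GF (nd w 0) := by
  have hl := alive_len hp hw
  have hθ := θ_pos hp
  have hwt := fun y => wtS_ge hp (Equiv.swap (nd w 0) y)
  have hGx : p.GF (nd w 0) = min 1 (p.gt w.1.length + p.φ w.1) := by
    rw [GF_nd, if_pos ⟨hw, by simp⟩]; simp
  by_cases hbig : 1 ≤ p.gt w.1.length + p.φ w.1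
  · have h1 : p.GF (nd w 0) = 1 := by rw [hGx]; exact min_eq_left hbig
    rw [h1]
    refine (Finset.sum_nonpos fun y _ => ?_).trans (by linarith)
    have := GF_le_one y
    have := hwt y
    nlinarith
  · have h1 : p.GF (nd w 0) = p.gt w.1.length + p.φ w.1 := by
      rw [hGx]; exact min_eq_right (by linarith)
    rw [sum_nbr_root w hw hl]
    have hε0 := hp.e0
    have hε1 := hp.e1
    set g := p.gt w.1.length with hg
    set f := p.φ w.1 with hf
    have hg0 : 0 < g := gt_pos _
    have hf0 : 0 < f := φ_pos _
    have hy := wY_abs w.1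
    set y := wY w.1 with hyd
    set g1 := p.gt (w.1.length + 1) with hg1
    have hgm : g ≤ g1 := gt_mono _
    -- children
    have hc : ∑ a, p.wtS (Equiv.swap (nd w 0) (nd (ch w hl a) 0))
          * (p.GF (nd (ch w hl a) 0) - p.GF (nd w 0))
        ≤ 6 * (g1 - g) + f * (2 * ((1 + p.ε) * (Real.exp (-p.aa * (3 / 4 * (1 + y)) + 4 * p.aa ^ 2) - 1))
      + 2 * (Real.exp (-p.aa * (3 / 4 * (-1 + y)) + 4 * p.aa ^ 2) - 1)) := by
      have h2 : ∀ a, p.wtS (Equiv.swap (nd w 0) (nd (ch w hl a) 0))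
          * (p.GF (nd (ch w hl a) 0) - p.GF (nd w 0))
          ≤ (if a.1 < 2 then 1 + p.ε else 1) * ((g1 - g) +
            f * (Real.exp (-p.aa * (3 / 4 * (lx a + y)) + 4 * p.aa ^ 2) - 1)) := by
        intro a
        have h3 := GF_child hp w hw hl a
        rw [φ_cons] at h3
        have h4 := hwt (nd (ch w hl a) 0)
        rw [wtS_child] at h4 ⊢
        refine mul_le_mul_of_nonneg_left ?_ (by linarith)
        rw [h1]
        linarith
      refine (Finset.sum_le_sum fun a _ => h2 a).trans ?_
      simp only [Fin.sum_univ_four, lx]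
      simp
      nlinarith
    -- pendants
    have hpd : ∑ j ∈ pend w, p.wtS (Equiv.swap (nd w 0) (nd w j))
          * (p.GF (nd w j) - p.GF (nd w 0)) ≤ p.B w.1.length * (g / (1 + p.θ) - g) := by
      rw [← card_pend hp w, ← nsmul_eq_mul]
      refine Finset.sum_le_card_nsmul _ _ _ fun j hj => ?_
      simp only [pend, mem_filter, mem_univ, true_and] at hj
      rw [Equiv.swap_comm, wtS_pend w j hj.1, one_mul, h1]
      have : p.GF (nd w j) ≤ g / (1 + p.θ) + f := by
        rw [GF_nd, if_pos ⟨hw, hj.2⟩, if_neg (by omega)]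
        exact min_le_right _ _
      linarith
    have hgi := gt_ineq hp hl
    -- parent
    have hup : ∃ u : ℝ, ((u = 0 ∧ y = 0) ∨ u = 1 ∨ u = 1 + p.ε) ∧
        upS w (fun z => p.wtS (Equiv.swap (nd w 0) z) * (p.GF z - p.GF (nd w 0)))
        ≤ f * (u * (Real.exp (-p.aa * (-3 * y) - 4 * p.aa ^ 2) - 1)) := by
      match hwe : w.1 with
      | [] =>
        refine ⟨0, Or.inl ⟨rfl, ?_⟩, ?_⟩
        · rw [hyd, hwe]; simp [wY]
        · rw [upS_nil w hwe]; simp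
      | a :: u0 =>
        have hul : u0.length ≤ p.L := by
          have := w.2; rw [hwe] at this; simp at this; omega
        set u : p.Wd := ⟨u0, hul⟩ with hu
        rw [upS_cons w u a (by rw [hwe])]
        refine ⟨p.wtS (Equiv.swap (nd w 0) (nd u 0)), Or.inr (wtS_cases _), ?_⟩
        have hua : p.alive u0 := by rw [hwe] at hw; exact hw.1
        have h3 : p.GF (nd u 0) ≤ p.gt u0.length + p.φ u0 := by
          rw [GF_nd, if_pos ⟨hua, by simp⟩]
          refine (min_le_right _ _).trans ?_
          simp [hu]
        have h4 : p.gt u0.length ≤ g := by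
          rw [hg, hwe]; exact gt_mono _
        rw [φ_up a u0, ← hwe, ← hf, ← hyd] at h3
        have h5 := (hwt (nd u 0)).1
        have h6 : p.GF (nd u 0) - p.GF (nd w 0)
            ≤ f * (Real.exp (-p.aa * (-3 * y) - 4 * p.aa ^ 2) - 1) := by rw [h1]; linarith
        have := mul_le_mul_of_nonneg_left h6 (show 0 ≤ p.wtS (Equiv.swap (nd w 0) (nd u 0)) by linarith)
        refine this.trans (le_of_eq ?_)
        ring
    obtain ⟨u, hu, hup⟩ := hup
    have hphi := phi_ineq hε0.le hε1 (show p.aa = p.ε / 64 from rfl) hy hu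
    have hphi' := mul_nonpos_of_nonneg_of_nonpos hf0.le hphi
    have hpos : 0 ≤ p.θ * p.GF (nd w 0) := mul_nonneg hθ.le (GF_nonneg hp _)
    nlinarith

theorem GF_super (hp : p.Ok) (x : p.VT) :
    ∑ y ∈ univ.filter (p.Gr.Adj x), p.wtS (Equiv.swap x y) * (p.GF y - p.GF x) ≤ p.θ * p.GF x := by
  have hθ := θ_pos hp
  by_cases hx : p.inA x
  · match x, hx with
    | Sum.inl (w, j), hx =>
      obtain ⟨hw, hj⟩ := hx
      by_cases h0 : j.1 = 0
      · have : j = 0 := Fin.ext h0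
        subst this
        exact GF_root hp w hw
      · change ∑ y ∈ univ.filter (p.Gr.Adj (nd w j)),
          p.wtS (Equiv.swap (nd w j) y) * (p.GF y - p.GF (nd w j)) ≤ p.θ * p.GF (nd w j)
        rw [sum_nbr_pend w hw j (by omega) hj, wtS_pend w j (by omega), one_mul]
        have e0 : p.GF (nd w 0) = min 1 (p.gt w.1.length + p.φ w.1) := by
          rw [GF_nd w 0, if_pos ⟨hw, by simp⟩]; simp
        have ej : p.GF (nd w j) = min 1 (p.gt w.1.length / (1 + p.θ) + p.φ w.1) := by
          rw [GF_nd w j, if_pos ⟨hw, hj⟩, if_neg h0]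
        rw [e0, ej]
        have hg0 := gt_pos (p := p) w.1.length
        have hf0 := φ_pos (p := p) w.1
        set g := p.gt w.1.length
        set f := p.φ w.1
        have e : g = (1 + p.θ) * (g / (1 + p.θ)) := by field_simp
        have hg' : 0 < g / (1 + p.θ) := by positivity
        set g' := g / (1 + p.θ)
        rcases le_total 1 (g' + f) with h | h
        · rw [min_eq_left h]
          have := min_le_left 1 (g + f)
          linarith
        · rw [min_eq_right h]
          have := min_le_right 1 (g + f)
          nlinarith
  · rw [GF_K x hx]
    refine (Finset.sum_nonpos fun y _ => ?_).trans (by linarith)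
    have := GF_le_one y
    have := wtS_ge hp (Equiv.swap x y)
    nlinarith

theorem sf_ge (hp : p.Ok) (i : ℕ) (hi : i < p.l) : ((i : ℝ) + 1) / 2 ≤ p.sf (p.cp i) := by
  induction i with
  | zero =>
    have hH : (0 : ℝ) < p.cp 0 := by exact_mod_cast cp_pos hp 0
    have : p.sf (p.cp 0) = 1 := by
      unfold sf
      rw [Finset.sum_congr rfl (g := fun _ => 1 / (p.cp 0 : ℝ))]
      · simp; field_simp
      · intro j hj
        have : p.lay j ≤ 0 := (lay_le_iff hp j 0 hi).2 (by simpa using hj)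
        rw [Nat.le_zero.1 this]
    rw [this]; norm_num
  | succ i ih =>
    have h1 := ih (by omega)
    have hle : p.cp i ≤ p.cp (i + 1) := (cp_strict hp).monotone (by omega)
    have h2 : p.sf (p.cp (i + 1)) = p.sf (p.cp i)
        + ∑ j ∈ Ico (p.cp i) (p.cp (i + 1)), 1 / (p.cp (p.lay j) : ℝ) := by
      unfold sf; rw [Finset.sum_range_add_sum_Ico _ hle]
    have hc : (0 : ℝ) < p.cp (i + 1) := by exact_mod_cast cp_pos hp (i + 1)
    have h3 : (#(Ico (p.cp i) (p.cp (i + 1)))) • (1 / (p.cp (i + 1) : ℝ))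
        ≤ ∑ j ∈ Ico (p.cp i) (p.cp (i + 1)), 1 / (p.cp (p.lay j) : ℝ) := by
      refine Finset.card_nsmul_le_sum _ _ _ fun j hj => ?_
      rw [mem_Ico] at hj
      have h4 : p.lay j ≤ i + 1 := (lay_le_iff hp j (i + 1) hi).2 hj.2
      have h5 : p.cp (p.lay j) ≤ p.cp (i + 1) := (cp_strict hp).monotone h4
      have h6 : (0 : ℝ) < p.cp (p.lay j) := by exact_mod_cast cp_pos hp _
      exact one_div_le_one_div_of_le h6 (by exact_mod_cast h5)
    rw [Nat.card_Ico, nsmul_eq_mul, Nat.cast_sub hle] at h3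
    have h7 : (2 : ℝ) * p.cp i ≤ p.cp (i + 1) := by
      have := hp.q2
      rw [cp_succ]; push_cast
      have : (2 : ℝ) ≤ p.q := by exact_mod_cast this
      have : (0 : ℝ) ≤ p.cp i := by positivity
      nlinarith
    have h8 : 1 / 2 ≤ ((p.cp (i + 1) : ℝ) - p.cp i) * (1 / (p.cp (i + 1) : ℝ)) := by
      rw [mul_one_div, div_le_div_iff₀ (by norm_num) hc]; linarith
    push_cast
    linarith

/-- The root. -/
def rt (p : GP) : p.VT := nd ⟨[], by simp⟩ 0

theorem GF_rt (hp : p.Ok) : p.GF p.rt ≤ Real.exp (-(p.l : ℝ) / 2)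
    + Real.exp (-(4 * p.aa ^ 2) * p.H / 2) := by
  unfold rt
  rw [GF_nd, if_pos ⟨trivial, by simp⟩]
  refine (min_le_right _ _).trans ?_
  simp only [Fin.val_zero, if_true, List.length_nil]
  have h1 := hp.l1
  have h2 := sf_ge hp (p.l - 1) (by omega)
  rw [Nat.cast_sub h1] at h2
  push_cast at h2
  have h3 : p.gt 0 ≤ Real.exp (-(p.l : ℝ) / 2) := by
    unfold gt
    apply Real.exp_le_exp.2
    have : p.sf 0 = 0 := by simp [sf]
    rw [this]
    unfold L
    linarith
  have h4 : p.φ [] = Real.exp (-(4 * p.aa ^ 2) * p.H / 2) := by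
    simp [φ, wX_nil]
  linarith

theorem sum_perm_inv {V : Type*} [Fintype V] (f : V → ℝ) (r : V) :
    (Fintype.card V : ℝ) * ∑ g : Equiv.Perm V, f (g⁻¹ r)
      = Fintype.card (Equiv.Perm V) * ∑ v, f v := by
  have h1 : ∀ r', ∑ g : Equiv.Perm V, f (g⁻¹ r') = ∑ g : Equiv.Perm V, f (g⁻¹ r) := by
    intro r'
    rw [← Equiv.sum_comp (Equiv.mulLeft (Equiv.swap r r'))]
    refine Finset.sum_congr rfl fun g _ => ?_
    simp
  have h2 : ∑ r', ∑ g : Equiv.Perm V, f (g⁻¹ r') = ∑ g : Equiv.Perm V, ∑ v, f v := by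
    rw [Finset.sum_comm]
    exact Finset.sum_congr rfl fun g _ => Equiv.sum_comp (g⁻¹ : Equiv.Perm V) f
  rw [Finset.sum_congr rfl (fun r' _ => h1 r')] at h2
  simpa using h2

theorem lower_bound (hp : p.Ok) (hS : IsSymmGen (swS p.Gr))
    (hK : 3 / 4 * (Fintype.card p.VT : ℝ) ≤ #(univ.filter (fun x => ¬ p.inA x)))
    (hsmall : Real.exp ((p.l : ℝ) / 4) * (Real.exp (-(p.l : ℝ) / 2)
      + Real.exp (-(4 * p.aa ^ 2) * p.H / 2)) < 1 / 2) :
    (#(swS p.Gr) : ℝ) * p.l * p.T / 32 ≤ tvMixUnif (lazyCayleyWP (swS p.Gr) p.wtS) := by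
  have hwt := fun s => wtS_ge hp s
  have hw0 : ∀ s ∈ swS p.Gr, 0 < p.wtS s := fun s _ => by linarith [(hwt s).1]
  have hE : (1 : ℝ) ≤ #(swS p.Gr) := by exact_mod_cast swS_pos hp
  set E : ℝ := (#(swS p.Gr) : ℝ) with hEd
  set Z := ∑ r ∈ swS p.Gr, p.wtS r with hZd
  have hZE : E ≤ Z := by
    have := Finset.card_nsmul_le_sum (swS p.Gr) p.wtS 1 (fun s _ => (hwt s).1)
    rw [nsmul_eq_mul, mul_one] at this
    exact this
  have hZ0 : Z ≠ 0 := by linarith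
  have h1S := one_notMem_swS p.Gr
  refine (Nat.ceil_le.1 (le_tvMix (swS p.Gr) p.wtS hS hw0 hZ0 ⌈E * p.l * p.T / 32⌉₊ ?_))
  intro t ht
  rw [Nat.ceil_le]
  by_contra hlt
  push Not at hlt
  have hθ := θ_pos hp
  have hT := T_pos hp
  set P := lazyCayleyWP (swS p.Gr) p.wtS with hP
  -- supersolution
  have hsup : ∀ g : Equiv.Perm p.VT, ∑ y, P g y * p.GF (y⁻¹ p.rt)
      ≤ (1 + p.θ / (2 * Z)) * p.GF (g⁻¹ p.rt) := by
    intro g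
    rw [hP, lcw_apply _ _ h1S (fun y => p.GF (y⁻¹ p.rt))]
    set v := g⁻¹ p.rt with hv
    have e : ∀ s ∈ swS p.Gr, p.wtS s * p.GF ((g * s)⁻¹ p.rt)
        = p.wtS s * (p.GF (s v) - p.GF v) + p.wtS s * p.GF v := by
      intro s hs
      rw [mul_inv_rev, sq_swS _ hs, Equiv.Perm.mul_apply]; ring
    rw [Finset.sum_congr rfl e, Finset.sum_add_distrib, sum_swS, ← Finset.sum_mul]
    have h := GF_super hp v
    have h2 : 1 / (2 * Z) * (∑ y ∈ univ.filter (p.Gr.Adj v), p.wtS (Equiv.swap v y) * (p.GF y - p.GF v))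
        ≤ 1 / (2 * Z) * (p.θ * p.GF v) :=
      mul_le_mul_of_nonneg_left h (by have : 0 < Z := by linarith
                                      positivity)
    have e2 : 1 / (2 * Z) * (Z * p.GF v) = 1 / 2 * p.GF v := by field_simp
    change 1 / 2 * p.GF v + 1 / (2 * Z) * (_ + Z * p.GF v) ≤ _
    rw [mul_add, e2]
    have e3 : (1 + p.θ / (2 * Z)) * p.GF v = p.GF v + 1 / (2 * Z) * (p.θ * p.GF v) := by ring
    rw [e3]
    linarith
  have hc0 : 0 ≤ 1 + p.θ / (2 * Z) := by have : 0 < Z := by linarith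
                                         positivity
  have h1 := lcw_super (swS p.Gr) p.wtS (fun s hs => (hw0 s hs).le) (fun y => p.GF (y⁻¹ p.rt))
    _ hc0 hsup t 1
  rw [← hP] at h1
  simp only [inv_one, Equiv.Perm.coe_one, id_eq] at h1
  have hexp : (1 + p.θ / (2 * Z)) ^ t ≤ Real.exp ((p.l : ℝ) / 4) := by
    have h2 : 1 + p.θ / (2 * Z) ≤ Real.exp (p.θ / (2 * Z)) := by
      linarith [Real.add_one_le_exp (p.θ / (2 * Z))]
    refine (pow_le_pow_left₀ hc0 h2 t).trans ?_
    rw [← Real.exp_nat_mul]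
    apply Real.exp_le_exp.2
    have hZp : 0 < Z := by linarith
    have h3 : (t : ℝ) * (p.θ / (2 * Z)) ≤ (E * p.l * p.T / 32) * (p.θ / (2 * E)) := by
      gcongr
    refine h3.trans (le_of_eq ?_)
    unfold θ; field_simp; ring
  have h2 : ∑ y, (P ^ t) 1 y * p.GF (y⁻¹ p.rt) < 1 / 2 := by
    refine lt_of_le_of_lt h1 (lt_of_le_of_lt ?_ hsmall)
    have := GF_rt hp
    have := GF_nonneg hp p.rt
    gcongr
  -- indicator of the clique
  let f : p.VT → ℝ := fun v => if p.inA v then 0 else 1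
  have hf1 : ∑ y, (P ^ t) 1 y * f (y⁻¹ p.rt) ≤ ∑ y, (P ^ t) 1 y * p.GF (y⁻¹ p.rt) := by
    refine Finset.sum_le_sum fun y _ => mul_le_mul_of_nonneg_left ?_
      (lcw_pow_nonneg _ _ (fun s hs => (hw0 s hs).le) _ _ _)
    simp only [f]
    split_ifs with h
    · exact GF_nonneg hp _
    · rw [GF_K _ h]
  have hu := sum_perm_inv f p.rt
  have hfs : ∑ v, f v = #(univ.filter (fun x => ¬ p.inA x)) := by
    simp only [f]; rw [Finset.sum_ite]; simp
  rw [hfs] at hu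
  have hTV := ht 1
  set n1 : ℝ := (Fintype.card (Equiv.Perm p.VT) : ℝ) with hn1
  have hn1p : 0 < n1 := by rw [hn1]; exact_mod_cast Fintype.card_pos
  have hcV : (0 : ℝ) < Fintype.card p.VT := by
    exact_mod_cast Fintype.card_pos_iff.2 ⟨p.rt⟩
  have hrow := lcw_pow_row (swS p.Gr) p.wtS h1S hZ0 t 1
  rw [← hP] at hrow
  have hmain : ∑ y, (1 / n1 - (P ^ t) 1 y) * (f (y⁻¹ p.rt) - 1 / 2)
      ≤ (∑ y, |(P ^ t) 1 y - 1 / n1|) / 2 := by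
    rw [Finset.sum_div]
    refine Finset.sum_le_sum fun y _ => ?_
    have hf : f (y⁻¹ p.rt) = 0 ∨ f (y⁻¹ p.rt) = 1 := by
      simp only [f]; split_ifs <;> simp
    have ha := le_abs_self ((P ^ t) 1 y - 1 / n1)
    have hb := neg_abs_le ((P ^ t) 1 y - 1 / n1)
    rcases hf with h | h <;> rw [h] <;> linarith
  have e1 : ∑ y, (1 / n1 - (P ^ t) 1 y) * (f (y⁻¹ p.rt) - 1 / 2)
      = 1 / n1 * ∑ y : Equiv.Perm p.VT, f (y⁻¹ p.rt) - ∑ y, (P ^ t) 1 y * f (y⁻¹ p.rt) := by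
    have : ∀ y : Equiv.Perm p.VT, (1 / n1 - (P ^ t) 1 y) * (f (y⁻¹ p.rt) - 1 / 2)
        = 1 / n1 * f (y⁻¹ p.rt) - (P ^ t) 1 y * f (y⁻¹ p.rt) - (1 / n1) / 2 + (P ^ t) 1 y / 2 := by
      intro y; ring
    simp only [this]
    have hhalf : ∑ y, (P ^ t) 1 y / 2 = 1 / 2 := by rw [← Finset.sum_div, hrow]
    rw [Finset.sum_add_distrib, Finset.sum_sub_distrib, Finset.sum_sub_distrib, ← Finset.mul_sum,
      hhalf]
    simp only [sum_const, nsmul_eq_mul, card_univ]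
    change _ - n1 * (1 / n1 / 2) + 1 / 2 = _
    have : n1 * (1 / n1 / 2) = 1 / 2 := by field_simp
    rw [this]; ring
  have e2 : 3 / 4 ≤ 1 / n1 * ∑ y : Equiv.Perm p.VT, f (y⁻¹ p.rt) := by
    have h3 : ∑ y : Equiv.Perm p.VT, f (y⁻¹ p.rt)
        = n1 * #(univ.filter (fun x => ¬ p.inA x)) / Fintype.card p.VT := by
      rw [eq_div_iff hcV.ne']; linarith
    rw [h3]
    have : 1 / n1 * (n1 * (#(univ.filter (fun x => ¬ p.inA x)) : ℝ) / Fintype.card p.VT)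
        = #(univ.filter (fun x => ¬ p.inA x)) / Fintype.card p.VT := by field_simp
    rw [this, le_div_iff₀ hcV]
    exact hK
  linarith

end GP
end lower


section upper
open Classical
namespace GP
variable {p : GP}

def stt (p : GP) (i : ℕ) : ℕ := if i = 0 then 0 else p.cp (i - 1)
noncomputable def lm (p : GP) (i : ℕ) : ℝ := 1 / (8 * p.Bi i)
noncomputable def rr (p : GP) : ℝ := 1 - 1 / p.q
noncomputable def vv (p : GP) (i d : ℕ) : ℝ :=
  (p.rr ^ p.cp (i + 1))⁻¹ * (2 ^ p.cp i * (1 / 2) ^ d + p.rr ^ d)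
noncomputable def mm (p : GP) (i d : ℕ) : ℝ := 4 ^ p.stt i * (1 / 4) ^ (d + 1)
noncomputable def ps (p : GP) (i : ℕ) (w : List (Fin 4)) : ℝ :=
  Real.exp (p.κ / 4 * (wX w - p.κ * p.cp (i + 1)) + 2 * (p.κ / 4) ^ 2 * (p.cp (i + 1) - w.length))

theorem q_ge (hp : p.Ok) : (2 : ℝ) ≤ p.q := by exact_mod_cast hp.q2

theorem q_big (hp : p.Ok) : 88 * 1024 ≤ (p.q : ℝ) := by
  have h1 := hp.qk
  have h2 := κ_le hp
  have h3 := κ_pos hp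
  have h4 : p.κ ^ 2 ≤ 1 / 1024 := by nlinarith
  have h5 := q_ge hp
  nlinarith

theorem rr_bd (hp : p.Ok) : 1 / 2 ≤ p.rr ∧ p.rr < 1 := by
  have := q_ge hp
  unfold rr
  have h1 : 1 / (p.q : ℝ) ≤ 1 / 2 := one_div_le_one_div_of_le (by norm_num) this
  have h2 : 0 < 1 / (p.q : ℝ) := by positivity
  constructor <;> linarith

theorem Bi_ge (hp : p.Ok) (i : ℕ) : (p.q : ℝ) ≤ p.Bi i := by
  exact_mod_cast hp.bq.trans (b0_le_Bi hp i)

theorem lm_bd (hp : p.Ok) (i : ℕ) : 0 < p.lm i ∧ p.lm i ≤ 1 / (8 * p.q) ∧ p.lm i ≤ 1 / 16 := by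
  have h1 := q_ge hp
  have h2 := Bi_ge hp i
  unfold lm
  have h3 : 1 / (8 * (p.Bi i : ℝ)) ≤ 1 / (8 * p.q) := one_div_le_one_div_of_le (by positivity) (by linarith)
  refine ⟨by have : (0:ℝ) < p.Bi i := by linarith
             positivity, h3, h3.trans ?_⟩
  exact one_div_le_one_div_of_le (by norm_num) (by linarith)

theorem r_ineq (hp : p.Ok) : 4 * (p.rr - 1) + (1 / p.rr - 1) ≤ - (2 / p.q) := by
  have h1 := q_ge hp
  have h2 := (rr_bd hp).1
  have h3 : 1 / p.rr = 1 + (1 / p.q) / p.rr := by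
    have : p.rr ≠ 0 := by linarith
    field_simp
    unfold rr; field_simp; ring
  have h4 : (1 / (p.q : ℝ)) / p.rr ≤ (1 / p.q) / (1 / 2) := by gcongr
  rw [h3]
  have h5 : p.rr - 1 = - (1 / p.q) := by unfold rr; ring
  rw [h5]
  have h6 : (2 : ℝ) / p.q = 2 * (1 / p.q) := by ring
  rw [h6]
  linarith

theorem lay_eq (hp : p.Ok) {d i : ℕ} (hd : d < p.L) (h1 : p.stt i ≤ d) (h2 : d < p.cp i) :
    p.lay d = i ∧ i < p.l := by
  have hl := lay_lt hp hd
  have h3 : ¬ i < p.lay d := fun h => by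
    have := cp_le_of_lay hp hd h; omega
  have h4 : ¬ p.lay d < i := by
    intro h
    have h5 := lt_cp_lay hp hd
    have h6 : p.cp (p.lay d) ≤ p.cp (i - 1) := (cp_strict hp).monotone (by omega)
    have : i ≠ 0 := by omega
    simp only [stt, this, if_false] at h1
    omega
  omega

theorem x_bd (hp : p.Ok) {d i : ℕ} (hi : i < p.l) (hd : d < p.L) (h1 : p.stt i ≤ d) (h2 : d < p.cp (i + 1)) :
    p.B d * (1 / (1 - p.lm i) - 1) + p.lm i ≤ (if d < p.cp i then 1 / 2 else 1 / p.q : ℝ) := by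
  obtain ⟨l0, l1, l2⟩ := lm_bd hp i
  have hq := q_ge hp
  have hB := Bi_ge hp i
  have hB0 : (0 : ℝ) < p.Bi i := by linarith
  have e : 1 / (1 - p.lm i) - 1 ≤ 16 / 15 * p.lm i := by
    have : 0 < 1 - p.lm i := by linarith
    rw [div_sub_one this.ne', div_le_iff₀ this]
    nlinarith
  have hBl : p.Bi i * p.lm i = 1 / 8 := by unfold lm; field_simp
  have h0 : (0 : ℝ) ≤ p.B d := by positivity
  have h3 := mul_le_mul_of_nonneg_left e h0
  split_ifs with h
  · have := (lay_eq hp hd h1 h).1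
    have hBd : p.B d = p.Bi i := by unfold B; rw [this]
    rw [hBd] at h3 ⊢
    nlinarith
  · have hL := lay_eq hp hd (i := i + 1) (by simp [stt]; omega) h2
    have hBd : p.B d = p.Bi (i + 1) := by unfold B; rw [hL.1]
    have hBB : p.Bi i = p.q * p.Bi (i + 1) := by
      unfold Bi
      have : p.l - 1 - i = (p.l - 1 - (i + 1)) + 1 := by omega
      rw [this, pow_succ]; ring
    have hBB' : (p.Bi i : ℝ) = p.q * p.Bi (i + 1) := by exact_mod_cast hBB
    rw [hBd] at h3 ⊢
    have h4 : (p.Bi (i + 1) : ℝ) * p.lm i = 1 / 8 * (1 / p.q) := by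
      rw [hBB'] at hBl
      field_simp
      linarith
    have h5 : p.lm i ≤ 1 / 8 * (1 / p.q) := by
      refine l1.trans (le_of_eq ?_); field_simp
    have h6 : 0 < 1 / (p.q : ℝ) := by positivity
    nlinarith

theorem vv_pos (hp : p.Ok) (i d : ℕ) : 0 < p.vv i d := by
  have := (rr_bd hp).1
  have : 0 < p.rr := by linarith
  unfold vv; positivity

/-- key decay inequality -/
theorem vv_ineq (hp : p.Ok) {d i : ℕ} (hi : i < p.l) (hd : d < p.L) (h1 : p.stt i ≤ d) (h2 : d < p.cp (i + 1))
    (up : ℝ) (hup : up ≤ 0 ∨ ∃ e, d = e + 1 ∧ up = p.vv i e - p.vv i d) :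
    4 * (p.vv i (d + 1) - p.vv i d) + up + p.B d * (p.vv i d / (1 - p.lm i) - p.vv i d)
      ≤ - p.lm i * p.vv i d := by
  have hx := x_bd hp hi hd h1 h2
  set x := p.B d * (1 / (1 - p.lm i) - 1) + p.lm i with hxd
  obtain ⟨hr1, hr2⟩ := rr_bd hp
  have hr := r_ineq hp
  have hq := q_ge hp
  have hr0 : 0 < p.rr := by linarith
  set P : ℝ := 2 ^ p.cp i * (1 / 2) ^ d with hP
  set Q : ℝ := p.rr ^ d with hQ
  set G : ℝ := (p.rr ^ p.cp (i + 1))⁻¹ with hG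
  have hP0 : 0 < P := by positivity
  have hQ0 : 0 < Q := by positivity
  have hG0 : 0 < G := by positivity
  have e1 : p.vv i d = G * (P + Q) := rfl
  have e2 : p.vv i (d + 1) = G * (P / 2 + Q * p.rr) := by
    simp only [vv, hP, hQ, hG, pow_succ]; ring
  have hup' : up ≤ G * (P + Q * (1 / p.rr - 1)) := by
    rcases hup with h | ⟨e, rfl, rfl⟩
    · refine h.trans ?_
      have : 1 ≤ 1 / p.rr := by rw [le_div_iff₀ hr0]; linarith
      have : 0 ≤ 1 / p.rr - 1 := by linarith
      positivity
    · apply le_of_eq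
      simp only [vv, hP, hQ, hG, pow_succ]
      field_simp
      ring
  have hmain : -P + Q * (4 * (p.rr - 1) + (1 / p.rr - 1)) + x * (P + Q) ≤ 0 := by
    have h3 := mul_le_mul_of_nonneg_left hr hQ0.le
    have h4 : x * (P + Q) ≤ P + Q * (2 / p.q) := by
      split_ifs at hx with h
      · have hPQ : Q ≤ P := by
          have a1 : Q ≤ 1 := pow_le_one₀ hr0.le hr2.le
          have a2 : 1 ≤ P := by
            have : p.cp i = d + (p.cp i - d) := by omega
            rw [hP, this, pow_add]
            have a3 : (2 : ℝ) ^ d * (1 / 2) ^ d = 1 := by rw [← mul_pow]; norm_num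
            have a4 : (1 : ℝ) ≤ 2 ^ (p.cp i - d) := one_le_pow₀ (by norm_num)
            nlinarith
          linarith
        have : 0 < Q * (2 / p.q) := by positivity
        nlinarith
      · have a1 : x * (P + Q) ≤ 1 / p.q * (P + Q) := by gcongr
        have a2 : 1 / (p.q : ℝ) ≤ 1 := by rw [div_le_one (by linarith)]; linarith
        have a3 : 0 < Q * (1 / p.q) := by positivity
        have a4 : Q * (2 / p.q) = 2 * (Q * (1 / p.q)) := by ring
        rw [a4]
        nlinarith
    nlinarith
  have e3 : p.B d * (p.vv i d / (1 - p.lm i) - p.vv i d) + p.lm i * p.vv i d = x * (G * (P + Q)) := by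
    rw [hxd, e1]; ring
  have h5 := mul_nonpos_of_nonneg_of_nonpos hG0.le hmain
  rw [e2, e1] at *
  nlinarith

theorem ps_pos (i : ℕ) (w : List (Fin 4)) : 0 < p.ps i w := Real.exp_pos _

theorem ps_cons (i : ℕ) (a : Fin 4) (w : List (Fin 4)) : p.ps i (a :: w)
    = p.ps i w * Real.exp (p.κ / 4 * (3 / 4 * (lx a + wY w)) - 2 * (p.κ / 4) ^ 2) := by
  unfold ps
  simp only [← Real.exp_add]
  congr 1
  rw [wX_cons]; simp only [List.length_cons]; push_cast; ring

theorem ps_up (i : ℕ) (a : Fin 4) (w : List (Fin 4)) : p.ps i w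
    = p.ps i (a :: w) * Real.exp (p.κ / 4 * (-3 * wY (a :: w)) + 2 * (p.κ / 4) ^ 2) := by
  unfold ps
  simp only [← Real.exp_add]
  congr 1
  rw [wX_up a w]; simp only [List.length_cons]; push_cast; ring

theorem ps_ineq (hp : p.Ok) (i : ℕ) (w : List (Fin 4)) (up : ℝ)
    (hup : (w = [] ∧ up = 0) ∨ ∃ a u, w = a :: u ∧ up = p.ps i u - p.ps i w) :
    ∑ a, (p.ps i (a :: w) - p.ps i w) + up ≤ 0 := by
  have hκ := κ_pos hp
  have hκ' := κ_le hp
  simp only [ps_cons]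
  rw [Finset.sum_sub_distrib, ← Finset.mul_sum,
    sum_lx (fun z => Real.exp (p.κ / 4 * (3 / 4 * (z + wY w)) - 2 * (p.κ / 4) ^ 2))]
  simp only [sum_const, card_univ, Fintype.card_fin, nsmul_eq_mul]
  have h0 := ps_pos (p := p) i w
  rcases hup with ⟨rfl, rfl⟩ | ⟨a, u, rfl, rfl⟩
  · have := psi_ineq_root (α := p.κ / 4) (by positivity) (by linarith)
    simp only [wY]
    have := mul_le_mul_of_nonneg_left this h0.le
    push_cast
    linarith
  · have := psi_ineq (α := p.κ / 4) (by positivity) (by linarith) (wY_abs (a :: u))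
    have := mul_le_mul_of_nonneg_left this h0.le
    rw [ps_up i a u]
    push_cast
    linarith

theorem mm_pos (i d : ℕ) : 0 < p.mm i d := by unfold mm; positivity

theorem mm_ineq (i d : ℕ) (up : ℝ) (hup : up ≤ 0 ∨ ∃ e, d = e + 1 ∧ up = p.mm i e - p.mm i d) :
    4 * (p.mm i (d + 1) - p.mm i d) + up ≤ 0 := by
  have h0 := mm_pos (p := p) i d
  have e1 : p.mm i (d + 1) = p.mm i d / 4 := by unfold mm; rw [pow_succ _ (d + 1)]; ring
  rcases hup with h | ⟨e, rfl, rfl⟩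
  · linarith
  · have e2 : p.mm i (e + 1) = p.mm i e / 4 := by unfold mm; rw [pow_succ _ (e + 1)]; ring
    linarith

end GP
end upper


section upper2
open Classical
namespace GP
variable {p : GP}

noncomputable def UU (p : GP) (i : ℕ) (N b : ℝ) (t : ℕ) : p.VT → ℝ
  | Sum.inl (w, j) => (1 - p.lm i / N) ^ t * (p.vv i w.1.length * (if j.1 = 0 then 1 else 1 / (1 - p.lm i)))
      + b * p.mm i w.1.length + p.ps i w.1
  | Sum.inr _ => 0

def Dm (p : GP) (i : ℕ) : p.VT → Prop
  | Sum.inl (w, j) => p.inA (nd w j) ∧ p.stt i ≤ w.1.length ∧ w.1.length < p.cp (i + 1)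
  | Sum.inr _ => False

theorem UU_root (i : ℕ) (N b : ℝ) (t : ℕ) (w : p.Wd) : p.UU i N b t (nd w 0)
    = (1 - p.lm i / N) ^ t * p.vv i w.1.length + b * p.mm i w.1.length + p.ps i w.1 := by
  simp [UU, nd]

theorem UU_pend (i : ℕ) (N b : ℝ) (t : ℕ) (w : p.Wd) (j : Fin (p.Bmax + 1)) (hj : 1 ≤ j.1) :
    p.UU i N b t (nd w j)
    = (1 - p.lm i / N) ^ t * (p.vv i w.1.length / (1 - p.lm i)) + b * p.mm i w.1.length + p.ps i w.1 := by
  have : j.1 ≠ 0 := by omega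
  change (1 - p.lm i / N) ^ t * (p.vv i w.1.length * (if j.1 = 0 then 1 else 1 / (1 - p.lm i)))
      + b * p.mm i w.1.length + p.ps i w.1 = _
  rw [if_neg this]; ring

theorem lmN (hp : p.Ok) (i : ℕ) {N : ℝ} (hN : 2 ≤ N) : 0 < 1 - p.lm i / N := by
  obtain ⟨l0, l1, l2⟩ := lm_bd hp i
  have : p.lm i / N < 1 := by rw [div_lt_one (by linarith)]; linarith
  linarith

theorem UU_nonneg (hp : p.Ok) (i : ℕ) {N b : ℝ} (hN : 2 ≤ N) (hb : 0 ≤ b) (t : ℕ) (x : p.VT) :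
    0 ≤ p.UU i N b t x := by
  match x with
  | Sum.inl (w, j) =>
    have h1 := lmN hp i hN
    have h2 := vv_pos hp i w.1.length
    have h3 := mm_pos (p := p) i w.1.length
    have h4 := ps_pos (p := p) i w.1
    obtain ⟨l0, l1, l2⟩ := lm_bd hp i
    have h5 : 0 < 1 - p.lm i := by linarith
    change 0 ≤ (1 - p.lm i / N) ^ t * (p.vv i w.1.length * (if j.1 = 0 then 1 else 1 / (1 - p.lm i)))
      + b * p.mm i w.1.length + p.ps i w.1
    split_ifs <;> positivity
  | Sum.inr _ => exact le_rfl

theorem UU_step (hp : p.Ok) {i : ℕ} (hi : i < p.l) {N b : ℝ} (hN : 2 ≤ N) (hb : 0 ≤ b) (t : ℕ) (x : p.VT)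
    (hx : p.Dm i x) :
    p.UU i N b t x + 1 / N * (∑ x' ∈ univ.filter (p.Gr.Adj x),
      ((if p.inA x' then p.UU i N b t x' else 0) - p.UU i N b t x)) ≤ p.UU i N b (t + 1) x := by
  have hN0 : 0 < N := by linarith
  have hc := lmN hp i hN
  set c := (1 - p.lm i / N) ^ t with hcd
  have hc0 : 0 < c := by positivity
  obtain ⟨l0, l1, l2⟩ := lm_bd hp i
  have hl1 : 0 < 1 - p.lm i := by linarith
  match x, hx with
  | Sum.inl (w, j), hx =>
    obtain ⟨⟨hw, hj⟩, hd1, hd2⟩ := hx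
    have hL := alive_len hp hw
    change p.UU i N b t (nd w j) + 1 / N * (∑ x' ∈ univ.filter (p.Gr.Adj (nd w j)),
      ((if p.inA x' then p.UU i N b t x' else 0) - p.UU i N b t (nd w j))) ≤ p.UU i N b (t + 1) (nd w j)
    by_cases h0 : j.1 = 0
    · have : j = 0 := Fin.ext h0
      subst this
      have h1 : ∑ x' ∈ univ.filter (p.Gr.Adj (nd w 0)),
          ((if p.inA x' then p.UU i N b t x' else 0) - p.UU i N b t (nd w 0))
          ≤ ∑ x' ∈ univ.filter (p.Gr.Adj (nd w 0)), (p.UU i N b t x' - p.UU i N b t (nd w 0)) := by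
        refine Finset.sum_le_sum fun x' _ => ?_
        have := UU_nonneg hp i hN hb t x'
        split_ifs <;> linarith
      have h2 : ∑ x' ∈ univ.filter (p.Gr.Adj (nd w 0)), (p.UU i N b t x' - p.UU i N b t (nd w 0))
          ≤ - p.lm i * (c * p.vv i w.1.length) := by
        rw [sum_nbr_root w hw hL]
        set d := w.1.length with hd
        have hch : ∑ a, (p.UU i N b t (nd (ch w hL a) 0) - p.UU i N b t (nd w 0))
            = c * (4 * (p.vv i (d + 1) - p.vv i d)) + b * (4 * (p.mm i (d + 1) - p.mm i d))
              + ∑ a, (p.ps i (a :: w.1) - p.ps i w.1) := by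
          simp only [UU_root, ch, List.length_cons, ← hd, ← hcd]
          have : ∀ a : Fin 4, c * p.vv i (d + 1) + b * p.mm i (d + 1) + p.ps i (a :: w.1)
              - (c * p.vv i d + b * p.mm i d + p.ps i w.1)
              = (c * (p.vv i (d + 1) - p.vv i d) + b * (p.mm i (d + 1) - p.mm i d))
                + (p.ps i (a :: w.1) - p.ps i w.1) := by intro a; ring
          simp only [this]
          rw [Finset.sum_add_distrib]
          simp only [sum_const, card_univ, Fintype.card_fin, nsmul_eq_mul]
          push_cast; ring
        have hpe : ∑ j ∈ pend w, (p.UU i N b t (nd w j) - p.UU i N b t (nd w 0))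
            = c * (p.B d * (p.vv i d / (1 - p.lm i) - p.vv i d)) := by
          have : ∀ j ∈ pend w, p.UU i N b t (nd w j) - p.UU i N b t (nd w 0)
              = c * (p.vv i d / (1 - p.lm i) - p.vv i d) := by
            intro j hj
            simp only [pend, mem_filter] at hj
            rw [UU_pend i N b t w j hj.2.1, UU_root, ← hd, ← hcd]; ring
          rw [Finset.sum_congr rfl this, sum_const, card_pend hp w, nsmul_eq_mul, ← hd]; ring
        rw [hch, hpe]
        have hups : ∃ uv um up : ℝ, upS w (fun y => p.UU i N b t y - p.UU i N b t (nd w 0))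
              = c * uv + b * um + up
            ∧ (uv ≤ 0 ∨ ∃ e, d = e + 1 ∧ uv = p.vv i e - p.vv i d)
            ∧ (um ≤ 0 ∨ ∃ e, d = e + 1 ∧ um = p.mm i e - p.mm i d)
            ∧ ((w.1 = [] ∧ up = 0) ∨ ∃ a u, w.1 = a :: u ∧ up = p.ps i u - p.ps i w.1) := by
          rcases hww : w.1 with _ | ⟨a, u⟩
          · refine ⟨0, 0, 0, ?_, Or.inl le_rfl, Or.inl le_rfl, Or.inl ⟨rfl, rfl⟩⟩
            rw [upS_nil w hww]; ring
          · have hu : u.length + 1 = d := by rw [hd, hww]; simp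
            let u' : p.Wd := ⟨u, by omega⟩
            refine ⟨p.vv i u.length - p.vv i d, p.mm i u.length - p.mm i d, p.ps i u - p.ps i w.1, ?_,
              Or.inr ⟨_, hu.symm, rfl⟩, Or.inr ⟨_, hu.symm, rfl⟩, Or.inr ⟨a, u, rfl, by rw [hww]⟩⟩
            rw [upS_cons w u' a hww]
            simp only [UU_root, ← hd, ← hcd, u']
            ring
        obtain ⟨uv, um, up, e, a1, a2, a3⟩ := hups
        rw [e]
        have b1 := mul_le_mul_of_nonneg_left (vv_ineq hp hi hL hd1 hd2 uv a1) hc0.le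
        have b2 := mul_nonpos_of_nonneg_of_nonpos hb (mm_ineq (p := p) i d um a2)
        have b3 := ps_ineq hp i w.1 up a3
        linarith
      have h3 := mul_le_mul_of_nonneg_left (h1.trans h2) (show 0 ≤ 1 / N by positivity)
      rw [UU_root, UU_root] at *
      have e : (1 - p.lm i / N) ^ (t + 1) * p.vv i w.1.length
          = c * p.vv i w.1.length + 1 / N * (-p.lm i * (c * p.vv i w.1.length)) := by
        rw [pow_succ, ← hcd]; ring
      rw [e]
      linarith
    · rw [sum_nbr_pend w hw j (by omega) hj, if_pos ⟨hw, by simp⟩, UU_root,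
        UU_pend i N b t w j (by omega), UU_pend i N b (t + 1) w j (by omega)]
      apply le_of_eq
      rw [pow_succ, ← hcd]
      field_simp
      ring

theorem pow_exp {x : ℝ} (h : x ≤ 1) (n : ℕ) : (1 - x) ^ n ≤ Real.exp (-(n * x)) := by
  have h1 : 1 - x ≤ Real.exp (-x) := by have := Real.add_one_le_exp (-x); linarith
  calc (1 - x) ^ n ≤ (Real.exp (-x)) ^ n := pow_le_pow_left₀ (by linarith) h1 n
    _ = _ := by rw [← Real.exp_nat_mul]; congr 1; ring

theorem Gamma_le (hp : p.Ok) (i : ℕ) : (p.rr ^ p.cp (i + 1))⁻¹ ≤ 4 ^ p.cp i := by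
  have hr := (rr_bd hp).1
  have hq := hp.q2
  have key : (1 / 4 : ℝ) ≤ p.rr ^ p.q := by
    obtain ⟨k, hk | hk⟩ := Nat.even_or_odd' p.q
    · have h1 : (1 / 2 : ℝ) ≤ p.rr ^ k := by
        have h := one_add_mul_le_pow (a := p.rr - 1) (by linarith) k
        have e : (k : ℝ) * (p.rr - 1) = - (1 / 2) := by
          unfold rr; rw [hk]; push_cast
          have : (k : ℝ) ≠ 0 := by
            have : k ≠ 0 := by omega
            exact_mod_cast this
          field_simp
          ring
        rw [e] at h
        have e2 : 1 + (p.rr - 1) = p.rr := by ring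
        rw [e2] at h; linarith
      rw [hk, mul_comm, pow_mul]
      nlinarith
    · have hk0 : (1 : ℝ) ≤ k := by
        have : 1 ≤ k := by omega
        exact_mod_cast this
      have e0 : p.rr = 1 - 1 / (2 * k + 1) := by unfold rr; rw [hk]; push_cast; rfl
      have h1 : (1 - k / (2 * k + 1) : ℝ) ≤ p.rr ^ k := by
        have h := one_add_mul_le_pow (a := p.rr - 1) (by linarith) k
        have e : (k : ℝ) * (p.rr - 1) = - (k / (2 * k + 1)) := by
          rw [e0]; field_simp; ring
        rw [e] at h
        have e2 : 1 + (p.rr - 1) = p.rr := by ring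
        rw [e2] at h; linarith
      have e3 : (1 - k / (2 * k + 1) : ℝ) = (k + 1) / (2 * k + 1) := by field_simp; ring
      rw [e3] at h1
      have e4 : p.rr = 2 * k / (2 * k + 1) := by rw [e0]; field_simp; ring
      rw [hk, pow_succ, mul_comm 2 k, pow_mul]
      have h2 : ((k + 1) / (2 * k + 1)) ^ 2 ≤ (p.rr ^ k) ^ 2 := pow_le_pow_left₀ (by positivity) h1 2
      have h3 : (1 / 4 : ℝ) ≤ ((k + 1) / (2 * k + 1)) ^ 2 * (2 * k / (2 * k + 1)) := by
        have : ((k + 1) / (2 * k + 1)) ^ 2 * (2 * k / (2 * k + 1) : ℝ)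
          = (k + 1) ^ 2 * (2 * k) / (2 * k + 1) ^ 3 := by field_simp
        rw [this, div_le_div_iff₀ (by norm_num) (by positivity)]
        nlinarith
      refine h3.trans ?_
      rw [← e4]
      gcongr
  rw [cp_succ, pow_mul, ← inv_pow]
  refine pow_le_pow_left₀ (by positivity) ?_ _
  rw [inv_le_comm₀ (by positivity) (by norm_num)]
  linarith

theorem cp_ge8 (hp : p.Ok) (i : ℕ) : 8 ≤ p.cp i := by
  have h1 : p.cp 0 ≤ p.cp i := (cp_strict hp).monotone (Nat.zero_le _)
  have e : p.cp 0 = p.H := by simp [cp]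
  have := hp.H4
  omega

theorem vv_le (hp : p.Ok) (i d : ℕ) : p.vv i d / (1 - p.lm i) ≤ Real.exp (3 * p.cp i) := by
  obtain ⟨l0, l1, l2⟩ := lm_bd hp i
  have h8 := cp_ge8 hp i
  have hr := rr_bd hp
  have hr0 : 0 < p.rr := by linarith
  have h1 : p.vv i d ≤ 4 ^ p.cp i * (2 ^ p.cp i + 1) := by
    unfold vv
    have := Gamma_le hp i
    have a1 : ((1 : ℝ) / 2) ^ d ≤ 1 := pow_le_one₀ (by norm_num) (by norm_num)
    have a2 : p.rr ^ d ≤ 1 := pow_le_one₀ hr0.le hr.2.le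
    have a3 : (2 : ℝ) ^ p.cp i * (1 / 2) ^ d ≤ 2 ^ p.cp i := mul_le_of_le_one_right (by positivity) a1
    gcongr
  have h2 : (4 : ℝ) ^ p.cp i * (2 ^ p.cp i + 1) ≤ 2 * 8 ^ p.cp i := by
    have : (8 : ℝ) ^ p.cp i = 4 ^ p.cp i * 2 ^ p.cp i := by rw [← mul_pow]; norm_num
    have h3 : (1 : ℝ) ≤ 2 ^ p.cp i := one_le_pow₀ (by norm_num)
    have h4 : (0 : ℝ) < 4 ^ p.cp i := by positivity
    rw [this]; nlinarith
  have h5 : (16 : ℝ) ≤ Real.exp 3 := by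
    have := Real.add_one_le_exp (1 : ℝ)
    have h27 := Real.exp_one_gt_d9
    have : Real.exp 3 = Real.exp 1 ^ 3 := by rw [← Real.exp_nat_mul]; norm_num
    rw [this]
    have : (2.6 : ℝ) ^ 3 ≤ Real.exp 1 ^ 3 := pow_le_pow_left₀ (by norm_num) (by linarith) 3
    norm_num at this ⊢
    linarith
  have h6 : (4 : ℝ) * 8 ^ p.cp i ≤ Real.exp (3 * p.cp i) := by
    have e : Real.exp (3 * p.cp i) = Real.exp 3 ^ p.cp i := by rw [← Real.exp_nat_mul]; congr 1; ring
    rw [e]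
    have : (16 : ℝ) ^ p.cp i ≤ Real.exp 3 ^ p.cp i := pow_le_pow_left₀ (by norm_num) h5 _
    refine le_trans ?_ this
    have e2 : (16 : ℝ) ^ p.cp i = 2 ^ p.cp i * 8 ^ p.cp i := by rw [← mul_pow]; norm_num
    rw [e2]
    gcongr
    calc (4 : ℝ) = 2 ^ 2 := by norm_num
      _ ≤ 2 ^ p.cp i := pow_le_pow_right₀ (by norm_num) (by omega)
  rw [div_le_iff₀ (by linarith)]
  have := Real.exp_pos (3 * p.cp i)
  nlinarith

theorem ps_le (hp : p.Ok) (i : ℕ) (w : List (Fin 4)) (h : w.length ≤ p.cp i) :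
    p.ps i w ≤ Real.exp (-(10 * p.cp i)) := by
  unfold ps
  apply Real.exp_le_exp.2
  have h1 := (abs_le.1 (wX_abs w)).2
  have h2 : (w.length : ℝ) ≤ p.cp i := by exact_mod_cast h
  have hκ := κ_pos hp
  have hκ' := κ_le hp
  have hq := hp.qk
  have h8 : (8 : ℝ) ≤ p.cp i := by exact_mod_cast cp_ge8 hp i
  rw [cp_succ]
  push_cast
  have h3 : p.κ / 4 * wX w ≤ p.κ / 4 * p.cp i := by gcongr; linarith
  have h4 : 0 ≤ 2 * (p.κ / 4) ^ 2 * w.length := by positivity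
  have h5 : 88 * (p.cp i : ℝ) ≤ p.q * p.κ ^ 2 * p.cp i := by gcongr
  have h6 : p.κ / 4 * p.cp i ≤ 1 / 128 * p.cp i :=
    mul_le_mul_of_nonneg_right (by linarith) (by linarith)
  nlinarith

theorem ps_ge (hp : p.Ok) (i : ℕ) (w : List (Fin 4)) (h : w.length = p.cp (i + 1))
    (hw : p.κ * w.length ≤ wX w) : 1 ≤ p.ps i w := by
  unfold ps
  apply Real.one_le_exp
  have hκ := κ_pos hp
  rw [h] at hw ⊢
  have : 0 ≤ p.κ / 4 * (wX w - p.κ * p.cp (i + 1)) := mul_nonneg (by positivity) (by linarith)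
  linarith

theorem alive_cp (hp : p.Ok) (i : ℕ) (w : List (Fin 4)) (hw : p.alive w) (h : w.length = p.cp i) :
    p.κ * w.length ≤ wX w := by
  match w, hw with
  | [], _ => have := cp_pos hp i; simp at h; omega
  | a :: u, hw => exact hw.2.2 i h

theorem UU_one (hp : p.Ok) {i : ℕ} {N b : ℝ} (hb : 0 ≤ b) (x : p.VT)
    (hx : p.Dm i x) : 1 ≤ p.UU i N b 0 x := by
  match x, hx with
  | Sum.inl (w, j), hx =>
    obtain ⟨⟨hw, hj⟩, hd1, hd2⟩ := hx
    obtain ⟨l0, l1, l2⟩ := lm_bd hp i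
    obtain ⟨hr1, hr2⟩ := rr_bd hp
    have hr0 : 0 < p.rr := by linarith
    have h3 := mm_pos (p := p) i w.1.length
    have h4 := ps_pos (p := p) i w.1
    have h5 : 0 < 1 - p.lm i := by linarith
    have hv : 1 ≤ p.vv i w.1.length := by
      unfold vv
      have a1 : p.rr ^ p.cp (i + 1) ≤ p.rr ^ w.1.length := pow_le_pow_of_le_one hr0.le hr2.le hd2.le
      have a2 : (0 : ℝ) < 2 ^ p.cp i * (1 / 2) ^ w.1.length := by positivity
      rw [← div_eq_inv_mul, le_div_iff₀ (by positivity)]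
      linarith
    have hb' : 0 ≤ b * p.mm i w.1.length := by positivity
    change 1 ≤ (1 - p.lm i / N) ^ 0 * (p.vv i w.1.length * (if j.1 = 0 then 1 else 1 / (1 - p.lm i)))
      + b * p.mm i w.1.length + p.ps i w.1
    split_ifs
    · linarith
    · have : 1 ≤ 1 / (1 - p.lm i) := by rw [le_div_iff₀ h5]; linarith
      nlinarith

theorem mm_top (i : ℕ) (h : 0 < p.stt i) : p.mm i (p.stt i - 1) = 1 := by
  unfold mm
  rw [Nat.sub_add_cancel h, ← mul_pow]; norm_num

theorem layer_bd (hp : p.Ok) {i : ℕ} (hi : i < p.l) (N : ℝ) (D : ℕ → p.VT → p.VT → ℝ)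
    (hD : DSys p.Gr N D) (s : ℕ) (err : ℝ) (herr : 0 ≤ err)
    (hKK : ∀ x y, ¬ p.inA x → ¬ p.inA y → D s x y ≤ err) (b : ℝ) (hb0 : 0 ≤ b)
    (hb : ∀ t (w : p.Wd) k, p.alive w.1 → i ≠ 0 → w.1.length = p.cp (i - 1) - 1 → ¬ p.inA k →
      D (s + t) (nd w 0) k ≤ b) (ρ : ℝ)
    (hρ : ρ = #(univ.filter p.inA) / #(univ.filter (fun x => ¬ p.inA x))) (t : ℕ)
    (ht : (t : ℝ) = 80 * p.T * N) (w : p.Wd) (j : Fin (p.Bmax + 1)) (k : p.VT)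
    (hA : p.inA (nd w j)) (h1 : p.stt i ≤ w.1.length) (h2 : w.1.length < p.cp i) (hk : ¬ p.inA k) :
    D (s + t) (nd w j) k ≤ err + (1 + 320 * p.T) * ρ + 2 * Real.exp (-(7 * p.cp i))
      + b * p.mm i w.1.length := by
  have hN := hD.Npos
  have hN0 : 0 < N := by linarith
  have h2' : w.1.length < p.cp (i + 1) := h2.trans (cp_strict hp (Nat.lt_succ_self i))
  have key := KA_lemma p.Gr N D hD p.inA Gr_clique (p.Dm i) ?_ s err herr hKK (p.UU i N b)
    (UU_nonneg hp i hN hb0) (fun x hx => UU_one hp hb0 x hx) ?_ (UU_step hp hi hN hb0) t (nd w j) k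
    ⟨hA, h1, h2'⟩ hk
  · refine key.trans ?_
    have e1 := etaK_le p.Gr p.inA k
    rw [← hρ] at e1
    have e2 := sum_etaK_le p.Gr p.inA (fun _ => 1) (fun _ => zero_le_one) (nbrK_le hp)
    simp only [sum_const, nsmul_eq_mul, mul_one] at e2
    rw [mul_div_assoc, ← hρ] at e2
    have e3 : (t : ℝ) * ((∑ k ∈ univ.filter (fun x => ¬ p.inA x), etaK p.Gr p.inA (fun _ => 1) k) / N)
        ≤ 320 * p.T * ρ := by
      rw [ht]
      have : 80 * p.T * N * ((∑ k ∈ univ.filter (fun x => ¬ p.inA x), etaK p.Gr p.inA (fun _ => 1) k) / N)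
          = 80 * p.T * (∑ k ∈ univ.filter (fun x => ¬ p.inA x), etaK p.Gr p.inA (fun _ => 1) k) := by
        field_simp
      rw [this]
      have hT := T_pos hp
      nlinarith
    have e4 : p.UU i N b t (nd w j) ≤ 2 * Real.exp (-(7 * p.cp i)) + b * p.mm i w.1.length := by
      obtain ⟨l0, l1, l2⟩ := lm_bd hp i
      have h5 : 0 < 1 - p.lm i := by linarith
      have hv := vv_le hp i w.1.length
      have hps := ps_le hp i w.1 h2.le
      have hv0 := vv_pos hp i w.1.length
      have hdec : (1 - p.lm i / N) ^ t ≤ Real.exp (-(10 * p.cp i)) := by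
        have := pow_exp (x := p.lm i / N) (by have := lmN hp i hN; linarith) t
        refine this.trans (le_of_eq ?_)
        congr 2
        have hBT : (p.Bi i : ℝ) * p.cp i = p.T := by exact_mod_cast Bi_mul_cp (p := p) i hi
        have hB : (0 : ℝ) < p.Bi i := by have := Bi_ge hp i; have := q_ge hp; linarith
        rw [ht, ← hBT]
        unfold lm
        field_simp
        ring
      have hdec0 : 0 ≤ (1 - p.lm i / N) ^ t := by have := lmN hp i hN; positivity
      have hX : p.vv i w.1.length * (if j.1 = 0 then 1 else 1 / (1 - p.lm i))
          ≤ Real.exp (3 * p.cp i) := by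
        refine le_trans ?_ hv
        split_ifs
        · rw [le_div_iff₀ h5]; nlinarith
        · apply le_of_eq; ring
      have hY : (1 - p.lm i / N) ^ t * (p.vv i w.1.length * (if j.1 = 0 then 1 else 1 / (1 - p.lm i)))
          ≤ Real.exp (-(7 * p.cp i)) := by
        have e : Real.exp (-(7 * (p.cp i : ℝ))) = Real.exp (-(10 * p.cp i)) * Real.exp (3 * p.cp i) := by
          rw [← Real.exp_add]; congr 1; ring
        rw [e]
        have : 0 ≤ p.vv i w.1.length * (if j.1 = 0 then 1 else 1 / (1 - p.lm i)) := by
          split_ifs <;> positivity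
        exact mul_le_mul hdec hX this (Real.exp_pos _).le
      have hZ : Real.exp (-(10 * (p.cp i : ℝ))) ≤ Real.exp (-(7 * p.cp i)) := by
        apply Real.exp_le_exp.2
        have : (0 : ℝ) ≤ p.cp i := by positivity
        linarith
      change (1 - p.lm i / N) ^ t * (p.vv i w.1.length * (if j.1 = 0 then 1 else 1 / (1 - p.lm i)))
        + b * p.mm i w.1.length + p.ps i w.1 ≤ _
      linarith
    linarith
  · intro x hx
    match x, hx with
    | Sum.inl (w, j), hx => exact hx.1
  · intro t x x' k hx hadj hx' hnx hk
    match x, hx with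
    | Sum.inl (w, j), hx =>
      obtain ⟨⟨hw, hj⟩, hd1, hd2⟩ := hx
      change p.Gr.Adj (nd w j) x' at hadj
      by_cases h0 : j.1 = 0
      · have : j = 0 := Fin.ext h0
        subst this
        rw [adj_root w hw] at hadj
        rcases hadj with ⟨w', ⟨a, ha⟩, rfl⟩ | ⟨w', ⟨a, ha⟩, rfl⟩ | ⟨j', h1, h2, rfl⟩
        · have hlen : w'.1.length = w.1.length + 1 := by rw [ha]; simp
          have hcp : w'.1.length = p.cp (i + 1) := by
            by_contra hc
            exact hnx ⟨hx', by omega, by omega⟩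
          have := ps_ge hp i w'.1 hcp (alive_cp hp (i + 1) w'.1 hx'.1 hcp)
          refine (hD.le_one _ _ _).trans ?_
          rw [UU_root]
          have b1 := lmN hp i hN
          have b2 := vv_pos hp i w'.1.length
          have b3 := mm_pos (p := p) i w'.1.length
          have : 0 ≤ (1 - p.lm i / N) ^ t * p.vv i w'.1.length := by positivity
          have : 0 ≤ b * p.mm i w'.1.length := by positivity
          linarith
        · have hlen : w.1.length = w'.1.length + 1 := by rw [ha]; simp
          have hst : w.1.length = p.stt i := by
            by_contra hc
            exact hnx ⟨hx', by omega, by omega⟩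
          have hi0 : i ≠ 0 := by
            intro h
            have : p.stt i = 0 := by simp [stt, h]
            omega
          have hst' : p.stt i = p.cp (i - 1) := by simp [stt, hi0]
          refine (hb t w' k hx'.1 hi0 (by omega) hk).trans ?_
          rw [UU_root]
          have b1 := lmN hp i hN
          have b2 := vv_pos hp i w'.1.length
          have b3 := ps_pos (p := p) i w'.1
          have b4 : p.mm i w'.1.length = 1 := by
            have : w'.1.length = p.stt i - 1 := by omega
            rw [this]; exact mm_top i (by omega)
          have : 0 ≤ (1 - p.lm i / N) ^ t * p.vv i w'.1.length := by positivity
          rw [b4]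
          linarith
        · exact absurd ⟨hx', hd1, hd2⟩ hnx
      · rw [adj_pend w hw j (by omega) hj] at hadj
        subst hadj
        exact absurd ⟨hx', hd1, hd2⟩ hnx

end GP
end upper2


section upper3
open Classical
namespace GP
variable {p : GP}

noncomputable def na (p : GP) (d : ℕ) : ℝ := ∑ w ∈ wl d, if p.alive w then 1 else 0

theorem na_nonneg (d : ℕ) : 0 ≤ p.na d := Finset.sum_nonneg fun _ _ => by split_ifs <;> norm_num

theorem na_le (d : ℕ) : p.na d ≤ 4 ^ d := by
  rw [← card_wl d]
  refine Finset.sum_le_sum fun w _ => ?_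
  split_ifs <;> norm_num

theorem na_succ (d : ℕ) : p.na (d + 1) ≤ 4 * p.na d := by
  unfold na
  rw [sum_wl_succ, Finset.mul_sum]
  refine Finset.sum_le_sum fun w _ => ?_
  have : ∀ a ∈ (univ : Finset (Fin 4)), (if p.alive (a :: w) then (1 : ℝ) else 0) ≤ if p.alive w then 1 else 0 := by
    intro a _
    by_cases h : p.alive (a :: w)
    · rw [if_pos h, if_pos h.1]
    · rw [if_neg h]; split_ifs <;> norm_num
  refine (Finset.sum_le_sum this).trans ?_
  simp

theorem na_cp (hp : p.Ok) (i e : ℕ) : p.na (p.cp i + e)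
    ≤ 4 ^ e * (4 ^ p.cp i * Real.exp (p.κ / 3 - p.κ ^ 2 / 2 * p.cp i)) := by
  induction e with
  | zero =>
    rw [pow_zero, one_mul, add_zero]
    refine le_trans ?_ (chernoff_card p.κ (κ_pos hp).le (p.cp i))
    unfold na
    rw [Finset.sum_filter]
    refine Finset.sum_le_sum fun w hw => ?_
    rw [mem_wl] at hw
    by_cases h : p.alive w
    · have := alive_cp hp i w h hw
      rw [hw] at this
      rw [if_pos h, if_pos this]
    · rw [if_neg h]; split_ifs <;> norm_num
  | succ e ih =>
    have := na_succ (p := p) (p.cp i + e)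
    rw [← add_assoc, pow_succ]
    linarith

noncomputable def bb (p : GP) (er : ℝ) (i : ℕ) : ℝ :=
  er + 2 * Real.exp (-(7 * p.cp i)) + if i = 0 then 0 else p.mm i (p.cp i - 1)

noncomputable def Dd (p : GP) (er : ℝ) (d : ℕ) : ℝ :=
  er + 2 * Real.exp (-(7 * p.cp (p.lay d)))
    + if p.lay d = 0 then 0 else p.bb er (p.lay d - 1) * p.mm (p.lay d) d

noncomputable def Db (p : GP) (er : ℝ) : p.VT → ℝ
  | Sum.inl (w, _) => p.Dd er w.1.length
  | Sum.inr _ => 0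

theorem bb_nonneg {er : ℝ} (h : 0 ≤ er) (i : ℕ) : 0 ≤ p.bb er i := by
  unfold bb
  have := mm_pos (p := p) i (p.cp i - 1)
  split_ifs <;> positivity

theorem Dd_nonneg {er : ℝ} (h : 0 ≤ er) (i : ℕ) : 0 ≤ p.Dd er i := by
  unfold Dd
  have := mm_pos (p := p) (p.lay i) i
  have := bb_nonneg (p := p) h (p.lay i - 1)
  split_ifs <;> positivity

theorem Db_nonneg {er : ℝ} (h : 0 ≤ er) (x : p.VT) : 0 ≤ p.Db er x := by
  match x with
  | Sum.inl (w, j) => exact Dd_nonneg h _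
  | Sum.inr _ => exact le_rfl

theorem four_le : (4 : ℝ) ≤ Real.exp 2 := by
  have h27 := Real.exp_one_gt_d9
  have : Real.exp 2 = Real.exp 1 ^ 2 := by rw [← Real.exp_nat_mul]; norm_num
  rw [this]
  nlinarith

theorem four_pow_le (n : ℕ) : (4 : ℝ) ^ n ≤ Real.exp (2 * n) := by
  have e : Real.exp (2 * n) = Real.exp 2 ^ n := by rw [← Real.exp_nat_mul]; congr 1; ring
  rw [e]; exact pow_le_pow_left₀ (by norm_num) four_le n

theorem bb_le (hp : p.Ok) (er : ℝ) (i : ℕ) :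
    p.bb er i ≤ er + 3 * ((1 / 4) ^ p.cp i * Real.exp (p.κ ^ 2 / 4 * p.cp i)) := by
  have hκ := κ_pos hp
  have h1 : Real.exp (-(7 * (p.cp i : ℝ))) ≤ (1 / 4) ^ p.cp i := by
    have := four_pow_le (p.cp i)
    rw [one_div, inv_pow, Real.exp_neg]
    apply inv_anti₀ (by positivity)
    refine this.trans (Real.exp_le_exp.2 ?_)
    have : (0 : ℝ) ≤ p.cp i := by positivity
    linarith
  have h2 : 1 ≤ Real.exp (p.κ ^ 2 / 4 * p.cp i) := Real.one_le_exp (by positivity)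
  have h4 : (0 : ℝ) < (1 / 4) ^ p.cp i := by positivity
  have h3 : (if i = 0 then 0 else p.mm i (p.cp i - 1)) ≤ (1 / 4) ^ p.cp i * Real.exp (p.κ ^ 2 / 4 * p.cp i) := by
    split_ifs with h
    · positivity
    · obtain ⟨j, rfl⟩ : ∃ j, i = j + 1 := ⟨i - 1, by omega⟩
      have e : p.mm (j + 1) (p.cp (j + 1) - 1) = 4 ^ p.cp j * (1 / 4) ^ p.cp (j + 1) := by
        unfold mm stt
        have := cp_pos hp (j + 1)
        simp only [Nat.succ_ne_zero, if_false, Nat.add_sub_cancel]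
        rw [Nat.sub_add_cancel this]
      rw [e, mul_comm]
      gcongr
      refine (four_pow_le _).trans (Real.exp_le_exp.2 ?_)
      rw [cp_succ]; push_cast
      have := hp.qk
      have h0 : (0 : ℝ) ≤ p.cp j := by positivity
      nlinarith
  unfold bb
  nlinarith

theorem na_Dd (hp : p.Ok) {er : ℝ} (her : 0 ≤ er) {d : ℕ} (hd : d < p.L) :
    p.na d * p.Dd er d ≤ 2 * 4 ^ p.L * er + 4 * Real.exp (-(p.κ ^ 2 / 4 * p.H)) := by
  have hκ := κ_pos hp
  have hκ' := κ_le hp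
  have hn0 := na_nonneg (p := p) d
  have hn1 := na_le (p := p) d
  have hL : (4 : ℝ) ^ d ≤ 4 ^ p.L := pow_le_pow_right₀ (by norm_num) hd.le
  have hHcp : ∀ i, (p.H : ℝ) ≤ p.cp i := by
    intro i
    have h1 : p.cp 0 ≤ p.cp i := (cp_strict hp).monotone (Nat.zero_le _)
    have e : p.cp 0 = p.H := by simp [cp]
    rw [e] at h1; exact_mod_cast h1
  have hH0 : (0 : ℝ) ≤ p.H := by positivity
  have t1 : p.na d * er ≤ 4 ^ p.L * er := by gcongr; linarith
  have hdl := lt_cp_lay hp hd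
  have t2 : p.na d * (2 * Real.exp (-(7 * p.cp (p.lay d)))) ≤ 2 * Real.exp (-(p.κ ^ 2 / 4 * p.H)) := by
    have a1 : p.na d ≤ Real.exp (2 * p.cp (p.lay d)) := by
      refine hn1.trans ((four_pow_le d).trans (Real.exp_le_exp.2 ?_))
      have : (d : ℝ) ≤ p.cp (p.lay d) := by exact_mod_cast hdl.le
      linarith
    calc p.na d * (2 * Real.exp (-(7 * p.cp (p.lay d))))
        ≤ Real.exp (2 * p.cp (p.lay d)) * (2 * Real.exp (-(7 * p.cp (p.lay d)))) := by gcongr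
      _ = 2 * Real.exp (2 * p.cp (p.lay d) + -(7 * p.cp (p.lay d))) := by rw [Real.exp_add]; ring
      _ ≤ _ := by
        gcongr
        have := hHcp (p.lay d)
        have hk2 : p.κ ^ 2 / 4 ≤ 1 := by nlinarith
        have := mul_le_mul_of_nonneg_right hk2 hH0
        linarith
  have t3 : p.na d * (if p.lay d = 0 then 0 else p.bb er (p.lay d - 1) * p.mm (p.lay d) d)
      ≤ 4 ^ p.L * er + 2 * Real.exp (-(p.κ ^ 2 / 4 * p.H)) := by
    split_ifs with hlay0
    · rw [mul_zero]; positivity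
    · obtain ⟨j, hj⟩ : ∃ j, p.lay d = j + 1 := ⟨p.lay d - 1, by omega⟩
      rw [hj, Nat.add_sub_cancel]
      have hdj : p.cp j ≤ d := cp_le_of_lay hp hd (by omega)
      obtain ⟨e, rfl⟩ := Nat.exists_eq_add_of_le hdj
      have b1 := na_cp hp j e
      have b2 := bb_le hp er j
      have b3 := bb_nonneg (p := p) her j
      set h := p.cp j with hh
      set X := Real.exp (p.κ / 3 - p.κ ^ 2 / 2 * h) with hX
      have hX0 : 0 < X := Real.exp_pos _
      have em : p.mm (j + 1) (h + e) = (1 / 4) ^ e * (1 / 4) := by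
        unfold mm stt
        simp only [Nat.succ_ne_zero, if_false, Nat.add_sub_cancel, ← hh]
        rw [pow_succ, pow_add, ← mul_assoc, ← mul_assoc, ← mul_pow]
        norm_num
      have b4 : p.na (h + e) * p.mm (j + 1) (h + e) ≤ 4 ^ h * X / 4 := by
        rw [em]
        calc p.na (h + e) * ((1 / 4) ^ e * (1 / 4)) ≤ 4 ^ e * (4 ^ h * X) * ((1 / 4) ^ e * (1 / 4)) := by
              gcongr
          _ = (4 ^ e * (1 / 4) ^ e) * (4 ^ h * X / 4) := by ring
          _ = _ := by rw [← mul_pow]; norm_num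
      have e3 : Real.exp (p.κ / 3) ≤ 2 := by
        have := exp_quad (y := p.κ / 3) (δ := 1 / 2) (by rw [abs_of_pos (by positivity)]; linarith) (by norm_num)
        linarith
      have hX1 : X ≤ 2 := by
        refine le_trans (Real.exp_le_exp.2 ?_) e3
        have : 0 ≤ p.κ ^ 2 / 2 * h := by positivity
        linarith
      have hX2 : X * Real.exp (p.κ ^ 2 / 4 * h) ≤ 2 * Real.exp (-(p.κ ^ 2 / 4 * p.H)) := by
        rw [hX, ← Real.exp_add]
        have : p.κ / 3 - p.κ ^ 2 / 2 * h + p.κ ^ 2 / 4 * h = p.κ / 3 + -(p.κ ^ 2 / 4 * h) := by ring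
        rw [this, Real.exp_add]
        have := hHcp j
        gcongr
      have hX3 : (4 : ℝ) ^ h * (1 / 4) ^ h = 1 := by rw [← mul_pow]; norm_num
      have h4L : (4 : ℝ) ^ h ≤ 4 ^ p.L := pow_le_pow_right₀ (by norm_num) (by omega)
      calc p.na (h + e) * (p.bb er j * p.mm (j + 1) (h + e))
          = (p.na (h + e) * p.mm (j + 1) (h + e)) * p.bb er j := by ring
        _ ≤ (4 ^ h * X / 4) * (er + 3 * ((1 / 4) ^ h * Real.exp (p.κ ^ 2 / 4 * h))) := by gcongr
        _ = 4 ^ h * er * (X / 4) + (4 ^ h * (1 / 4) ^ h) * (3 / 4 * (X * Real.exp (p.κ ^ 2 / 4 * h))) := by ring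
        _ ≤ 4 ^ p.L * er * 1 + 1 * (3 / 4 * (2 * Real.exp (-(p.κ ^ 2 / 4 * p.H)))) := by
          rw [hX3]
          gcongr
          linarith
        _ ≤ _ := by
          have := Real.exp_pos (-(p.κ ^ 2 / 4 * p.H))
          linarith
  unfold Dd
  rw [mul_add, mul_add]
  linarith

theorem sum_Db (hp : p.Ok) {er : ℝ} (her : 0 ≤ er) : ∑ x ∈ univ.filter p.inA, p.Db er x
    ≤ (p.Bmax + 1) * (p.L * (2 * 4 ^ p.L * er + 4 * Real.exp (-(p.κ ^ 2 / 4 * p.H)))) := by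
  have h1 : ∑ x ∈ univ.filter p.inA, p.Db er x
      = ∑ x : (p.Wd × Fin (p.Bmax + 1)) ⊕ Fin p.m, if p.inA x then p.Db er x else 0 := by
    rw [Finset.sum_filter]; rfl
  rw [h1, Fintype.sum_sum_type, Fintype.sum_prod_type]
  have h2 : ∑ x : Fin p.m, (if p.inA (Sum.inr x) then p.Db er (Sum.inr x) else 0) = 0 :=
    Finset.sum_eq_zero fun x _ => if_neg (fun h => h)
  rw [h2, add_zero]
  have h3 : ∀ w ∈ (univ : Finset p.Wd), ∑ j : Fin (p.Bmax + 1),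
      (if p.inA (Sum.inl (w, j)) then p.Db er (Sum.inl (w, j)) else 0)
      ≤ (p.Bmax + 1) * (if p.alive w.1 then p.Dd er w.1.length else 0) := by
    intro w _
    have : ∀ j ∈ (univ : Finset (Fin (p.Bmax + 1))),
        (if p.inA (Sum.inl (w, j)) then p.Db er (Sum.inl (w, j)) else 0)
        ≤ if p.alive w.1 then p.Dd er w.1.length else 0 := by
      intro j _
      by_cases h : p.inA (Sum.inl (w, j))
      · rw [if_pos h, if_pos h.1]; exact le_rfl
      · rw [if_neg h]
        have := Dd_nonneg (p := p) her w.1.length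
        split_ifs
        · exact this
        · exact le_rfl
    refine (Finset.sum_le_sum this).trans ?_
    simp
  refine (Finset.sum_le_sum h3).trans ?_
  rw [← Finset.mul_sum]
  gcongr
  have h4 : ∑ w : p.Wd, (if p.alive w.1 then p.Dd er w.1.length else 0)
      = ∑ w ∈ (univ : Finset p.Wd).filter (fun w => p.alive w.1), p.Dd er w.1.length := by
    rw [Finset.sum_filter]
  rw [h4]
  have h5 : ∑ w ∈ (univ : Finset p.Wd).filter (fun w => p.alive w.1), p.Dd er w.1.length
      = ∑ w ∈ ((univ : Finset p.Wd).filter (fun w => p.alive w.1)).map (Function.Embedding.subtype _),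
        (if p.alive w then p.Dd er w.length else 0) := by
    rw [Finset.sum_map]
    refine Finset.sum_congr rfl fun w hw => ?_
    simp only [mem_filter] at hw
    exact (if_pos hw.2).symm
  rw [h5]
  have h6 : ((univ : Finset p.Wd).filter (fun w => p.alive w.1)).map (Function.Embedding.subtype _)
      ⊆ (range p.L).biUnion wl := by
    intro w hw
    simp only [Finset.mem_map, mem_filter, mem_univ, true_and] at hw
    obtain ⟨u, hu, rfl⟩ := hw
    simp only [mem_biUnion, mem_range, mem_wl]
    exact ⟨_, alive_len hp hu, rfl⟩
  refine (Finset.sum_le_sum_of_subset_of_nonneg h6 ?_).trans ?_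
  · intro w _ _
    have := Dd_nonneg (p := p) her w.length
    split_ifs
    · exact this
    · exact le_rfl
  rw [Finset.sum_biUnion]
  · have h7 : ∀ d ∈ range p.L, ∑ w ∈ wl d, (if p.alive w then p.Dd er w.length else 0)
        ≤ 2 * 4 ^ p.L * er + 4 * Real.exp (-(p.κ ^ 2 / 4 * p.H)) := by
      intro d hd
      refine le_trans (le_of_eq ?_) (na_Dd hp her (mem_range.1 hd))
      unfold na
      rw [Finset.sum_mul]
      refine Finset.sum_congr rfl fun w hw => ?_
      rw [mem_wl] at hw
      rw [hw]; split_ifs <;> simp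
    refine (Finset.sum_le_sum h7).trans (le_of_eq ?_)
    rw [sum_const, card_range, nsmul_eq_mul]
  · intro d _ d' _ hne
    rw [Function.onFun, Finset.disjoint_left]
    intro w h1 h2
    rw [mem_wl] at h1 h2
    exact hne (h1.symm.trans h2)

theorem upper_bound (hp : p.Ok) (ρ er : ℝ)
    (hρ : ρ = #(univ.filter p.inA) / #(univ.filter (fun x => ¬ p.inA x)))
    (her : er = Real.exp (-(2 * p.T)) + (7 + 320 * p.T) * ρ)
    (hs : (p.Bmax + 1) * (p.L * (2 * 4 ^ p.L * er + 4 * Real.exp (-(p.κ ^ 2 / 4 * p.H)))) ≤ 1 / 100)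
    (hT : Real.exp (-(2 * p.T)) * Fintype.card p.VT ≤ 1 / 100) :
    (tvMixUnif (lazyCayleyWP (swS p.Gr) (fun _ => 1)) : ℝ) ≤ 324 * p.T * #(swS p.Gr) := by
  have hE := swS_pos hp
  have hD := dsys_Dsw p.Gr hE
  set N := 2 * (#(swS p.Gr) : ℝ) with hN
  have hN2 := hD.Npos
  have hTp := T_pos hp
  have hρ0 : 0 ≤ ρ := by rw [hρ]; positivity
  have her0 : 0 ≤ er := by rw [her]; positivity
  set t1 := p.T * (2 * #(swS p.Gr)) with ht1
  set t0 := 80 * p.T * (2 * #(swS p.Gr)) with ht0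
  have ht1' : (t1 : ℝ) = p.T * N := by rw [ht1, hN]; push_cast; ring
  have ht0' : (t0 : ℝ) = 80 * p.T * N := by rw [ht0, hN]; push_cast; ring
  have hpw : (1 - 2 / N) ^ t1 ≤ Real.exp (-(2 * p.T)) := by
    have := pow_exp (x := 2 / N) (by rw [div_le_one (by linarith)]; exact hN2) t1
    refine this.trans (le_of_eq ?_)
    congr 2
    rw [ht1']; field_simp
  set err := Real.exp (-(2 * p.T)) + 6 * ρ with herr
  have herr0 : 0 ≤ err := by positivity
  have hKK : ∀ t x y, ¬ p.inA x → ¬ p.inA y → Dsw p.Gr (t1 + t) x y ≤ err := by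
    intro t x y hx hy
    refine (hD.anti t1 t x y).trans ?_
    by_cases hxy : x = y
    · rw [hxy, hD.self]; exact herr0
    · have := KK_lemma p.Gr N (Dsw p.Gr) hD p.inA Gr_clique (fun _ => 1) (fun _ => zero_le_one) 0
        (fun t x k _ _ => hD.le_one _ _ _) t1 x y hx hy hxy
      rw [zero_add] at this
      refine this.trans ?_
      have e1 := etaK_le p.Gr p.inA x
      have e3 := etaK_le p.Gr p.inA y
      rw [← hρ] at e1 e3
      have e2 := sum_etaK_le p.Gr p.inA (fun _ => 1) (fun _ => zero_le_one) (nbrK_le hp)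
      simp only [sum_const, nsmul_eq_mul, mul_one] at e2
      rw [mul_div_assoc, ← hρ] at e2
      linarith
  have hee : err + (1 + 320 * p.T) * ρ = er := by rw [her, herr]; ring
  have phaseA : ∀ t i (w : p.Wd) k, i < p.l → p.alive w.1 → w.1.length = p.cp i - 1 → ¬ p.inA k →
      Dsw p.Gr (t1 + t0 + t) (nd w 0) k ≤ p.bb er i := by
    intro t i w k hi hw hlen hk
    refine (hD.anti (t1 + t0) t _ _).trans ?_
    have hcp := cp_pos hp i
    have hst : p.stt i ≤ w.1.length := by
      unfold stt
      split_ifs with h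
      · omega
      · have := cp_strict hp (show i - 1 < i by omega)
        omega
    have := layer_bd hp hi N (Dsw p.Gr) hD t1 err herr0 (fun x y hx hy => hKK 0 x y hx hy)
      (if i = 0 then 0 else 1) (by split_ifs <;> norm_num)
      (fun t w k _ h0 _ _ => by rw [if_neg h0]; exact hD.le_one _ _ _) ρ hρ t0 ht0' w 0 k
      ⟨hw, by simp⟩ hst (by omega) hk
    rw [hee] at this
    refine this.trans ?_
    unfold bb
    rw [hlen]
    split_ifs <;> linarith
  have phaseB : ∀ t x k, p.inA x → ¬ p.inA k → Dsw p.Gr (t1 + t0 + t0 + t) x k ≤ p.Db er x := by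
    intro t x k hx hk
    refine (hD.anti (t1 + t0 + t0) t _ _).trans ?_
    match x, hx with
    | Sum.inl (w, j), hx =>
      have hL := alive_len hp hx.1
      have hl := lay_lt hp hL
      have h2 := lt_cp_lay hp hL
      set i := p.lay w.1.length with hi
      have hst : p.stt i ≤ w.1.length := by
        unfold stt
        split_ifs with h
        · omega
        · exact cp_le_of_lay hp hL (by omega)
      have := layer_bd hp hl N (Dsw p.Gr) hD (t1 + t0) err herr0 (fun x y hx hy => hKK t0 x y hx hy)
        (if i = 0 then 0 else p.bb er (i - 1))
        (by split_ifs; exacts [le_rfl, bb_nonneg her0 _])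
        (fun t w k hw h0 hlen hk => by
          rw [if_neg h0]
          exact phaseA t (i - 1) w k (by omega) hw hlen hk) ρ hρ t0 ht0' w j k hx hst h2 hk
      rw [hee] at this
      refine this.trans ?_
      change _ ≤ p.Dd er w.1.length
      unfold Dd
      rw [← hi]
      split_ifs <;> linarith
  have hmix := mix_upper p.Gr hE p.inA Gr_clique (nbrK_le hp)
    ⟨p.cl ⟨0, by have := hp.m1; omega⟩, fun h => h⟩ (p.Db er) (Db_nonneg her0)
    (t1 + t0 + t0) t1 phaseB ((sum_Db hp her0).trans hs) ?_
  · have : (tvMixUnif (lazyCayleyWP (swS p.Gr) (fun _ => 1)) : ℝ) ≤ ((t1 + t0 + t0 + t1 : ℕ) : ℝ) := by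
      exact_mod_cast hmix
    refine this.trans (le_of_eq ?_)
    push_cast
    rw [ht1', ht0', hN]; ring
  · refine le_trans ?_ hT
    gcongr

end GP
end upper3


section gener
open Classical
namespace GP
variable {p : GP}

theorem symmGen (hp : p.Ok) : IsSymmGen (swS p.Gr) := by
  refine ⟨one_notMem_swS _, fun s hs => by rw [sq_swS _ hs]; exact hs, ?_⟩
  set C := Subgroup.closure ((swS p.Gr : Finset (Equiv.Perm p.VT)) : Set (Equiv.Perm p.VT)) with hC
  have hadj : ∀ x y, p.Gr.Adj x y → Equiv.swap x y ∈ C := by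
    intro x y h
    apply Subgroup.subset_closure
    exact Finset.mem_coe.2 ((mem_swS _ _).2 ⟨x, y, h, rfl⟩)
  have htr : ∀ x y z, Equiv.swap x y ∈ C → Equiv.swap y z ∈ C → Equiv.swap x z ∈ C := fun x y z h1 h2 =>
    SubmonoidClass.swap_mem_trans C h1 h2
  set k0 : p.VT := p.cl ⟨0, by have := hp.m1; omega⟩ with hk0
  have hK : ∀ x, ¬ p.inA x → Equiv.swap x k0 ∈ C := by
    intro x hx
    by_cases h : x = k0
    · rw [h, Equiv.swap_self]; exact C.one_mem
    · exact hadj _ _ (Gr_clique x k0 hx (fun h => h) h)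
  have hroot : ∀ n (w : p.Wd), p.alive w.1 → p.L ≤ w.1.length + n → Equiv.swap (nd w 0) k0 ∈ C := by
    intro n
    induction n with
    | zero =>
      intro w hw hl
      have := alive_len hp hw
      omega
    | succ n ih =>
      intro w hw hl
      have hL := alive_len hp hw
      have h1 : Equiv.swap (nd w 0) (nd (ch w hL 0) 0) ∈ C :=
        hadj _ _ ((adj_root w hw _).2 (Or.inl ⟨_, ⟨0, rfl⟩, rfl⟩))
      refine htr _ _ _ h1 ?_
      by_cases h : p.alive (ch w hL 0).1
      · exact ih _ h (by simp [ch]; omega)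
      · exact hK _ (fun h' => h h'.1)
  have hall : ∀ x, Equiv.swap x k0 ∈ C := by
    intro x
    by_cases hx : p.inA x
    · match x, hx with
      | Sum.inl (w, j), hx =>
        obtain ⟨hw, hj⟩ := hx
        have hr := hroot p.L w hw (by omega)
        by_cases h0 : j.1 = 0
        · have : j = 0 := Fin.ext h0
          subst this
          exact hr
        · exact htr _ _ _ (hadj (nd w j) (nd w 0) ((adj_pend w hw j (by omega) hj _).2 rfl)) hr
    · exact hK x hx
  rw [eq_top_iff, ← Equiv.Perm.closure_isSwap, Subgroup.closure_le]
  rintro g ⟨x, y, -, rfl⟩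
  exact htr _ _ _ (hall x) (by rw [Equiv.swap_comm]; exact hall y)

end GP
end gener


section transport

theorem lcw_transport {G G' : Type*} [Group G] [Fintype G] [DecidableEq G] [Group G'] [Fintype G']
    [DecidableEq G'] (e : G ≃* G') (S : Finset G) (w : G → ℝ) (x y : G) :
    lazyCayleyWP (S.map e.toEquiv.toEmbedding) (fun g => w (e.symm g)) (e x) (e y)
      = lazyCayleyWP S w x y := by
  unfold lazyCayleyWP
  have h1 : (e y = e x) ↔ (y = x) := e.injective.eq_iff
  have h2 : ((e x)⁻¹ * e y ∈ S.map e.toEquiv.toEmbedding) ↔ x⁻¹ * y ∈ S := by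
    rw [← map_inv, ← map_mul]
    simp only [Finset.mem_map, Equiv.coe_toEmbedding, MulEquiv.toEquiv_eq_coe, MulEquiv.coe_toEquiv]
    constructor
    · rintro ⟨a, ha, h⟩
      rwa [← e.injective h]
    · intro h; exact ⟨_, h, rfl⟩
  have h3 : e.symm ((e x)⁻¹ * e y) = x⁻¹ * y := by
    rw [← map_inv, ← map_mul, MulEquiv.symm_apply_apply]
  have h4 : ∑ r ∈ S.map e.toEquiv.toEmbedding, w (e.symm r) = ∑ r ∈ S, w r := by
    rw [Finset.sum_map]; simp
  simp only [h1, h2, h3, h4]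

theorem mix_transport {G G' : Type*} [Group G] [Fintype G] [DecidableEq G] [Group G'] [Fintype G']
    [DecidableEq G'] (e : G ≃* G') (S : Finset G) (w : G → ℝ) :
    tvMixUnif (lazyCayleyWP (S.map e.toEquiv.toEmbedding) (fun g => w (e.symm g)))
      = tvMixUnif (lazyCayleyWP S w) := by
  set P' := lazyCayleyWP (S.map e.toEquiv.toEmbedding) (fun g => w (e.symm g)) with hP'
  set P := lazyCayleyWP S w with hP
  have hpow : ∀ t x y, (P' ^ t) (e x) (e y) = (P ^ t) x y := by
    intro t
    induction t with
    | zero =>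
      intro x y
      simp [Matrix.one_apply, e.injective.eq_iff]
    | succ t ih =>
      intro x y
      rw [pow_succ, pow_succ, Matrix.mul_apply, Matrix.mul_apply, ← Equiv.sum_comp e.toEquiv]
      refine Finset.sum_congr rfl fun z _ => ?_
      change (P' ^ t) (e x) (e z) * P' (e z) (e y) = _
      rw [ih, hP', lcw_transport]
  have hcard : Fintype.card G' = Fintype.card G := (Fintype.card_congr e.toEquiv).symm
  unfold tvMixUnif
  congr 1
  ext t
  simp only [Set.mem_setOf_eq]
  have hs : ∀ x, ∑ y, |(P' ^ t) (e x) y - 1 / (Fintype.card G' : ℝ)|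
      = ∑ y, |(P ^ t) x y - 1 / (Fintype.card G : ℝ)| := by
    intro x
    rw [← Equiv.sum_comp e.toEquiv]
    refine Finset.sum_congr rfl fun z _ => ?_
    change |(P' ^ t) (e x) (e z) - _| = _
    rw [hpow, hcard]
  constructor
  · intro h x
    rw [← hs]; exact h _
  · intro h x
    have := hs (e.symm x)
    rw [MulEquiv.apply_symm_apply] at this
    rw [this]; exact h _

theorem symmGen_transport {G G' : Type*} [Group G] [Group G'] (e : G ≃* G') (S : Finset G)
    (h : IsSymmGen S) : IsSymmGen (S.map e.toEquiv.toEmbedding) := by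
  obtain ⟨h1, h2, h3⟩ := h
  refine ⟨?_, ?_, ?_⟩
  · intro hc
    simp only [Finset.mem_map, Equiv.coe_toEmbedding, MulEquiv.toEquiv_eq_coe, MulEquiv.coe_toEquiv] at hc
    obtain ⟨a, ha, hh⟩ := hc
    have : a = 1 := by simpa using hh
    exact h1 (this ▸ ha)
  · intro s hs
    simp only [Finset.mem_map, Equiv.coe_toEmbedding, MulEquiv.toEquiv_eq_coe, MulEquiv.coe_toEquiv] at hs ⊢
    obtain ⟨a, ha, rfl⟩ := hs
    exact ⟨a⁻¹, h2 a ha, map_inv e a⟩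
  · have : ((S.map e.toEquiv.toEmbedding : Finset G') : Set G') = (e.toMonoidHom : G → G') '' (S : Set G) := by
      ext x; simp
    rw [this, ← MonoidHom.map_closure, h3]
    rw [← MonoidHom.range_eq_map]
    exact MonoidHom.range_eq_top.2 e.surjective

end transport

section combine
open Classical
namespace GP
variable {p : GP}

theorem card_Wd : Fintype.card p.Wd ≤ 4 ^ (p.L + 1) := by
  have h1 : Fintype.card p.Wd = #((univ : Finset p.Wd).map (Function.Embedding.subtype _)) := by
    rw [Finset.card_map, card_univ]
  have h2 : (univ : Finset p.Wd).map (Function.Embedding.subtype _) ⊆ (range (p.L + 1)).biUnion wl := by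
    intro w hw
    simp only [Finset.mem_map, mem_univ, true_and] at hw
    obtain ⟨u, rfl⟩ := hw
    simp only [mem_biUnion, mem_range, mem_wl]
    exact ⟨_, Nat.lt_succ_of_le u.2, rfl⟩
  rw [h1]
  refine (Finset.card_le_card h2).trans (Finset.card_biUnion_le.trans ?_)
  have h3 : ∀ d, #(wl d) = 4 ^ d := by
    intro d
    have := card_wl d
    simp only [sum_const, nsmul_eq_mul, mul_one] at this
    exact_mod_cast this
  simp only [h3]
  generalize p.L + 1 = n
  induction n with
  | zero => simp
  | succ n ih => rw [Finset.sum_range_succ, pow_succ]; omega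

theorem card_VT : Fintype.card p.VT = Fintype.card p.Wd * (p.Bmax + 1) + p.m := by
  have : Fintype.card p.VT = Fintype.card ((p.Wd × Fin (p.Bmax + 1)) ⊕ Fin p.m) := rfl
  rw [this]; simp

theorem card_A : #(univ.filter p.inA) ≤ Fintype.card p.Wd * (p.Bmax + 1) := by
  have : univ.filter p.inA ⊆ (univ : Finset (p.Wd × Fin (p.Bmax + 1))).image
      (fun x => (Sum.inl x : p.VT)) := by
    intro x hx
    simp only [mem_filter, mem_univ, true_and] at hx
    match x, hx with
    | Sum.inl y, _ => exact Finset.mem_image.2 ⟨y, Finset.mem_univ _, rfl⟩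
  refine (Finset.card_le_card this).trans (Finset.card_image_le.trans ?_)
  simp

theorem card_K : p.m ≤ #(univ.filter (fun x => ¬ p.inA x)) := by
  have : (univ : Finset (Fin p.m)).map ⟨fun i => p.cl i, fun i j h => Sum.inr.inj h⟩
      ⊆ univ.filter (fun x => ¬ p.inA x) := by
    intro x hx
    simp only [Finset.mem_map, mem_univ, true_and] at hx
    obtain ⟨i, rfl⟩ := hx
    simp only [mem_filter, mem_univ, true_and]
    exact fun h => h
  have h := Finset.card_le_card this
  rwa [Finset.card_map, card_univ, Fintype.card_fin] at h

set_option maxHeartbeats 1600000 in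
/-- The gadget gives the desired example for a given size. -/
theorem gadget_main (hp : p.Ok) (n : ℕ) (hn : Fintype.card p.VT = n) (hn2 : 2 ≤ n)
    (Mb : ℝ) (hMb : Mb = 4 ^ (p.L + 1) * (p.Bmax + 1))
    (hMn : Mb ^ 4 * 400000 ≤ n) (hT : Real.log n ≤ p.T)
    (hk : (p.Bmax + 1) * (p.L * (4 * Real.exp (-(p.κ ^ 2 / 4 * p.H)))) ≤ 1 / 200)
    (hsmall : Real.exp (p.l / 4) * (Real.exp (-(p.l : ℝ) / 2) + Real.exp (-(4 * p.aa ^ 2) * p.H / 2)) < 1 / 2) :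
    ∃ S : Finset (Equiv.Perm (Fin n)), ∃ w : Equiv.Perm (Fin n) → ℝ,
        (∀ s ∈ S, Equiv.Perm.IsSwap s) ∧ IsSymmGen S ∧
        (∀ s ∈ S, w s⁻¹ = w s) ∧
        (∀ s ∈ S, 1 ≤ w s ∧ w s ≤ 1 + p.ε) ∧
        p.l / 10368 * (tvMixUnif (lazyCayleyWP S (fun _ => 1)) : ℝ) ≤
        (tvMixUnif (lazyCayleyWP S w) : ℝ) := by
  have hn0 : (0 : ℝ) < n := by positivity
  have hc1 : (Fintype.card p.Wd : ℝ) * (p.Bmax + 1) ≤ Mb := by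
    rw [hMb]; gcongr; exact_mod_cast card_Wd
  have hMb1 : 1 ≤ Mb := by
    rw [hMb]
    have a1 : (1 : ℝ) ≤ 4 ^ (p.L + 1) := one_le_pow₀ (by norm_num)
    have a2 : (0 : ℝ) ≤ p.Bmax := by positivity
    nlinarith
  have hMb4 : Mb ≤ Mb ^ 4 := le_self_pow₀ hMb1 (by norm_num)
  have hA : (#(univ.filter p.inA) : ℝ) ≤ Mb := by
    refine le_trans ?_ hc1
    exact_mod_cast card_A
  have hm : 3 / 4 * (n : ℝ) ≤ p.m := by
    have h1 : (n : ℝ) = (Fintype.card p.Wd : ℝ) * (p.Bmax + 1) + p.m := by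
      rw [← hn, card_VT]; push_cast; ring
    nlinarith
  have hKc : 3 / 4 * (n : ℝ) ≤ #(univ.filter (fun x => ¬ p.inA x)) :=
    hm.trans (by exact_mod_cast card_K)
  have hS := symmGen hp
  have hlow := lower_bound hp hS (by rw [hn]; exact hKc) hsmall
  set ρ : ℝ := #(univ.filter p.inA) / #(univ.filter (fun x => ¬ p.inA x)) with hρ
  have hρ1 : ρ ≤ 2 * Mb / n := by
    rw [hρ, div_le_div_iff₀ (by linarith) hn0]
    have : (#(univ.filter p.inA) : ℝ) * n ≤ Mb * n := by gcongr
    nlinarith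
  have hρ0 : 0 ≤ ρ := by rw [hρ]; positivity
  have hexp : Real.exp (-(2 * p.T)) ≤ 1 / n * (1 / n) := by
    have : Real.exp (-(2 * (p.T : ℝ))) = Real.exp (- p.T) * Real.exp (- p.T) := by
      rw [← Real.exp_add]; congr 1; ring
    rw [this]
    have h1 : Real.exp (-(p.T : ℝ)) ≤ 1 / n := by
      calc Real.exp (-(p.T : ℝ)) ≤ Real.exp (- Real.log n) := Real.exp_le_exp.2 (by linarith)
        _ = 1 / n := by rw [Real.exp_neg, Real.exp_log hn0, one_div]
    exact mul_le_mul h1 h1 (Real.exp_pos _).le (by positivity)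
  have hn4 : (400000 : ℝ) ≤ n := by nlinarith
  have hn5 : (100 : ℝ) ≤ n := le_trans (by norm_num) hn4
  have hn6 : 1 / (n : ℝ) ≤ 1 / 100 := one_div_le_one_div_of_le (by norm_num) hn5
  have hn7 : (1 / (n : ℝ) * (1 / n)) * n = 1 / n := by field_simp
  have hL4 : (p.L : ℝ) ≤ 4 ^ (p.L + 1) := by
    have : p.L + 1 < 4 ^ (p.L + 1) := Nat.lt_pow_self (by norm_num)
    have h2 : p.L ≤ 4 ^ (p.L + 1) := by omega
    exact_mod_cast h2
  have hB0 : (0 : ℝ) ≤ p.Bmax := by positivity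
  have hLM : (p.L : ℝ) ≤ Mb := by
    rw [hMb]
    have : (0 : ℝ) < 4 ^ (p.L + 1) := by positivity
    nlinarith
  have hTM : (p.T : ℝ) ≤ Mb := by
    have e : p.T = p.Bmax * p.H := by unfold T Bmax; rfl
    have hHL : p.H ≤ p.L := by
      have : p.cp 0 ≤ p.cp (p.l - 1) := (cp_strict hp).monotone (Nat.zero_le _)
      simpa [cp, L] using this
    have hHL' : (p.H : ℝ) ≤ p.L := by exact_mod_cast hHL
    rw [e, hMb]
    push_cast
    calc (p.Bmax : ℝ) * p.H ≤ (p.Bmax + 1) * 4 ^ (p.L + 1) := by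
          gcongr
          · linarith
          · linarith
      _ = _ := by ring
  have hup := upper_bound hp ρ _ hρ rfl ?_ ?_
  · let e : Equiv.Perm p.VT ≃* Equiv.Perm (Fin n) :=
      (Fintype.equivFinOfCardEq hn).permCongrHom
    refine ⟨(swS p.Gr).map e.toEquiv.toEmbedding, fun g => p.wtS (e.symm g), ?_,
      symmGen_transport e _ hS, ?_, ?_, ?_⟩
    · intro s hs
      simp only [Finset.mem_map, Equiv.coe_toEmbedding, MulEquiv.toEquiv_eq_coe, MulEquiv.coe_toEquiv] at hs
      obtain ⟨a, ha, rfl⟩ := hs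
      rw [mem_swS] at ha
      obtain ⟨x, y, hxy, rfl⟩ := ha
      refine ⟨Fintype.equivFinOfCardEq hn x, Fintype.equivFinOfCardEq hn y, ?_, ?_⟩
      · exact fun h => hxy.ne ((Fintype.equivFinOfCardEq hn).injective h)
      · have := Equiv.symm_trans_swap_trans x y (Fintype.equivFinOfCardEq hn)
        rw [← this]
        rfl
    · intro s hs
      simp only [Finset.mem_map, Equiv.coe_toEmbedding, MulEquiv.toEquiv_eq_coe, MulEquiv.coe_toEquiv] at hs
      obtain ⟨a, ha, rfl⟩ := hs
      rw [← map_inv, sq_swS _ ha]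
    · intro s _
      exact wtS_ge hp _
    · have h1 := mix_transport e (swS p.Gr) p.wtS
      have h2 := mix_transport e (swS p.Gr) (fun _ => 1)
      rw [h1, h2]
      refine le_trans ?_ hlow
      have hl : (0 : ℝ) ≤ p.l / 10368 := by positivity
      have := mul_le_mul_of_nonneg_left hup hl
      refine this.trans (le_of_eq ?_)
      ring
  · have hX : (p.Bmax + 1) * ((p.L : ℝ) * (2 * 4 ^ p.L)) ≤ Mb * Mb := by
      have e : Mb = 4 * 4 ^ p.L * (p.Bmax + 1) := by rw [hMb, pow_succ]; ring
      calc (p.Bmax + 1) * ((p.L : ℝ) * (2 * 4 ^ p.L)) = p.L * (2 * 4 ^ p.L * (p.Bmax + 1)) := by ring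
        _ ≤ Mb * (4 * 4 ^ p.L * (p.Bmax + 1)) := by gcongr; norm_num
        _ = Mb * Mb := by rw [← e]
    set er := Real.exp (-(2 * p.T)) + (7 + 320 * p.T) * ρ with her
    have her0 : 0 ≤ er := by positivity
    have her1 : er ≤ 700 * (Mb * Mb) / n := by
      have h1 : (7 + 320 * (p.T : ℝ)) * ρ ≤ 327 * Mb * (2 * Mb / n) := by
        apply mul_le_mul _ hρ1 hρ0 (by positivity)
        linarith
      have h2 : Real.exp (-(2 * p.T)) ≤ (Mb * Mb) / n := by
        refine hexp.trans ?_
        rw [div_mul_eq_mul_div, one_mul]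
        gcongr
        have : 1 / (n : ℝ) ≤ 1 := by rw [div_le_one hn0]; linarith
        nlinarith
      calc er ≤ (Mb * Mb) / n + 327 * Mb * (2 * Mb / n) := add_le_add h2 h1
        _ = 655 * (Mb * Mb / n) := by ring
        _ ≤ 700 * (Mb * Mb / n) := by gcongr; norm_num
        _ = _ := by ring
    have hY : (p.Bmax + 1) * ((p.L : ℝ) * (2 * 4 ^ p.L * er)) ≤ 1 / 200 := by
      calc (p.Bmax + 1) * ((p.L : ℝ) * (2 * 4 ^ p.L * er)) = (p.Bmax + 1) * ((p.L : ℝ) * (2 * 4 ^ p.L)) * er := by ring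
        _ ≤ Mb * Mb * (700 * (Mb * Mb) / n) := by gcongr
        _ = 700 * Mb ^ 4 / n := by ring
        _ ≤ 1 / 200 := by
          rw [div_le_div_iff₀ hn0 (by norm_num)]
          linarith
    calc _ = (p.Bmax + 1) * ((p.L : ℝ) * (2 * 4 ^ p.L * er))
          + (p.Bmax + 1) * (p.L * (4 * Real.exp (-(p.κ ^ 2 / 4 * p.H)))) := by ring
      _ ≤ 1 / 100 := by linarith
  · rw [hn]
    exact (mul_le_mul_of_nonneg_right hexp hn0.le).trans (hn7.le.trans hn6)

end GP
end combine


section final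
namespace GP

theorem q_pow_le (x F s u : ℝ) (q l : ℕ) (hF : 1 ≤ F) (hFx : F ≤ 2 * x) (hs : 0 < s)
    (hs4 : s ^ 4 = F / x) (hq1 : 1 ≤ q) (hq : (q : ℝ) ≤ 1000000 / s ^ 2) (hl : (l : ℝ) ≤ F / 240)
    (hu : 0 < u) (hx : x = 8 * Real.log u) : (q : ℝ) ^ l ≤ u := by
  have hx0 : 0 < x := by linarith
  have hF0 : 0 < F := by linarith
  have hq0 : (0 : ℝ) < q := by exact_mod_cast hq1
  have hlq0 : 0 ≤ Real.log q := Real.log_nonneg (by exact_mod_cast hq1)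
  have h14 : Real.log 1000000 ≤ 14 := by
    rw [Real.log_le_iff_le_exp (by norm_num)]
    have h1 : (2.7 : ℝ) ≤ Real.exp 1 := by have := Real.exp_one_gt_d9; linarith
    have e : Real.exp 14 = Real.exp 1 ^ 14 := by rw [← Real.exp_nat_mul]; norm_num
    rw [e]
    exact le_trans (by norm_num) (pow_le_pow_left₀ (by norm_num) h1 14)
  have hls : 4 * Real.log s = Real.log F - Real.log x := by
    rw [← Real.log_div hF0.ne' hx0.ne', ← hs4, Real.log_pow]; norm_num
  have hlxF : Real.log x - Real.log F ≤ x / F := by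
    rw [← Real.log_div hx0.ne' hF0.ne']
    have := Real.log_le_sub_one_of_pos (div_pos hx0 hF0)
    linarith
  have hlq : Real.log q ≤ 14 + x / F / 2 := by
    have h1 := Real.log_le_log hq0 hq
    rw [Real.log_div (by norm_num) (by positivity), Real.log_pow] at h1
    push_cast at h1
    linarith
  have hmain : l * Real.log q ≤ Real.log u := by
    calc l * Real.log q ≤ F / 240 * (14 + x / F / 2) := by
          apply mul_le_mul hl hlq hlq0 (by positivity)
      _ = F * 14 / 240 + x / 480 := by field_simp; ring
      _ ≤ Real.log u := by linarith
  calc (q : ℝ) ^ l = Real.exp (l * Real.log q) := by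
        rw [Real.exp_nat_mul, Real.exp_log hq0]
    _ ≤ Real.exp (Real.log u) := Real.exp_le_exp.2 hmain
    _ = u := Real.exp_log hu

theorem pow_arith (u : ℝ) (hu : 10000 ≤ u) : 4 * (2 * u ^ 5 + 2 + u) + u ≤ u ^ 8 := by
  have h5 : u ≤ u ^ 5 := le_self_pow₀ (by linarith) (by norm_num)
  have h8 : u ^ 8 = u ^ 5 * u ^ 3 := by ring
  have h3 : u ≤ u ^ 3 := le_self_pow₀ (by linarith) (by norm_num)
  have h9 : u ^ 5 * 10000 ≤ u ^ 5 * u ^ 3 :=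
    mul_le_mul_of_nonneg_left (by linarith) (by linarith)
  linarith

set_option maxHeartbeats 2000000 in
theorem params (n : ℕ) (F x u : ℝ) (hF : 2160 ≤ F) (hFx : F ≤ 2 * x) (hx : x = 8 * Real.log u)
    (hxu : x ≤ u) (hu : 10000 ≤ u) (hue : 2400 * u ^ 14 ≤ Real.exp u) (hn : Real.log n = u ^ 8) :
    ∃ S : Finset (Equiv.Perm (Fin n)), ∃ w : Equiv.Perm (Fin n) → ℝ,
        (∀ s ∈ S, Equiv.Perm.IsSwap s) ∧ IsSymmGen S ∧
        (∀ s ∈ S, w s⁻¹ = w s) ∧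
        (∀ s ∈ S, 1 ≤ w s ∧ w s ≤ 1 + (F / x) ^ ((1 : ℝ) / 4)) ∧
        F / 10000000 * (tvMixUnif (lazyCayleyWP S (fun _ => 1)) : ℝ) ≤
        (tvMixUnif (lazyCayleyWP S w) : ℝ) := by
  have hx0 : 0 < x := by linarith
  have hu0 : 0 < u := by linarith
  have hr0 : 0 < F / x := by positivity
  obtain ⟨s, hs⟩ : ∃ s : ℝ, s = (F / x) ^ ((1 : ℝ) / 4) := ⟨_, rfl⟩
  have hs0 : 0 < s := by rw [hs]; exact Real.rpow_pos_of_pos hr0 _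
  have hs4 : s ^ 4 = F / x := by
    rw [hs, ← Real.rpow_natCast, ← Real.rpow_mul hr0.le]; norm_num
  have hs4' : s ^ 4 ≤ 2 := by
    rw [hs4, div_le_iff₀ hx0]; exact hFx
  have hs2 : s ^ 2 ≤ 2 := by nlinarith [sq_nonneg (s ^ 2 - 1), sq_nonneg (s^2)]
  have hs1 : s ≤ 2 := by nlinarith
  have hsu : 1 / u ≤ s ^ 2 := by
    have h1 : 1 / u ≤ s ^ 4 := by
      rw [hs4, div_le_div_iff₀ hu0 hx0]; nlinarith
    have h2 : 1 / u ≤ 1 := by rw [div_le_one hu0]; linarith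
    have h3 : 0 < 1 / u := by positivity
    by_contra h
    push Not at h
    nlinarith [sq_nonneg s]
  rw [← hs]
  obtain ⟨q, hqd⟩ : ∃ q : ℕ, q = ⌈360448 / s ^ 2⌉₊ := ⟨_, rfl⟩
  have hqs : 360448 / s ^ 2 ≤ q := by rw [hqd]; exact Nat.le_ceil _
  have hqs' : (q : ℝ) ≤ 1000000 / s ^ 2 := by
    have h1 : (q : ℝ) < 360448 / s ^ 2 + 1 := by
      rw [hqd]; exact Nat.ceil_lt_add_one (by positivity)
    have h2 : 1 ≤ 2 / s ^ 2 := by rw [le_div_iff₀ (by positivity)]; linarith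
    have h3 : 1000000 / s ^ 2 = 360448 / s ^ 2 + 319776 * (2 / s ^ 2) := by field_simp; norm_num
    linarith
  have hq2' : (2 : ℝ) ≤ q := by
    refine le_trans ?_ hqs
    rw [le_div_iff₀ (by positivity)]; linarith
  have hq2 : 2 ≤ q := by exact_mod_cast hq2'
  obtain ⟨l, hld⟩ : ∃ l : ℕ, l = ⌊F / 240⌋₊ := ⟨_, rfl⟩
  have hl1 : (l : ℝ) ≤ F / 240 := by rw [hld]; exact Nat.floor_le (by positivity)
  have hl2 : F / 240 < l + 1 := by rw [hld]; exact Nat.lt_floor_add_one _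
  have hl8' : (7 : ℝ) < l := by linarith
  have hl8 : 8 ≤ l := by
    have : 7 < l := by exact_mod_cast hl8'
    omega
  have hql : (q : ℝ) ^ l ≤ u :=
    q_pow_le x F s u q l (by linarith) hFx hs0 hs4 (by omega) hqs' hl1 hu0 hx
  have hql1 : (q : ℝ) ^ (l - 1) ≤ u :=
    le_trans (pow_le_pow_right₀ (by linarith) (Nat.sub_le _ _)) hql
  have hqu : (q : ℝ) ≤ u := le_trans (le_self_pow₀ (by linarith) (by omega)) hql
  have hq11 : (1 : ℝ) ≤ (q : ℝ) ^ (l - 1) := one_le_pow₀ (by linarith)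
  obtain ⟨H, hHd⟩ : ∃ H : ℕ, H = ⌊u ^ 4⌋₊ := ⟨_, rfl⟩
  have hH1 : (H : ℝ) ≤ u ^ 4 := by rw [hHd]; exact Nat.floor_le (by positivity)
  have hu4 : 10000 ≤ u ^ 4 := hu.trans (le_self_pow₀ (by linarith) (by norm_num))
  have hH2 : u ^ 4 / 2 ≤ H := by
    have : u ^ 4 < H + 1 := by rw [hHd]; exact Nat.lt_floor_add_one _
    linarith
  have hH8' : (8 : ℝ) ≤ H := by linarith
  have hH8 : 8 ≤ H := by exact_mod_cast hH8'
  obtain ⟨b, hbd⟩ : ∃ b : ℕ, b = ⌈u ^ 8⌉₊ := ⟨_, rfl⟩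
  have hb1 : u ^ 8 ≤ b := by rw [hbd]; exact Nat.le_ceil _
  have hb2 : (b : ℝ) < u ^ 8 + 1 := by rw [hbd]; exact Nat.ceil_lt_add_one (by positivity)
  have huu8 : u ≤ u ^ 8 := le_self_pow₀ (by linarith) (by norm_num)
  have hqb : q ≤ b := by
    have : (q : ℝ) ≤ b := by linarith
    exact_mod_cast this
  -- sizes
  have hLle : (H : ℝ) * (q : ℝ) ^ (l - 1) ≤ u ^ 5 := by
    calc (H : ℝ) * (q : ℝ) ^ (l - 1) ≤ u ^ 4 * u := by gcongr
      _ = u ^ 5 := by ring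
  have hBle : (b : ℝ) * (q : ℝ) ^ (l - 1) + 1 ≤ 3 * u ^ 9 := by
    have h1 : (b : ℝ) * (q : ℝ) ^ (l - 1) ≤ (2 * u ^ 8) * u := by
      gcongr; linarith
    have h2 : 1 ≤ u ^ 9 := one_le_pow₀ (by linarith)
    nlinarith
  have hBexp : 3 * u ^ 9 ≤ Real.exp u := by
    refine le_trans ?_ hue
    have : u ^ 9 ≤ u ^ 14 := pow_le_pow_right₀ (by linarith) (by norm_num)
    have : 0 ≤ u ^ 9 := by positivity
    linarith
  have hn0 : (0 : ℝ) < n := by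
    rcases Nat.eq_zero_or_pos n with h | h
    · rw [h] at hn; simp at hn; exact absurd hn (pow_pos hu0 8).ne
    · exact_mod_cast h
  have hnexp : (n : ℝ) = Real.exp (u ^ 8) := by rw [← hn, Real.exp_log hn0]
  have hκH : 2 * u ≤ (s / 2 / 32) ^ 2 / 4 * H := by
    have h1 : 1 / u / 4096 / 4 * (u ^ 4 / 2) ≤ (s / 2 / 32) ^ 2 / 4 * H := by
      have e : (s / 2 / 32) ^ 2 / 4 = s ^ 2 / 4096 / 4 := by ring
      rw [e]
      gcongr
    have h2 : 1 / u / 4096 / 4 * (u ^ 4 / 2) = u * u ^ 2 / 32768 := by field_simp; norm_num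
    rw [h2] at h1
    refine le_trans ?_ h1
    rw [le_div_iff₀ (by norm_num)]
    have h3 : (65536 : ℝ) ≤ u ^ 2 := le_trans (by norm_num) (pow_le_pow_left₀ (by norm_num) hu 2)
    calc 2 * u * 32768 = u * 65536 := by ring
      _ ≤ u * u ^ 2 := mul_le_mul_of_nonneg_left h3 hu0.le
  -- the gadget, first with dummy m
  let p0 : GP := ⟨H, q, l, b, 0, s / 2⟩
  have hWd : (Fintype.card p0.Wd : ℝ) ≤ 4 ^ (p0.L + 1) := by exact_mod_cast card_Wd
  obtain ⟨Mb, hMb⟩ : ∃ Mb : ℝ, Mb = 4 ^ (p0.L + 1) * ((p0.Bmax : ℝ) + 1) := ⟨_, rfl⟩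
  have hL0 : (p0.L : ℝ) = (H : ℝ) * (q : ℝ) ^ (l - 1) := by
    simp only [L, cp, p0]; push_cast; rfl
  have hB0 : (p0.Bmax : ℝ) = (b : ℝ) * (q : ℝ) ^ (l - 1) := by
    simp only [Bmax, p0]; push_cast; rfl
  have hMb1 : Mb ≤ Real.exp (2 * u ^ 5 + 2 + u) := by
    have h1 := four_pow_le (p0.L + 1)
    push_cast at h1
    have h2 : Real.exp (2 * ((p0.L : ℝ) + 1)) ≤ Real.exp (2 * u ^ 5 + 2) :=
      Real.exp_le_exp.2 (by rw [hL0]; linarith)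
    rw [hMb, Real.exp_add]
    refine mul_le_mul (h1.trans h2) ?_ (by positivity) (by positivity)
    rw [hB0]; linarith
  have hMb0 : 1 ≤ Mb := by
    rw [hMb]
    have a1 : (1 : ℝ) ≤ 4 ^ (p0.L + 1) := one_le_pow₀ (by norm_num)
    have a2 : (0 : ℝ) ≤ p0.Bmax := by positivity
    nlinarith
  have hMbn : Mb ^ 4 * 400000 ≤ n := by
    have h1 : (400000 : ℝ) ≤ Real.exp u := by
      refine le_trans ?_ hue
      have : u ≤ u ^ 14 := le_self_pow₀ (by linarith) (by norm_num)
      linarith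
    have h2 : Mb ^ 4 ≤ Real.exp (4 * (2 * u ^ 5 + 2 + u)) := by
      have : Real.exp (4 * (2 * u ^ 5 + 2 + u)) = Real.exp (2 * u ^ 5 + 2 + u) ^ 4 := by
        rw [← Real.exp_nat_mul]; norm_num
      rw [this]; exact pow_le_pow_left₀ (by linarith) hMb1 4
    calc Mb ^ 4 * 400000 ≤ Real.exp (4 * (2 * u ^ 5 + 2 + u)) * Real.exp u := by gcongr
      _ = Real.exp (4 * (2 * u ^ 5 + 2 + u) + u) := (Real.exp_add _ _).symm
      _ ≤ Real.exp (u ^ 8) := by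
        apply Real.exp_le_exp.2
        exact pow_arith u hu
      _ = n := hnexp.symm
  have hMb4 : Mb ≤ Mb ^ 4 := le_self_pow₀ hMb0 (by norm_num)
  have hcard : (Fintype.card p0.Wd : ℝ) * (p0.Bmax + 1) ≤ Mb := by
    rw [hMb]; gcongr
  have hnle : Fintype.card p0.Wd * (p0.Bmax + 1) + 2 ≤ n := by
    have : ((Fintype.card p0.Wd * (p0.Bmax + 1) + 2 : ℕ) : ℝ) ≤ n := by
      push_cast; linarith
    exact_mod_cast this
  let p : GP := ⟨H, q, l, b, n - Fintype.card p0.Wd * (p0.Bmax + 1), s / 2⟩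
  have hok : p.Ok := by
    refine ⟨hH8, hq2, ?_, hqb, ?_, ?_, ?_, ?_⟩
    · change 1 ≤ l; omega
    · change 2 ≤ n - Fintype.card p0.Wd * (p0.Bmax + 1); omega
    · change 0 < s / 2; linarith
    · change s / 2 ≤ 1; linarith
    · change 88 ≤ (q : ℝ) * (s / 2 / 32) ^ 2
      rw [div_le_iff₀ (by positivity)] at hqs
      nlinarith
  have hcVT : Fintype.card p.VT = n := by
    rw [card_VT]
    change Fintype.card p0.Wd * (p0.Bmax + 1) + (n - Fintype.card p0.Wd * (p0.Bmax + 1)) = n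
    omega
  have hmain := gadget_main hok n hcVT (by omega) Mb hMb hMbn ?_ ?_ ?_
  · obtain ⟨S, w, h1, h2, h3, h4, h5⟩ := hmain
    refine ⟨S, w, h1, h2, h3, ?_, ?_⟩
    · intro g hg
      refine ⟨(h4 g hg).1, (h4 g hg).2.trans ?_⟩
      change 1 + s / 2 ≤ 1 + s
      linarith
    · refine le_trans ?_ h5
      refine mul_le_mul_of_nonneg_right ?_ (by positivity)
      change F / 10000000 ≤ (l : ℝ) / 10368
      linarith
  · rw [hn]
    have : (p.T : ℝ) = (b : ℝ) * (q : ℝ) ^ (l - 1) * H := by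
      simp only [T, p]; push_cast; rfl
    rw [this]
    have hb0 : (0 : ℝ) ≤ b := by positivity
    calc u ^ 8 ≤ (b : ℝ) * 1 * 1 := by linarith
      _ ≤ _ := by gcongr; linarith
  · change ((p0.Bmax : ℝ) + 1) * ((p0.L : ℝ) * (4 * Real.exp (-((s / 2 / 32) ^ 2 / 4 * H)))) ≤ 1 / 200
    rw [hB0, hL0]
    calc ((b : ℝ) * (q : ℝ) ^ (l - 1) + 1) * ((H : ℝ) * (q : ℝ) ^ (l - 1) *
          (4 * Real.exp (-((s / 2 / 32) ^ 2 / 4 * H))))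
        ≤ (3 * u ^ 9) * (u ^ 5 * (4 * Real.exp (-u))) := by
          have : Real.exp (-((s / 2 / 32) ^ 2 / 4 * H)) ≤ Real.exp (-u) :=
            Real.exp_le_exp.2 (by linarith)
          gcongr
      _ = 12 * u ^ 14 / Real.exp u := by rw [Real.exp_neg]; field_simp; ring
      _ ≤ 1 / 200 := by
        rw [div_le_div_iff₀ (Real.exp_pos _) (by norm_num)]
        linarith
  · change Real.exp ((l : ℝ) / 4) * (Real.exp (-(l : ℝ) / 2) +
      Real.exp (-(4 * (s / 2 / 64) ^ 2) * H / 2)) < 1 / 2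
    rw [mul_add, ← Real.exp_add, ← Real.exp_add]
    have hlu : (l : ℝ) ≤ u := by linarith
    have hl8'' : (8 : ℝ) ≤ l := by exact_mod_cast hl8
    have e4 : Real.exp (-2) < 1 / 4 := by
      have h1 : (2.7 : ℝ) ≤ Real.exp 1 := by have := Real.exp_one_gt_d9; linarith
      have e : Real.exp 2 = Real.exp 1 * Real.exp 1 := by rw [← Real.exp_add]; norm_num
      rw [Real.exp_neg, ← one_div]
      apply one_div_lt_one_div_of_lt (by norm_num)
      rw [e]; nlinarith
    have a1 : Real.exp ((l : ℝ) / 4 + -(l : ℝ) / 2) ≤ Real.exp (-2) :=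
      Real.exp_le_exp.2 (by linarith)
    have a2 : Real.exp ((l : ℝ) / 4 + -(4 * (s / 2 / 64) ^ 2) * H / 2) ≤ Real.exp (-2) := by
      apply Real.exp_le_exp.2
      have : (4 * (s / 2 / 64) ^ 2) * H / 2 = 2 * ((s / 2 / 32) ^ 2 / 4 * H) := by ring
      linarith
    linarith

end GP

theorem f_bound (f : ℕ → ℝ)
    (hfbd : ∀ᶠ n in atTop, 1 ≤ f n ∧ f n ≤ Real.log (Real.log (Real.log (n : ℝ)))) :
    ∀ᶠ n : ℕ in atTop, f n.factorial ≤ 2 * Real.log (Real.log n) := by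
  have hfac : Tendsto Nat.factorial atTop atTop := tendsto_atTop_mono Nat.self_le_factorial tendsto_id
  have hlog : Tendsto (fun n : ℕ => Real.log n) atTop atTop :=
    Real.tendsto_log_atTop.comp tendsto_natCast_atTop_atTop
  have hll : Tendsto (fun n : ℕ => Real.log (Real.log n)) atTop atTop :=
    Real.tendsto_log_atTop.comp hlog
  have hl1 := hlog.comp hfac
  have hl2 := hll.comp hfac
  filter_upwards [hfac.eventually hfbd, hlog.eventually_ge_atTop 1, hll.eventually_ge_atTop 1,
    hl1.eventually_ge_atTop 1, hl2.eventually_ge_atTop 1, eventually_ge_atTop 1]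
    with n h1 h2 h3 h4 h5 h6
  simp only [Function.comp] at h4 h5
  have hn0 : (0 : ℝ) < n := by exact_mod_cast h6
  have hf0 : (0 : ℝ) < n.factorial := by exact_mod_cast n.factorial_pos
  refine h1.2.trans ?_
  have a1 : Real.log n.factorial ≤ n * Real.log n := by
    rw [← Real.log_pow]
    apply Real.log_le_log hf0
    exact_mod_cast Nat.factorial_le_pow n
  have a2 : Real.log (Real.log n.factorial) ≤ 2 * Real.log n := by
    have := Real.log_le_log (by linarith) a1
    rw [Real.log_mul hn0.ne' (by linarith)] at this
    have b := Real.log_le_sub_one_of_pos (show 0 < Real.log n by linarith)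
    linarith
  have a3 := Real.log_le_log (by linarith) a2
  rw [Real.log_mul (by norm_num) (by linarith)] at a3
  have := Real.log_two_lt_d9
  linarith

end final

/-- Theorem B (discrete time): weights `1 ≤ w ≤ 1 + (f(n!)/log log n)^{1/4}` on a set of
transpositions generating `Sym(n)` can increase the mixing time by a factor `f(n!)`. -/
theorem mixing_sensitive_under_small_weights (f : ℕ → ℝ)
    (hftop : Tendsto f atTop atTop)
    (hfbd : ∀ᶠ n in atTop, 1 ≤ f n ∧ f n ≤ Real.log (Real.log (Real.log (n : ℝ)))) :
    ∃ c > (0 : ℝ), ∃ N : ℕ, ∀ n : ℕ, N ≤ n →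
      ∃ S : Finset (Equiv.Perm (Fin n)), ∃ w : Equiv.Perm (Fin n) → ℝ,
        (∀ s ∈ S, Equiv.Perm.IsSwap s) ∧ IsSymmGen S ∧
        (∀ s ∈ S, w s⁻¹ = w s) ∧
        (∀ s ∈ S, 1 ≤ w s ∧
          w s ≤ 1 + (f n.factorial / Real.log (Real.log (n : ℝ))) ^ ((1 : ℝ) / 4)) ∧
        (tvMixUnif (lazyCayleyWP S w) : ℝ) ≥
          c * (tvMixUnif (lazyCayleyWP S (fun _ => 1)) : ℝ) * f n.factorial := by
  have hfac : Tendsto Nat.factorial atTop atTop := tendsto_atTop_mono Nat.self_le_factorial tendsto_id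
  have hlog : Tendsto (fun n : ℕ => Real.log n) atTop atTop :=
    Real.tendsto_log_atTop.comp tendsto_natCast_atTop_atTop
  have hu : Tendsto (fun n : ℕ => (Real.log n) ^ ((1 : ℝ) / 8)) atTop atTop :=
    (tendsto_rpow_atTop (by norm_num)).comp hlog
  have e1 : ∀ᶠ u : ℝ in atTop, 2400 * u ^ 14 ≤ Real.exp u := by
    have := (Real.tendsto_exp_div_pow_atTop 14).eventually_ge_atTop 2400
    filter_upwards [this, eventually_gt_atTop 0] with u h1 h2
    rwa [le_div_iff₀ (by positivity)] at h1
  have e2 : ∀ᶠ u : ℝ in atTop, 8 * Real.log u ≤ u := by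
    have := Real.isLittleO_log_id_atTop.bound (show (0 : ℝ) < 1 / 8 by norm_num)
    filter_upwards [this, eventually_gt_atTop 0] with u h1 h2
    simp only [id, Real.norm_eq_abs, abs_of_pos h2] at h1
    have := le_abs_self (Real.log u)
    linarith
  have key : ∀ᶠ n : ℕ in atTop, ∃ S : Finset (Equiv.Perm (Fin n)), ∃ w : Equiv.Perm (Fin n) → ℝ,
        (∀ s ∈ S, Equiv.Perm.IsSwap s) ∧ IsSymmGen S ∧
        (∀ s ∈ S, w s⁻¹ = w s) ∧
        (∀ s ∈ S, 1 ≤ w s ∧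
          w s ≤ 1 + (f n.factorial / Real.log (Real.log (n : ℝ))) ^ ((1 : ℝ) / 4)) ∧
        (tvMixUnif (lazyCayleyWP S w) : ℝ) ≥
          1 / 10000000 * (tvMixUnif (lazyCayleyWP S (fun _ => 1)) : ℝ) * f n.factorial := by
    filter_upwards [f_bound f hfbd, (hftop.comp hfac).eventually_ge_atTop 2160,
      hu.eventually e1, hu.eventually e2, hu.eventually_ge_atTop 10000, hlog.eventually_ge_atTop 1]
      with n h1 h2 h3 h4 h5 h6
    have hl0 : 0 < Real.log n := by linarith
    have hxe : Real.log (Real.log n) = 8 * Real.log ((Real.log n) ^ ((1 : ℝ) / 8)) := by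
      rw [Real.log_rpow hl0]; ring
    obtain ⟨S, w, a1, a2, a3, a4, a5⟩ := GP.params n (f n.factorial) (Real.log (Real.log n))
      ((Real.log n) ^ ((1 : ℝ) / 8)) h2 h1 hxe (by rw [hxe]; exact h4) h5 h3 (by
        rw [← Real.rpow_natCast, ← Real.rpow_mul hl0.le]; norm_num)
    refine ⟨S, w, a1, a2, a3, a4, ?_⟩
    refine ge_iff_le.2 (le_trans (le_of_eq ?_) a5)
    ring
  obtain ⟨N, hN⟩ := eventually_atTop.1 key
  exact ⟨1 / 10000000, by norm_num, N, fun n hn => hN n hn⟩
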